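/- Let S be an (n-1)-sphere embedded in S^n and H a connected component of S^n \ S. If the closure of H is a topological manifold with boundary, then the closure of H is homeomorphic to the closed n-ball. -/

import Mathlib

/-- `X` is an `n`-dimensional topological manifold with boundary: a second-countable
Hausdorff space in which every point has an open neighborhood homeomorphic to an open
subset of the closed half-space of dimension `n`. -/
def IsTopManifoldWithBoundary (n : ℕ) [NeZero n] (X : Type*) [TopologicalSpace X] : Prop :=
  SecondCountableTopology X ∧ T2Space X ∧
    ∀ x : X, ∃ U : Set X, x ∈ U ∧ IsOpen U ∧
      ∃ V : Set (EuclideanHalfSpace n), IsOpen V ∧ Nonempty (U ≃ₜ V)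

section
open Set Metric Filter Topology MeasureTheory

/-- Euclidean space of dimension `n`. -/
abbrev Eu (n : ℕ) : Type := EuclideanSpace ℝ (Fin n)

namespace Cantrell

theorem exists_interp_weights {n : ℕ} (t : Fin (n + 1) → ℝ) (ht : Function.Injective t) :
    ∃ c : Fin (n + 1) → ℝ, (∑ i, c i = 1) ∧
      ∀ M : Eu n →L[ℝ] Eu n,
        (ContinuousLinearMap.id ℝ (Eu n) + M).det =
          ∑ i, c i * (ContinuousLinearMap.id ℝ (Eu n) + t i • M).det := by
  classical
  refine ⟨fun i => (Lagrange.basis Finset.univ t i).eval 1, ?_, ?_⟩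
  · rw [← Polynomial.eval_finsetSum, Lagrange.sum_basis ht.injOn Finset.univ_nonempty]
    simp
  · intro M
    let b := (EuclideanSpace.basisFun (Fin n) ℝ).toBasis
    let A : Matrix (Fin n) (Fin n) ℝ := LinearMap.toMatrix b b (M : Eu n →ₗ[ℝ] Eu n)
    let p : Polynomial ℝ := Matrix.det
      ((Polynomial.X : Polynomial ℝ) • A.map Polynomial.C + (1 : Matrix (Fin n) (Fin n) ℝ).map Polynomial.C)
    have hp : ∀ s : ℝ, p.eval s = (ContinuousLinearMap.id ℝ (Eu n) + s • M).det := by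
      intro s
      have h1 : p.eval s = Matrix.det (s • A + 1) := by
        change Polynomial.evalRingHom s p = _
        rw [RingHom.map_det]
        congr 1
        ext i j
        simp [Matrix.one_apply]
        split_ifs <;> simp [mul_comm]
      rw [h1]
      change _ = LinearMap.det ((ContinuousLinearMap.id ℝ (Eu n) + s • M : Eu n →L[ℝ] Eu n) : Eu n →ₗ[ℝ] Eu n)
      rw [← LinearMap.det_toMatrix b]
      congr 1
      simp only [ContinuousLinearMap.toLinearMap_add, ContinuousLinearMap.toLinearMap_smul, map_add, map_smul, A]
      rw [add_comm]
      congr 1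
      exact (LinearMap.toMatrix_id b).symm
    have hdeg : p.degree < (Finset.univ : Finset (Fin (n+1))).card := by
      have h := Polynomial.natDegree_det_X_add_C_le A (1 : Matrix (Fin n) (Fin n) ℝ)
      refine lt_of_le_of_lt Polynomial.degree_le_natDegree ?_
      rw [Finset.card_univ, Fintype.card_fin]
      rw [Fintype.card_fin] at h
      exact_mod_cast Nat.lt_succ_of_le h
    have key := Lagrange.eq_interpolate_of_eval_eq (s := Finset.univ) (v := t)
      (r := fun i => p.eval (t i)) (f := p) ht.injOn hdeg (fun i _ => rfl)
    have h1 := hp 1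
    rw [one_smul] at h1
    rw [← h1, key, Lagrange.interpolate_apply, Polynomial.eval_finsetSum]
    refine Finset.sum_congr rfl fun i _ => ?_
    rw [← hp]
    simp [mul_comm]

theorem det_eq_zero_of_norm_one {n : ℕ} {g : Eu n → Eu n} (x : Eu n)
    (hg : DifferentiableAt ℝ g x) (h1 : ∀ y, ‖g y‖ = 1) : (fderiv ℝ g x).det = 0 := by
  by_contra hdet
  have hsurj : Function.Surjective (fderiv ℝ g x) := by
    have := (LinearMap.equivOfDetNeZero _ hdet).surjective
    exact this
  obtain ⟨u, hu⟩ := hsurj (g x)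
  have h2 : HasFDerivAt (fun y => inner ℝ (g y) (g y)) _ x := hg.hasFDerivAt.inner ℝ hg.hasFDerivAt
  have h3 : (fun y => inner ℝ (g y) (g y)) = fun _ => (1 : ℝ) := by
    funext y; rw [real_inner_self_eq_norm_sq, h1]; norm_num
  rw [h3] at h2
  have h4 := h2.unique (hasFDerivAt_const (1 : ℝ) x)
  have h5 := congrArg (fun L => L u) h4
  simp [hu, h1] at h5


theorem lipschitz_ext {n : ℕ} {v : Eu n → Eu n} {L : NNReal}
    (hv : LipschitzOnWith L v (closedBall 0 1)) (h0 : ∀ x, ‖x‖ = 1 → v x = 0) :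
    LipschitzWith L (fun x => if ‖x‖ ≤ 1 then v x else 0) := by
  have cross : ∀ x y : Eu n, ‖x‖ ≤ 1 → 1 < ‖y‖ → dist (v x) 0 ≤ L * dist x y := by
    intro x y hx hy
    have hc : ContinuousOn (fun s : ℝ => ‖AffineMap.lineMap x y s‖) (Icc 0 1) := by
      apply Continuous.continuousOn
      exact (AffineMap.lineMap_continuous (R := ℝ)).norm
    obtain ⟨s, hs, hs1⟩ := intermediate_value_Icc (zero_le_one) hc
      (show (1 : ℝ) ∈ Icc _ _ by simp [hx, hy.le])
    have hz : v (AffineMap.lineMap x y s) = 0 := h0 _ hs1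
    have h1 := hv.dist_le_mul x (by simpa using hx) (AffineMap.lineMap x y s)
      (by simpa using le_of_eq hs1)
    rw [hz] at h1
    refine h1.trans ?_
    gcongr
    rw [dist_left_lineMap, Real.norm_of_nonneg hs.1]
    have := dist_nonneg (x := x) (y := y)
    nlinarith [hs.2]
  refine LipschitzWith.of_dist_le_mul fun x y => ?_
  by_cases hx : ‖x‖ ≤ 1 <;> by_cases hy : ‖y‖ ≤ 1
  · simp only [hx, hy, if_true]
    exact hv.dist_le_mul x (by simpa using hx) y (by simpa using hy)
  · simp only [hx, hy, if_true, if_false]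
    exact cross x y hx (not_le.1 hy)
  · simp only [hx, hy, if_true, if_false]
    rw [dist_comm, dist_comm x y]
    exact cross y x hy (not_le.1 hx)
  · simp only [hx, hy, if_false, dist_self]
    positivity

/-- An injective perturbation of the identity is a bijection. -/
theorem bijective_id_add {n : ℕ} {w : Eu n → Eu n} {c : NNReal} (hw : LipschitzWith c w)
    (hc : c < 1) : ∃ h : Eu n ≃ₜ Eu n, ∀ x, h x = x + w x := by
  have ha : ApproximatesLinearOn (fun x => x + w x)
      ((ContinuousLinearEquiv.refl ℝ (Eu n) : Eu n ≃L[ℝ] Eu n) : Eu n →L[ℝ] Eu n) univ c := by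
    rw [ApproximatesLinearOn.approximatesLinearOn_iff_lipschitzOnWith, lipschitzOnWith_univ]
    have e : ((fun x => x + w x) -
        ⇑((ContinuousLinearEquiv.refl ℝ (Eu n) : Eu n ≃L[ℝ] Eu n) : Eu n →L[ℝ] Eu n)) = w := by
      funext x
      simp
    rw [e]
    exact hw
  have hc' : Subsingleton (Eu n) ∨ c < ‖((ContinuousLinearEquiv.refl ℝ (Eu n)).symm : Eu n →L[ℝ] Eu n)‖₊⁻¹ := by
    rcases subsingleton_or_nontrivial (Eu n) with h | h
    · exact Or.inl h
    · right
      have : ‖((ContinuousLinearEquiv.refl ℝ (Eu n)).symm : Eu n →L[ℝ] Eu n)‖₊ = 1 := by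
        have : ((ContinuousLinearEquiv.refl ℝ (Eu n)).symm : Eu n →L[ℝ] Eu n) = ContinuousLinearMap.id ℝ (Eu n) := rfl
        rw [this]
        ext
        simp
      rw [this]; simpa using hc
  exact ⟨ha.toHomeomorph _ hc', fun x => rfl⟩

theorem no_smooth_retraction {n : ℕ} (hn : 0 < n) {g : Eu n → Eu n} (hg : ContDiff ℝ 1 g)
    (h1 : ∀ y, ‖g y‖ = 1) (hid : ∀ x, ‖x‖ = 1 → g x = x) : False := by
  let v : Eu n → Eu n := fun x => g x - x
  have hv : ContDiff ℝ 1 v := hg.sub contDiff_id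
  obtain ⟨L, hL⟩ : ∃ L, LipschitzOnWith L v (closedBall 0 1) :=
    hv.contDiffOn.exists_lipschitzOnWith (by norm_num) (convex_closedBall _ _)
      (isCompact_closedBall _ _)
  have hv0 : ∀ x, ‖x‖ = 1 → v x = 0 := fun x hx => by simp [v, hid x hx]
  have hw := lipschitz_ext hL hv0
  set w : Eu n → Eu n := fun x => if ‖x‖ ≤ 1 then v x else 0 with hwdef
  let dv : Eu n → (Eu n →L[ℝ] Eu n) := fun x => fderiv ℝ v x
  have hdv : Continuous dv := hv.continuous_fderiv (by norm_num)
  let D : ℝ → Eu n → ℝ := fun t x => (ContinuousLinearMap.id ℝ (Eu n) + t • dv x).det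
  have hDc : Continuous (fun p : ℝ × Eu n => D p.1 p.2) := by
    have : Continuous (fun p : ℝ × Eu n => (ContinuousLinearMap.id ℝ (Eu n) + p.1 • dv p.2)) := by
      fun_prop
    exact ContinuousLinearMap.continuous_det.comp this
  have hpos : ∀ᶠ t in 𝓝 (0 : ℝ), ∀ x ∈ closedBall (0 : Eu n) 1, 0 < D t x := by
    refine (isCompact_closedBall (0 : Eu n) 1).eventually_forall_of_forall_eventually ?_
    intro x _
    have h0 : 0 < D (0 : ℝ) x := by
      simp [D, ContinuousLinearMap.det]
    exact hDc.continuousAt.eventually (lt_mem_nhds h0)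
  have hsmall : ∀ᶠ t in 𝓝 (0 : ℝ), |t| * (L : ℝ) < 1 := by
    have : Continuous fun t : ℝ => |t| * (L : ℝ) := by fun_prop
    have h := this.tendsto 0
    simp only [abs_zero, zero_mul] at h
    exact h.eventually (gt_mem_nhds one_pos)
  obtain ⟨δ, hδ, hδ'⟩ := Metric.eventually_nhds_iff.1
    (hpos.and (hsmall.and (gt_mem_nhds (zero_lt_one (α := ℝ)))))
  -- volume identity for small `t`
  have hvol : ∀ t, 0 ≤ t → t < δ →
      ∫ x in closedBall (0 : Eu n) 1, D t x = (volume (closedBall (0 : Eu n) 1)).toReal := by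
    intro t ht0 htδ
    obtain ⟨hp, hs, ht1⟩ := hδ' (y := t) (by simpa [abs_of_nonneg ht0] using htδ)
    have hlip : LipschitzWith (⟨t, ht0⟩ * L) (fun x => t • w x) := by
      refine LipschitzWith.of_dist_le_mul fun x y => ?_
      rw [dist_smul₀, Real.norm_of_nonneg ht0]
      have := hw.dist_le_mul x y
      calc t * dist (w x) (w y) ≤ t * (L * dist x y) := by gcongr
        _ = _ := by rw [← mul_assoc]; rfl
    obtain ⟨G, hG⟩ := bijective_id_add hlip (by
      rw [abs_of_nonneg ht0] at hs
      exact hs)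
    have himg : (fun x => x + t • v x) '' closedBall 0 1 = closedBall 0 1 := by
      have e1 : (fun x => x + t • v x) '' closedBall 0 1 = G '' closedBall 0 1 := by
        refine image_congr fun x hx => ?_
        have : ‖x‖ ≤ 1 := by simpa using hx
        simp [hG, w, this]
      rw [e1]
      apply Subset.antisymm
      · rintro _ ⟨x, hx, rfl⟩
        have hx1 : ‖x‖ ≤ 1 := by simpa using hx
        rw [hG]
        simp only [w, hx1, if_true, v, mem_closedBall, dist_zero_right]
        have : x + t • (g x - x) = (1 - t) • x + t • g x := by module
        rw [this]
        refine (norm_add_le _ _).trans ?_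
        rw [norm_smul, norm_smul, h1, Real.norm_of_nonneg ht0, Real.norm_of_nonneg (by linarith)]
        nlinarith
      · intro y hy
        refine ⟨G.symm y, ?_, by simp⟩
        by_contra hcon
        have hcon' : ¬ ‖G.symm y‖ ≤ 1 := by simpa using hcon
        have := hG (G.symm y)
        simp only [w, hcon', if_false, smul_zero, add_zero, Homeomorph.apply_symm_apply] at this
        rw [← this] at hcon'
        exact hcon' (by simpa using hy)
    have hinj : InjOn (fun x => x + t • v x) (closedBall 0 1) := by
      intro x hx y hy hxy
      have hx1 : ‖x‖ ≤ 1 := by simpa using hx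
      have hy1 : ‖y‖ ≤ 1 := by simpa using hy
      apply G.injective
      rw [hG, hG]
      simpa only [w, hx1, hy1, if_true] using hxy
    have hder : ∀ x ∈ closedBall (0 : Eu n) 1, HasFDerivWithinAt (fun x => x + t • v x)
        (ContinuousLinearMap.id ℝ (Eu n) + t • dv x) (closedBall 0 1) x := by
      intro x _
      have h2 : HasFDerivAt v (dv x) x := ((hv.differentiable (by norm_num)) x).hasFDerivAt
      exact ((hasFDerivAt_id x).add (h2.const_smul t)).hasFDerivWithinAt
    have hcv := lintegral_abs_det_fderiv_eq_addHaar_image (volume : Measure (Eu n))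
      (measurableSet_closedBall (x := (0 : Eu n)) (ε := 1)) hder hinj
    rw [himg] at hcv
    rw [← hcv, integral_eq_lintegral_of_nonneg_ae]
    · congr 1
      refine setLIntegral_congr_fun measurableSet_closedBall fun x hx => ?_
      change ENNReal.ofReal (D t x) = ENNReal.ofReal |D t x|
      rw [abs_of_pos (hp x hx)]
    · refine (ae_restrict_iff' measurableSet_closedBall).2 (ae_of_all _ fun x hx => (hp x hx).le)
    · exact (hDc.comp (Continuous.prodMk_right t)).aestronglyMeasurable
  let tn : Fin (n + 1) → ℝ := fun i => δ / 2 * ((i : ℕ) / (n + 1 : ℝ))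
  have htinj : Function.Injective tn := by
    intro i j hij
    simp only [tn] at hij
    have hn' : (0 : ℝ) < n + 1 := by positivity
    have h3 := mul_left_cancel₀ (by positivity) hij
    rw [div_left_inj' hn'.ne'] at h3
    exact Fin.ext (by exact_mod_cast h3)
  have htn : ∀ i, 0 ≤ tn i ∧ tn i < δ := by
    intro i
    have hn' : (0 : ℝ) < n + 1 := by positivity
    have h4 : ((i : ℕ) : ℝ) / (n + 1 : ℝ) ≤ 1 := by
      rw [div_le_one hn']
      have : (i : ℕ) ≤ n + 1 := i.2.le
      exact_mod_cast this
    refine ⟨by positivity, ?_⟩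
    simp only [tn]
    nlinarith
  obtain ⟨c, hc1, hc⟩ := exists_interp_weights tn htinj
  have hfin : ∫ x in closedBall (0 : Eu n) 1, D 1 x = (volume (closedBall (0 : Eu n) 1)).toReal := by
    have e : ∀ x, D 1 x = ∑ i, c i * D (tn i) x := by
      intro x
      simp only [D, one_smul]
      exact hc (dv x)
    simp_rw [e]
    rw [integral_finsetSum]
    · simp_rw [integral_const_mul]
      rw [Finset.sum_congr rfl fun i _ => by rw [hvol _ (htn i).1 (htn i).2], ← Finset.sum_mul, hc1,
        one_mul]
    · intro i _
      refine Integrable.const_mul ?_ _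
      exact ((hDc.comp (Continuous.prodMk_right (tn i))).continuousOn).integrableOn_compact
        (isCompact_closedBall _ _)
  have hzero : ∀ x, D 1 x = 0 := by
    intro x
    have hgd : DifferentiableAt ℝ g x := (hg.differentiable (by norm_num)) x
    rw [← det_eq_zero_of_norm_one x hgd h1]
    simp only [D, one_smul, dv]
    congr 1
    have : fderiv ℝ v x = fderiv ℝ g x - ContinuousLinearMap.id ℝ (Eu n) := by
      have := (hgd.hasFDerivAt.sub (hasFDerivAt_id x)).fderiv
      exact this
    rw [this]; abel
  simp only [hzero, integral_zero] at hfin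
  have : NeZero n := ⟨hn.ne'⟩
  have hpos' : 0 < (volume (closedBall (0 : Eu n) 1)).toReal :=
    ENNReal.toReal_pos (measure_closedBall_pos _ _ one_pos).ne' measure_closedBall_lt_top.ne
  exact hpos'.ne hfin

/-- No retraction theorem, in the form used later. -/
theorem no_avoid {n : ℕ} (hn : 0 < n) {F : Eu n → Eu n} (hF : Continuous F) (R : ℝ)
    (hid : ∀ x, R ≤ ‖x‖ → F x = x) : ∃ x, F x = 0 := by
  by_contra hne
  push Not at hne
  obtain ⟨T, hT0, hTR⟩ : ∃ T : ℝ, 0 < T ∧ R < T := ⟨max R 0 + 1, by positivity, by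
    have := le_max_left R 0; linarith⟩
  obtain ⟨u, hu, hclose, heq, -⟩ := hF.exists_contDiff_approx_and_eqOn 1 hF.norm
    (fun x => norm_pos_iff.2 (hne x)) (S := {x | T ≤ ‖x‖}) (U := {x | R < ‖x‖})
    (isClosed_le continuous_const continuous_norm)
    ((isOpen_lt continuous_const continuous_norm).mem_nhdsSet.2 fun x hx => lt_of_lt_of_le hTR hx)
    (contDiffOn_id.congr fun x hx => hid x (le_of_lt hx))
  have hu0 : ∀ x, u x ≠ 0 := by
    intro x hx
    have := hclose x
    rw [hx, dist_zero_left] at this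
    exact lt_irrefl _ this
  have huT : ∀ x, T ≤ ‖x‖ → u x = x := fun x hx => by rw [heq hx, hid x (hTR.le.trans hx)]
  have hs : ContDiff ℝ 1 (fun x => u (T • x)) :=
    ContDiff.comp (by exact_mod_cast hu) (contDiff_const_smul T)
  refine no_smooth_retraction hn (g := fun x => ‖u (T • x)‖⁻¹ • u (T • x)) ?_ ?_ ?_
  · exact ((hs.norm ℝ fun x => hu0 _).inv fun x => norm_ne_zero_iff.2 (hu0 _)).smul hs
  · intro y
    rw [norm_smul, norm_inv, norm_norm]
    exact inv_mul_cancel₀ (norm_ne_zero_iff.2 (hu0 _))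
  · intro x hx
    have h5 : ‖T • x‖ = T := by rw [norm_smul, hx, mul_one, Real.norm_of_nonneg hT0.le]
    rw [huT (T • x) h5.ge, h5, smul_smul, inv_mul_cancel₀ hT0.ne', one_smul]

/-- Poincaré–Bohl. -/
theorem exists_zero_of_near_id {n : ℕ} (hn : 0 < n) {m : Eu n → Eu n}
    (hm : ContinuousOn m (closedBall 0 1)) (hnear : ∀ x, ‖x‖ = 1 → ‖m x - x‖ < 1) :
    ∃ x ∈ closedBall (0 : Eu n) 1, m x = 0 := by
  let π : Eu n → Eu n := fun x => (max 1 ‖x‖)⁻¹ • x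
  have hπ : Continuous π := by
    refine Continuous.smul (Continuous.inv₀ (continuous_const.max continuous_norm) fun x => ?_)
      continuous_id
    have := le_max_left 1 ‖x‖
    positivity
  have hπb : ∀ x, π x ∈ closedBall (0 : Eu n) 1 := by
    intro x
    have h1 : 0 < max 1 ‖x‖ := lt_of_lt_of_le one_pos (le_max_left _ _)
    simp only [π, mem_closedBall, dist_zero_right, norm_smul, norm_inv, Real.norm_of_nonneg h1.le]
    rw [inv_mul_le_iff₀ h1, mul_one]
    exact le_max_right _ _
  let s : Eu n → ℝ := fun x => max 0 (min 1 (2 - ‖x‖))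
  have hs : Continuous s := by fun_prop
  let F : Eu n → Eu n := fun x => s x • m (π x) + (1 - s x) • x
  have hF : Continuous F := by
    have : Continuous fun x => m (π x) := hm.comp_continuous hπ hπb
    exact (hs.smul this).add ((continuous_const.sub hs).smul continuous_id)
  obtain ⟨x, hx⟩ := no_avoid hn hF 2 (fun x hx => by
    have : s x = 0 := by
      simp only [s]
      rw [max_eq_left]
      exact (min_le_right _ _).trans (by linarith)
    simp [F, this])
  rcases le_or_gt ‖x‖ 1 with h | h
  · have h1 : s x = 1 := by
      simp only [s]
      rw [min_eq_left (by linarith), max_eq_right zero_le_one]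
    have h2 : π x = x := by simp [π, max_eq_left h]
    refine ⟨x, by simpa using h, ?_⟩
    simpa [F, h1, h2] using hx
  · exfalso
    have hx0 : 0 < ‖x‖ := by linarith
    have h2 : π x = ‖x‖⁻¹ • x := by simp [π, max_eq_right h.le]
    have h3 : ‖π x‖ = 1 := by
      rw [h2, norm_smul, norm_inv, norm_norm, inv_mul_cancel₀ hx0.ne']
    have h4 : x = ‖x‖ • π x := by rw [h2, smul_smul, mul_inv_cancel₀ hx0.ne', one_smul]
    have h5 : 0 < inner ℝ (m (π x)) (π x) := by
      have h6 := hnear _ h3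
      have h7 : inner ℝ (m (π x) - π x) (π x) = inner ℝ (m (π x)) (π x) - 1 := by
        rw [inner_sub_left, real_inner_self_eq_norm_sq, h3]; norm_num
      have h8 := abs_real_inner_le_norm (m (π x) - π x) (π x)
      rw [h3, mul_one, h7, abs_le] at h8
      linarith
    have hs0 : 0 ≤ s x := le_max_left _ _
    have hs1 : s x ≤ 1 := max_le zero_le_one (min_le_left _ _)
    have h9 : inner ℝ (F x) (π x) = s x * inner ℝ (m (π x)) (π x) + (1 - s x) * ‖x‖ := by
      have : F x = s x • m (π x) + (1 - s x) • ‖x‖ • π x := by rw [← h4]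
      rw [this, inner_add_left, real_inner_smul_left, real_inner_smul_left, real_inner_smul_left,
        real_inner_self_eq_norm_sq, h3]
      ring
    rw [hx, inner_zero_left] at h9
    rcases hs0.eq_or_lt with h0 | h0
    · rw [← h0] at h9; linarith
    · have : 0 < s x * inner ℝ (m (π x)) (π x) := mul_pos h0 h5
      nlinarith

end Cantrell
end

section
open Set Metric Filter Topology MeasureTheory
namespace Cantrell

theorem one_lt_rank_Eu {n : ℕ} (hn : 2 ≤ n) : 1 < Module.rank ℝ (Eu n) := by
  rw [← Module.finrank_eq_rank, finrank_euclideanSpace_fin]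
  exact_mod_cast hn

theorem exists_large {n : ℕ} (hn : 0 < n) (R : ℝ) : ∃ q : Eu n, R < ‖q‖ := by
  refine ⟨EuclideanSpace.single ⟨0, hn⟩ (|R| + 1), ?_⟩
  have : R ≤ |R| := le_abs_self R
  rw [EuclideanSpace.norm_single, Real.norm_of_nonneg (by positivity)]
  linarith

theorem move_local {n : ℕ} (q q' : Eu n) (r : ℝ) (h : dist q' q < r) :
    ∃ θ : Eu n ≃ₜ Eu n, (∀ x, x ∉ ball q r → θ x = x) ∧ θ q = q' := by
  have hr : 0 < r := lt_of_le_of_lt dist_nonneg h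
  let w : Eu n → Eu n := fun x => (max 0 (r - dist x q) / r) • (q' - q)
  have hw : LipschitzWith ⟨dist q' q / r, by positivity⟩ w := by
    refine LipschitzWith.of_dist_le_mul fun x y => ?_
    simp only [w, dist_eq_norm, ← sub_smul, norm_smul]
    change _ ≤ ‖q' - q‖ / r * ‖x - y‖
    rw [← sub_div, norm_div, Real.norm_of_nonneg hr.le]
    have h1 : ‖max 0 (r - ‖x - q‖) - max 0 (r - ‖y - q‖)‖ ≤ ‖x - y‖ := by
      rw [Real.norm_eq_abs]
      have h2 := abs_max_sub_max_le_abs (r - ‖x - q‖) (r - ‖y - q‖) 0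
      rw [max_comm _ (0 : ℝ), max_comm _ (0 : ℝ)] at h2
      refine h2.trans ?_
      have h3 := abs_norm_sub_norm_le (y - q) (x - q)
      have h4 : y - q - (x - q) = -(x - y) := by abel
      rw [h4, norm_neg] at h3
      have h5 : r - ‖x - q‖ - (r - ‖y - q‖) = ‖y - q‖ - ‖x - q‖ := by ring
      rw [h5]
      exact h3
    calc _ ≤ ‖x - y‖ / r * ‖q' - q‖ := by gcongr
      _ = _ := by ring
  obtain ⟨θ, hθ⟩ := bijective_id_add hw (by
    change dist q' q / r < 1
    rwa [div_lt_one hr])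
  refine ⟨θ, fun x hx => ?_, ?_⟩
  · have : r - dist x q ≤ 0 := by
      have : r ≤ dist x q := by simpa using hx
      linarith
    simp [hθ, w, max_eq_left this]
  · simp [hθ, w, max_eq_right hr.le, div_self hr.ne']

theorem move_point {n : ℕ} {U : Set (Eu n)} (hU : IsOpen U) (hc : IsPreconnected U)
    {p q : Eu n} (hp : p ∈ U) (hq : q ∈ U) :
    ∃ θ : Eu n ≃ₜ Eu n, (∀ x, x ∉ U → θ x = x) ∧ θ p = q := by
  let R : Set (Eu n) := {z | z ∈ U ∧ ∃ θ : Eu n ≃ₜ Eu n, (∀ x, x ∉ U → θ x = x) ∧ θ p = z}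
  have key : ∀ z ∈ U, ∃ r > 0, ball z r ⊆ U ∧ ∀ y ∈ ball z r, (z ∈ R ↔ y ∈ R) := by
    intro z hz
    obtain ⟨r, hr, hrU⟩ := Metric.isOpen_iff.1 hU z hz
    refine ⟨r, hr, hrU, fun y hy => ?_⟩
    obtain ⟨φ, hφ, hφz⟩ := move_local z y r hy
    constructor
    · rintro ⟨-, θ, hθ, hθp⟩
      refine ⟨hrU hy, θ.trans φ, fun x hx => ?_, by simp [hθp, hφz]⟩
      simp only [Homeomorph.trans_apply]
      rw [hθ x hx, hφ x fun h => hx (hrU h)]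
    · rintro ⟨-, θ, hθ, hθp⟩
      refine ⟨hz, θ.trans φ.symm, fun x hx => ?_, ?_⟩
      · simp only [Homeomorph.trans_apply]
        rw [hθ x hx, Homeomorph.symm_apply_eq, hφ x fun h => hx (hrU h)]
      · simp only [Homeomorph.trans_apply]
        rw [hθp, Homeomorph.symm_apply_eq, hφz]
  have hR : IsOpen R := by
    refine Metric.isOpen_iff.2 fun z hz => ?_
    obtain ⟨r, hr, -, h⟩ := key z hz.1
    exact ⟨r, hr, fun y hy => (h y hy).1 hz⟩
  have hR' : IsOpen (U \ R) := by
    refine Metric.isOpen_iff.2 fun z hz => ?_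
    obtain ⟨r, hr, hrU, h⟩ := key z hz.1
    exact ⟨r, hr, fun y hy => ⟨hrU hy, fun hyR => hz.2 ((h y hy).2 hyR)⟩⟩
  have hpR : p ∈ R := ⟨hp, Homeomorph.refl _, fun _ _ => rfl, rfl⟩
  have := hc.subset_left_of_subset_union hR hR' (disjoint_sdiff_right)
    (fun x hx => by by_cases h : x ∈ R; exacts [Or.inl h, Or.inr ⟨hx, h⟩]) ⟨p, hp, hpR⟩
  exact (this hq).2

theorem punctured_ball_preconnected {n : ℕ} (hn : 2 ≤ n) (z : Eu n) {r : ℝ} (hr : 0 < r) :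
    IsPreconnected (ball z r \ {z}) := by
  have h := (isConnected_compl_singleton_of_one_lt_rank (one_lt_rank_Eu hn) (0 : Eu n)).isPreconnected
  have h2 : ball z r \ {z} = (OpenPartialHomeomorph.univBall z r) '' {0}ᶜ := by
    have hz : OpenPartialHomeomorph.univBall z r 0 = z := OpenPartialHomeomorph.univBall_apply_zero z r
    have ht := OpenPartialHomeomorph.univBall_target z hr
    have hs := OpenPartialHomeomorph.univBall_source z r
    ext y
    constructor
    · rintro ⟨hy, hyz⟩
      refine ⟨(OpenPartialHomeomorph.univBall z r).symm y, ?_, ?_⟩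
      · intro h0
        rw [mem_singleton_iff] at h0
        apply hyz
        rw [mem_singleton_iff, ← hz, ← h0, OpenPartialHomeomorph.right_inv _ (by rwa [ht])]
      · exact OpenPartialHomeomorph.right_inv _ (by rwa [ht])
    · rintro ⟨x, hx, rfl⟩
      refine ⟨?_, ?_⟩
      · rw [← ht]; exact OpenPartialHomeomorph.map_source _ (by rw [hs]; trivial)
      · intro hxz
        rw [mem_singleton_iff] at hxz
        apply hx
        exact (OpenPartialHomeomorph.univBall z r).injOn (by rw [hs]; trivial) (by rw [hs]; trivial) (hxz.trans hz.symm)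
  rw [h2]
  exact h.image _ (OpenPartialHomeomorph.continuous_univBall z r).continuousOn

theorem preconnected_diff_singleton {n : ℕ} (hn : 2 ≤ n) {U : Set (Eu n)} (hU : IsOpen U)
    (hc : IsPreconnected U) (z : Eu n) : IsPreconnected (U \ {z}) := by
  by_cases hz : z ∈ U
  swap
  · rwa [diff_singleton_eq_self hz]
  obtain ⟨r, hr, hrU⟩ := Metric.isOpen_iff.1 hU z hz
  have hball := punctured_ball_preconnected hn z hr
  have hne : (ball z r \ {z}).Nonempty := by
    have : NeZero n := ⟨by omega⟩
    have h1 : (𝓝[≠] z).NeBot := inferInstance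
    have h2 : ball z r ∩ {z}ᶜ ∈ 𝓝[≠] z := inter_mem (mem_nhdsWithin_of_mem_nhds (ball_mem_nhds z hr)) self_mem_nhdsWithin
    exact h1.nonempty_of_mem h2
  -- if the punctured ball lies in an open piece then that piece plus the centre is open
  have main : ∀ u v : Set (Eu n), IsOpen u → IsOpen v → U \ {z} ⊆ u ∪ v →
      (U \ {z} ∩ v).Nonempty → (U \ {z}) ∩ (u ∩ v) = ∅ → ball z r \ {z} ⊆ u → False := by
    intro u v hu hv huv hnv hdis hbu
    have hnb : ∀ y, y ∈ ball z r → y ≠ z → y ∉ v := fun y hy hyz hyv => by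
      have : y ∈ (U \ {z}) ∩ (u ∩ v) := ⟨⟨hrU hy, hyz⟩, hbu ⟨hy, hyz⟩, hyv⟩
      rw [hdis] at this
      exact this
    obtain ⟨y, ⟨hyU, hyz⟩, hyv⟩ := hnv
    have hdisj := hc (u ∪ ball z r) (v \ {z}) (hu.union isOpen_ball)
      (hv.sdiff isClosed_singleton) (fun x hx => by
        by_cases hxz : x = z
        · left; right; rw [hxz]; exact mem_ball_self hr
        · rcases huv ⟨hx, hxz⟩ with h | h
          · exact Or.inl (Or.inl h)
          · exact Or.inr ⟨h, hxz⟩) ⟨z, hz, Or.inr (mem_ball_self hr)⟩ ⟨y, hyU, hyv, hyz⟩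
    obtain ⟨x, hxU, hxu | hxb, hxv, hxz⟩ := hdisj
    · have : x ∈ (U \ {z}) ∩ (u ∩ v) := ⟨⟨hxU, hxz⟩, hxu, hxv⟩
      rw [hdis] at this
      exact this
    · exact hnb x hxb hxz hxv
  intro u v hu hv huv hnu hnv
  by_contra hemp
  rw [not_nonempty_iff_eq_empty] at hemp
  have hbU : ball z r \ {z} ⊆ U \ {z} := diff_subset_diff_left hrU
  have := isPreconnected_iff_subset_of_disjoint.1 hball u v hu hv (hbU.trans huv) (by
    rw [← subset_empty_iff, ← hemp]
    exact inter_subset_inter_left _ hbU)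
  rcases this with h | h
  · exact main u v hu hv huv hnv hemp h
  · exact main v u hv hu (by rwa [union_comm]) hnu (by rwa [inter_comm v u]) h

theorem preconnected_diff_finite {n : ℕ} (hn : 2 ≤ n) {U : Set (Eu n)} (hU : IsOpen U)
    (hc : IsPreconnected U) {Z : Set (Eu n)} (hZ : Z.Finite) : IsPreconnected (U \ Z) := by
  induction Z, hZ using Set.Finite.induction_on with
  | empty => simpa using hc
  | @insert a s has hs ih =>
    have : U \ insert a s = (U \ s) \ {a} := by ext x; simp; tauto
    rw [this]
    exact preconnected_diff_singleton hn (hU.sdiff hs.isClosed) ih a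

theorem move_finite {n : ℕ} (hn : 2 ≤ n) {U : Set (Eu n)} (hU : IsOpen U)
    (hc : IsPreconnected U) (R : ℝ) (hR : ∀ x, R < ‖x‖ → x ∈ U) {Z : Set (Eu n)} (hZ : Z.Finite)
    (hZU : Z ⊆ U) :
    ∃ θ : Eu n ≃ₜ Eu n, (∀ x, x ∉ U → θ x = x) ∧ ∀ z ∈ Z, R < ‖θ z‖ := by
  induction Z, hZ using Set.Finite.induction_on with
  | empty => exact ⟨Homeomorph.refl _, fun _ _ => rfl, by simp⟩
  | @insert a s has hs ih =>
    obtain ⟨θ, hθ, hθs⟩ := ih ((subset_insert a s).trans hZU)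
    have hfin : (θ '' s).Finite := hs.image _
    obtain ⟨C, hC⟩ := hfin.isBounded.exists_norm_le
    obtain ⟨q, hq⟩ := exists_large (n := n) (by omega) (max R C)
    have hqs : q ∉ θ '' s := fun h => absurd (hC q h) (not_le.2 (lt_of_le_of_lt (le_max_right _ _) hq))
    have hqR : R < ‖q‖ := lt_of_le_of_lt (le_max_left _ _) hq
    have hθa : θ a ∈ U := by
      by_contra h
      have h1 := hθ _ h
      have h2 := θ.injective h1
      rw [h2] at h
      exact h (hZU (mem_insert _ _))
    obtain ⟨φ, hφ, hφa⟩ := move_point (hU.sdiff hfin.isClosed) (preconnected_diff_finite hn hU hc hfin)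
      (p := θ a) (q := q) ⟨hθa, fun ⟨y, hy, hya⟩ => has (by rwa [← θ.injective hya])⟩ ⟨hR q hqR, hqs⟩
    refine ⟨θ.trans φ, fun x hx => ?_, ?_⟩
    · simp only [Homeomorph.trans_apply]
      rw [hθ x hx, hφ x fun h => hx h.1]
    · rintro z (rfl | hz)
      · simpa [hφa] using hqR
      · simp only [Homeomorph.trans_apply]
        rw [hφ _ fun h => h.2 (mem_image_of_mem _ hz)]
        exact hθs z hz

end Cantrell
end

section
open Set Metric Filter Topology MeasureTheory
namespace Cantrell

theorem tietze {n : ℕ} {X : Type} [TopologicalSpace X] [NormalSpace X] {C : Set X}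
    (hC : IsClosed C) {f : X → Eu n} (hf : ContinuousOn f C) :
    ∃ g : X → Eu n, Continuous g ∧ EqOn g f C := by
  obtain ⟨g, hg⟩ := ContinuousMap.exists_restrict_eq hC
    (⟨C.domRestrict f, continuousOn_iff_continuous_domRestrict.1 hf⟩ : C(C, Eu n))
  exact ⟨g, g.continuous, fun x hx => congrArg (fun k : C(C, Eu n) => k ⟨x, hx⟩) hg⟩

theorem exists_regular {n : ℕ} {u : Eu n → Eu n} (hu : ContDiff ℝ 1 u) :
    ∃ c : Eu n, ‖c‖ < 1 / 4 ∧ ∀ x, u x = c → (fderiv ℝ u x).det ≠ 0 := by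
  have h0 := addHaar_image_eq_zero_of_det_fderivWithin_eq_zero (volume : Measure (Eu n))
    (s := {x | (fderiv ℝ u x).det = 0}) (f := u) (f' := fderiv ℝ u)
    (fun x _ => ((hu.differentiable (by norm_num)) x).hasFDerivAt.hasFDerivWithinAt)
    (fun x hx => hx)
  have h1 : 0 < volume (ball (0 : Eu n) (1 / 4)) := measure_ball_pos _ _ (by norm_num)
  have h2 : ¬ (ball (0 : Eu n) (1 / 4) ⊆ u '' {x | (fderiv ℝ u x).det = 0}) := by
    intro h
    have := measure_mono (μ := (volume : Measure (Eu n))) h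
    rw [h0] at this
    exact absurd h1 (not_lt.2 this)
  obtain ⟨c, hc, hc'⟩ := Set.not_subset.1 h2
  refine ⟨c, by simpa using hc, fun x hx hd => hc' ⟨x, hd, hx⟩⟩

theorem zeros_finite {n : ℕ} {u : Eu n → Eu n} (hu : ContDiff ℝ 1 u) (c : Eu n) (R : ℝ)
    (hR : ∀ x, R ≤ ‖x‖ → u x ≠ c) (hd : ∀ x, u x = c → (fderiv ℝ u x).det ≠ 0) :
    {x | u x = c}.Finite := by
  have hcl : IsClosed {x | u x = c} := isClosed_eq hu.continuous continuous_const
  have hK : IsCompact {x | u x = c} := by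
    refine (isCompact_closedBall (0 : Eu n) R).of_isClosed_subset hcl fun x hx => ?_
    by_contra h
    simp at h
    exact hR x h.le hx
  have hiso : ∀ z ∈ {x | u x = c}, ∃ U ∈ 𝓝 z, ∀ y ∈ U, u y = c → y = z := by
    intro z hz
    have hf : HasFDerivAt u (fderiv ℝ u z) z := ((hu.differentiable (by norm_num)) z).hasFDerivAt
    let e := (fderiv ℝ u z).toContinuousLinearEquivOfDetNeZero (hd z hz)
    have hanti : ∃ C, AntilipschitzWith C (fderiv ℝ u z) := ⟨_, by
      have := e.antilipschitz
      have he : ⇑e = fderiv ℝ u z := rfl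
      rwa [he] at this⟩
    have hev := hf.eventually_ne (c := c) hanti
    rw [eventually_nhdsWithin_iff] at hev
    refine ⟨_, hev, fun y hy hyc => ?_⟩
    by_contra hne
    exact hy hne hyc
  choose! U hU hUz using hiso
  obtain ⟨t, ht, hcov⟩ := hK.elim_nhds_subcover U hU
  refine t.finite_toSet.subset fun x hx => ?_
  obtain ⟨z, hz, hxz⟩ := mem_iUnion₂.1 (hcov hx)
  have := hUz z (ht z hz) x hxz hx
  rw [this]; exact hz

theorem cone_continuous {n : ℕ} {τ : Eu n → Eu n} (hτ : ContinuousOn τ (sphere 0 1)) {R : ℝ}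
    (hR : ∀ y ∈ sphere (0 : Eu n) 1, ‖τ y‖ ≤ R) :
    Continuous fun x : Eu n => ‖x‖ • τ (‖x‖⁻¹ • x) := by
  have hmem : ∀ x : Eu n, x ≠ 0 → ‖x‖⁻¹ • x ∈ sphere (0 : Eu n) 1 := by
    intro x hx
    have : ‖x‖ ≠ 0 := norm_ne_zero_iff.2 hx
    simp [norm_smul, this]
  rw [continuous_iff_continuousAt]
  intro x
  by_cases hx : x = 0
  · subst hx
    rw [ContinuousAt]
    simp only [norm_zero, zero_smul]
    refine squeeze_zero_norm' (a := fun x : Eu n => ‖x‖ * R) ?_ ?_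
    · refine Eventually.of_forall fun y => ?_
      by_cases hy : y = 0
      · simp [hy]
      rw [norm_smul, norm_norm]
      exact mul_le_mul_of_nonneg_left (hR _ (hmem y hy)) (norm_nonneg _)
    · have : Tendsto (fun x : Eu n => ‖x‖ * R) (𝓝 0) (𝓝 (‖(0 : Eu n)‖ * R)) := by
        apply Continuous.tendsto; fun_prop
      simpa using this
  · have hn : ‖x‖ ≠ 0 := norm_ne_zero_iff.2 hx
    have h1 : ContinuousOn (fun x : Eu n => ‖x‖ • τ (‖x‖⁻¹ • x)) {0}ᶜ := by
      refine continuous_norm.continuousOn.smul (hτ.comp ?_ fun y hy => hmem y hy)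
      refine ContinuousOn.smul (ContinuousOn.inv₀ continuous_norm.continuousOn fun y hy => ?_) continuousOn_id
      exact norm_ne_zero_iff.2 hy
    exact h1.continuousAt (isOpen_compl_singleton.mem_nhds hx)

/-- Separation: the complement of a topological `(n-1)`-sphere in `ℝⁿ` is not connected. -/
theorem separation {n : ℕ} (hn : 2 ≤ n) {K : Set (Eu n)} (hK : IsCompact K) {σ τ : Eu n → Eu n}
    (hσ : ContinuousOn σ K) (hσ1 : ∀ x ∈ K, ‖σ x‖ = 1) (hτ : ContinuousOn τ (sphere 0 1))
    (hτK : ∀ y ∈ sphere (0 : Eu n) 1, τ y ∈ K) (hστ : ∀ y ∈ sphere (0 : Eu n) 1, σ (τ y) = y) :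
    ¬ IsPreconnected Kᶜ := by
  intro hcon
  obtain ⟨R, hRpos, hR⟩ := hK.isBounded.subset_ball_lt 0 (0 : Eu n)
  have hR' : ∀ x ∈ K, ‖x‖ < R := fun x hx => by simpa using hR hx
  obtain ⟨q0, hq0⟩ := exists_large (n := n) (by omega) 0
  let e : Eu n := ‖q0‖⁻¹ • q0
  have he : ‖e‖ = 1 := by simp [e, norm_smul, hq0.ne']
  classical
  have hcl : IsClosed {x : Eu n | R ≤ ‖x‖} := isClosed_le continuous_const continuous_norm
  have hcont : ContinuousOn (fun x => if ‖x‖ < R then σ x else e) (K ∪ {x : Eu n | R ≤ ‖x‖}) := by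
    refine ContinuousOn.union_of_isClosed ?_ ?_ hK.isClosed hcl
    · exact hσ.congr fun x hx => by simp [hR' x hx]
    · exact (continuousOn_const (c := e)).congr fun x hx => by
        have : R ≤ ‖x‖ := hx
        simp [not_lt.2 this]
  obtain ⟨σ', hσ'c, hσ'⟩ := tietze (hK.isClosed.union hcl) hcont
  obtain ⟨u, hu, huε, -⟩ := hσ'c.exists_contDiff_approx (1 : ℕ∞) (ε := fun _ => 1 / 4)
    continuous_const (fun _ => by norm_num)
  have hu : ContDiff ℝ 1 u := by exact_mod_cast hu
  obtain ⟨c, hc, hreg⟩ := exists_regular hu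
  have hout : ∀ x, R ≤ ‖x‖ → u x ≠ c := by
    intro x hx hxc
    have h1 : σ' x = e := by rw [hσ' (Or.inr hx)]; simp [not_lt.2 hx]
    have h2 : dist (u x) (σ' x) < 1 / 4 := huε x
    rw [h1, hxc, dist_eq_norm] at h2
    have := norm_sub_norm_le e c
    rw [norm_sub_rev] at this
    linarith
  have hZ := zeros_finite hu c R hout hreg
  have honK : ∀ x ∈ K, ‖u x - c - σ x‖ < 1 / 2 := by
    intro x hx
    have h1 : σ' x = σ x := by rw [hσ' (Or.inl hx)]; simp [hR' x hx]
    have h2 : dist (u x) (σ' x) < 1 / 4 := huε x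
    rw [h1, dist_eq_norm] at h2
    have h3 : u x - c - σ x = (u x - σ x) - c := by abel
    rw [h3]
    have := norm_sub_le (u x - σ x) c
    linarith
  obtain ⟨θ, hθ, hθZ⟩ := move_finite hn hK.isClosed.isOpen_compl hcon R
    (fun x hx hxK => by linarith [hR' x hxK]) hZ (fun x hx hxK => by
      have h1 := honK x hxK
      have h2 : u x = c := hx
      rw [h2, sub_self, zero_sub, norm_neg, hσ1 x hxK] at h1
      norm_num at h1)
  have hcone := cone_continuous hτ (R := R) (fun y hy => (hR' _ (hτK y hy)).le)
  obtain ⟨x, hx, hx0⟩ := exists_zero_of_near_id (n := n) (by omega)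
    (m := fun x => u (θ.symm (‖x‖ • τ (‖x‖⁻¹ • x))) - c)
    (by
      refine Continuous.continuousOn ?_
      exact (hu.continuous.comp (θ.symm.continuous.comp hcone)).sub continuous_const) (by
      intro x hx
      have hxs : x ∈ sphere (0 : Eu n) 1 := by simpa using hx
      simp only [hx, inv_one, one_smul]
      have h1 : θ.symm (τ x) = τ x := by
        rw [Homeomorph.symm_apply_eq]
        exact (hθ _ fun h => h (hτK x hxs)).symm
      rw [h1]
      have := honK _ (hτK x hxs)
      rw [hστ x hxs] at this
      linarith)
  have hz := hθZ _ (show θ.symm (‖x‖ • τ (‖x‖⁻¹ • x)) ∈ {x | u x = c} from sub_eq_zero.1 hx0)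
  rw [Homeomorph.apply_symm_apply] at hz
  by_cases hx00 : x = 0
  · simp [hx00] at hz; linarith
  · have hnn : ‖x‖ ≠ 0 := norm_ne_zero_iff.2 hx00
    have hm : ‖x‖⁻¹ • x ∈ sphere (0 : Eu n) 1 := by simp [norm_smul, hnn]
    have := hR' _ (hτK _ hm)
    rw [norm_smul, norm_norm] at hz
    have hx1 : ‖x‖ ≤ 1 := by simpa using hx
    nlinarith [norm_nonneg x, norm_nonneg (τ (‖x‖⁻¹ • x))]

end Cantrell
end

section
open Set Metric Filter Topology MeasureTheory
namespace Cantrell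

theorem exterior_preconnected {n : ℕ} (hn : 2 ≤ n) {R : ℝ} (hR : 0 ≤ R) :
    IsPreconnected {x : Eu n | R < ‖x‖} := by
  have h := (isConnected_compl_singleton_of_one_lt_rank (one_lt_rank_Eu hn) (0 : Eu n)).isPreconnected
  have h2 : {x : Eu n | R < ‖x‖} = (fun x : Eu n => ((‖x‖ + R) * ‖x‖⁻¹) • x) '' {0}ᶜ := by
    ext y
    constructor
    · intro hy
      have hy : R < ‖y‖ := hy
      have hy0 : ‖y‖ ≠ 0 := by linarith
      have hs : 0 < ‖y‖ - R := by linarith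
      have hn1 : ‖((‖y‖ - R) * ‖y‖⁻¹) • y‖ = ‖y‖ - R := by
        rw [norm_smul, norm_mul, norm_inv, norm_norm, Real.norm_of_nonneg hs.le]
        field_simp
      refine ⟨((‖y‖ - R) * ‖y‖⁻¹) • y, ?_, ?_⟩
      · intro h0
        have h0 : ((‖y‖ - R) * ‖y‖⁻¹) • y = 0 := h0
        rw [h0, norm_zero] at hn1
        linarith
      · simp only [hn1]
        rw [smul_smul]
        have : (‖y‖ - R + R) * (‖y‖ - R)⁻¹ * ((‖y‖ - R) * ‖y‖⁻¹) = 1 := by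
          field_simp
          ring
        rw [this, one_smul]
    · rintro ⟨x, hx, rfl⟩
      have hx0 : 0 < ‖x‖ := norm_pos_iff.2 hx
      have : ‖((‖x‖ + R) * ‖x‖⁻¹) • x‖ = ‖x‖ + R := by
        rw [norm_smul, norm_mul, norm_inv, norm_norm, Real.norm_of_nonneg (by linarith)]
        field_simp
      change R < ‖((‖x‖ + R) * ‖x‖⁻¹) • x‖
      rw [this]; linarith
  rw [h2]
  refine h.image _ ?_
  refine ContinuousOn.smul (ContinuousOn.mul (by fun_prop)
    (ContinuousOn.inv₀ continuous_norm.continuousOn fun y hy => ?_)) continuousOn_id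
  exact norm_ne_zero_iff.2 hy

theorem no_bounded_piece {n : ℕ} (hn : 0 < n) {K U : Set (Eu n)} {r : Eu n → Eu n}
    (hr : Continuous r) (hrK : ∀ x, r x ∈ K) (hrid : ∀ x ∈ K, r x = x) (hUK : U ⊆ Kᶜ)
    (hfr : frontier U ⊆ K) {R : ℝ} (hUR : ∀ x ∈ U, ‖x‖ ≤ R) : U = ∅ := by
  by_contra hne
  obtain ⟨p, hp⟩ := nonempty_iff_ne_empty.2 hne
  classical
  have hc : Continuous (fun x => if x ∈ U then r x else x) := by
    refine continuous_if (fun a ha => hrid a (hfr ha)) hr.continuousOn continuousOn_id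
  obtain ⟨x, hx⟩ := no_avoid hn
    (F := fun x => (fun x => if x ∈ U then r x else x) (x + p) - p)
    ((hc.comp (continuous_id.add continuous_const)).sub continuous_const) (R + ‖p‖ + 1) (by
      intro x hx
      have : x + p ∉ U := by
        intro h
        have h1 := hUR _ h
        have h2 := norm_sub_norm_le x (-p)
        rw [sub_neg_eq_add, norm_neg] at h2
        linarith
      simp [this])
  have hx' := sub_eq_zero.1 hx
  by_cases hxU : x + p ∈ U
  · simp only [hxU, if_true] at hx'
    exact hUK hp (hx' ▸ hrK _)
  · simp only [hxU, if_false] at hx'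
    rw [hx'] at hxU
    exact hxU hp

theorem retract_compl_preconnected {n : ℕ} (hn : 2 ≤ n) {K : Set (Eu n)} (hK : IsCompact K)
    {r : Eu n → Eu n}
    (hr : Continuous r) (hrK : ∀ x, r x ∈ K) (hrid : ∀ x ∈ K, r x = x) : IsPreconnected Kᶜ := by
  rw [isPreconnected_iff_subset_of_disjoint]
  intro u v hu hv huv hd
  obtain ⟨R, hRpos, hR⟩ := hK.isBounded.subset_ball_lt 0 (0 : Eu n)
  have hR' : ∀ x ∈ K, ‖x‖ < R := fun x hx => by simpa using hR hx
  have hext : {x : Eu n | R < ‖x‖} ⊆ Kᶜ := fun x hx hxK => by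
    have := hR' x hxK
    have h2 : R < ‖x‖ := hx
    linarith
  have key : ∀ u v : Set (Eu n), IsOpen u → IsOpen v → Kᶜ ⊆ u ∪ v → Kᶜ ∩ (u ∩ v) = ∅ →
      {x : Eu n | R < ‖x‖} ⊆ v → Kᶜ ⊆ v := by
    intro u v hu hv huv hd hsub
    have hU : Kᶜ ∩ u = ∅ := by
      refine no_bounded_piece (by omega) hr hrK hrid inter_subset_left ?_ (R := R) ?_
      · intro x hx
        by_contra hxK
        have hop : IsOpen (Kᶜ ∩ u) := hK.isClosed.isOpen_compl.inter hu
        rw [hop.frontier_eq] at hx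
        have hxv : x ∈ v := by
          rcases huv hxK with h | h
          · exact absurd ⟨hxK, h⟩ hx.2
          · exact h
        obtain ⟨y, hy1, hy2⟩ := mem_closure_iff.1 hx.1 v hv hxv
        have : y ∈ Kᶜ ∩ (u ∩ v) := ⟨hy2.1, hy2.2, hy1⟩
        rw [hd] at this
        exact this
      · intro x hx
        by_contra h
        push Not at h
        have : x ∈ Kᶜ ∩ (u ∩ v) := ⟨hx.1, hx.2, hsub h⟩
        rw [hd] at this
        exact this
    intro x hx
    rcases huv hx with h | h
    · have : x ∈ Kᶜ ∩ u := ⟨hx, h⟩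
      rw [hU] at this
      exact this.elim
    · exact h
  have hE := isPreconnected_iff_subset_of_disjoint.1 (exterior_preconnected hn hRpos.le) u v hu hv
    (hext.trans huv) (by
      rw [← subset_empty_iff, ← hd]
      exact inter_subset_inter_left _ hext)
  rcases hE with h | h
  · left
    exact key v u hv hu (by rwa [union_comm]) (by rwa [inter_comm v u]) h
  · right
    exact key u v hu hv huv hd h

theorem continuousOn_invFunOn {X Y : Type*} [TopologicalSpace X] [TopologicalSpace Y] [T2Space Y]
    [Nonempty X] {K : Set X} (hK : IsCompact K) {f : X → Y} (hf : ContinuousOn f K)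
    (hinj : InjOn f K) : ContinuousOn (Function.invFunOn f K) (f '' K) := by
  rw [continuousOn_iff_isClosed]
  intro t ht
  refine ⟨f '' (K ∩ t), ((hK.inter_right ht).image_of_continuousOn
    (hf.mono inter_subset_left)).isClosed, ?_⟩
  ext y
  constructor
  · rintro ⟨h1, x, hx, rfl⟩
    rw [mem_preimage, hinj.leftInvOn_invFunOn hx] at h1
    exact ⟨⟨x, ⟨hx, h1⟩, rfl⟩, x, hx, rfl⟩
  · rintro ⟨⟨x, ⟨hx, hxt⟩, rfl⟩, -⟩
    refine ⟨?_, x, hx, rfl⟩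
    rw [mem_preimage, hinj.leftInvOn_invFunOn hx]
    exact hxt

theorem clip_exists (n : ℕ) : ∃ c : Eu n → Eu n, Continuous c ∧ (∀ x, c x ∈ closedBall (0 : Eu n) 1) ∧
    ∀ x ∈ closedBall (0 : Eu n) 1, c x = x := by
  refine ⟨fun x => (max 1 ‖x‖)⁻¹ • x, ?_, ?_, ?_⟩
  · refine Continuous.smul (Continuous.inv₀ (continuous_const.max continuous_norm) fun x => ?_) continuous_id
    have : (1 : ℝ) ≤ max 1 ‖x‖ := le_max_left _ _
    linarith
  · intro x
    have h1 : (1 : ℝ) ≤ max 1 ‖x‖ := le_max_left _ _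
    have h2 : ‖x‖ ≤ max 1 ‖x‖ := le_max_right _ _
    rw [mem_closedBall_zero_iff, norm_smul, norm_inv, Real.norm_of_nonneg (by linarith)]
    rw [inv_mul_le_iff₀ (by linarith)]
    linarith
  · intro x hx
    rw [mem_closedBall_zero_iff] at hx
    simp [max_eq_left hx]

theorem open_image_unit_ball {n : ℕ} (hn : 2 ≤ n) {f : Eu n → Eu n}
    (hf : ContinuousOn f (closedBall 0 1)) (hinj : InjOn f (closedBall 0 1)) :
    IsOpen (f '' ball 0 1) := by
  have hD : IsCompact (closedBall (0 : Eu n) 1) := isCompact_closedBall _ _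
  have hSD : sphere (0 : Eu n) 1 ⊆ closedBall 0 1 := sphere_subset_closedBall
  have hBD : ball (0 : Eu n) 1 ⊆ closedBall 0 1 := ball_subset_closedBall
  have hg := continuousOn_invFunOn hD hf hinj
  have hgl := hinj.leftInvOn_invFunOn
  set g := Function.invFunOn f (closedBall 0 1) with hgdef
  have hfD := hD.image_of_continuousOn hf
  -- complement of the disc image is connected
  have hB : IsPreconnected (f '' closedBall 0 1)ᶜ := by
    obtain ⟨g', hg'c, hg'⟩ := tietze hfD.isClosed hg
    obtain ⟨c, hc, hcD, hcid⟩ := clip_exists n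
    refine retract_compl_preconnected hn hfD (r := fun x => f (c (g' x))) ?_ ?_ ?_
    · exact hf.comp_continuous (hc.comp hg'c) fun x => hcD _
    · exact fun x => ⟨_, hcD _, rfl⟩
    · rintro _ ⟨x, hx, rfl⟩
      rw [hg' ⟨x, hx, rfl⟩, hgl hx, hcid x hx]
  have hA : IsPreconnected (f '' ball 0 1) :=
    (convex_ball (0 : Eu n) 1).isPreconnected.image _ (hf.mono hBD)
  have hfS : IsCompact (f '' sphere 0 1) := (isCompact_sphere _ _).image_of_continuousOn (hf.mono hSD)
  have hW : ¬ IsPreconnected (f '' sphere 0 1)ᶜ := by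
    refine separation hn hfS (σ := g) (τ := f) (hg.mono (image_mono hSD)) ?_ (hf.mono hSD)
      (fun y hy => ⟨y, hy, rfl⟩) (fun y hy => hgl (hSD hy))
    rintro _ ⟨x, hx, rfl⟩
    rw [hgl (hSD hx)]
    simpa using hx
  have hunion : (f '' sphere 0 1)ᶜ = f '' ball 0 1 ∪ (f '' closedBall 0 1)ᶜ := by
    ext y
    constructor
    · intro hy
      by_cases h : y ∈ f '' closedBall 0 1
      · obtain ⟨x, hx, rfl⟩ := h
        left
        refine ⟨x, ?_, rfl⟩
        rw [← ball_union_sphere] at hx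
        rcases hx with h | h
        · exact h
        · exact absurd ⟨x, h, rfl⟩ hy
      · exact Or.inr h
    · rintro (⟨x, hx, rfl⟩ | h)
      · rintro ⟨x', hx', he⟩
        have := hinj (hSD hx') (hBD hx) he
        subst this
        simp at hx hx'
        linarith
      · exact fun hy => h (image_mono hSD hy)
  rw [isPreconnected_iff_subset_of_disjoint] at hW
  push Not at hW
  obtain ⟨u, v, hu, hv, huv, hd, hnu, hnv⟩ := hW
  have hWo : IsOpen (f '' sphere 0 1)ᶜ := hfS.isClosed.isOpen_compl
  have sub1 : f '' ball 0 1 ⊆ (f '' sphere 0 1)ᶜ := by rw [hunion]; exact subset_union_left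
  have sub2 : (f '' closedBall 0 1)ᶜ ⊆ (f '' sphere 0 1)ᶜ := by rw [hunion]; exact subset_union_right
  have hA' := isPreconnected_iff_subset_of_disjoint.1 hA u v hu hv (sub1.trans huv) (by
    rw [← subset_empty_iff, ← hd]; exact inter_subset_inter_left _ sub1)
  have hB' := isPreconnected_iff_subset_of_disjoint.1 hB u v hu hv (sub2.trans huv) (by
    rw [← subset_empty_iff, ← hd]; exact inter_subset_inter_left _ sub2)
  have fin : ∀ u v : Set (Eu n), IsOpen u → (f '' sphere 0 1)ᶜ ∩ (u ∩ v) = ∅ →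
      f '' ball 0 1 ⊆ u → (f '' closedBall 0 1)ᶜ ⊆ v → IsOpen (f '' ball 0 1) := by
    intro u v hu hd h1 h2
    have : f '' ball 0 1 = (f '' sphere 0 1)ᶜ ∩ u := by
      refine subset_antisymm (subset_inter sub1 h1) ?_
      rintro y ⟨hy, hyu⟩
      have hy' := hy
      rw [hunion] at hy'
      rcases hy' with h | h
      · exact h
      · have : y ∈ (f '' sphere 0 1)ᶜ ∩ (u ∩ v) := ⟨hy, hyu, h2 h⟩
        rw [hd] at this
        exact this.elim
    rw [this]
    exact hWo.inter hu
  rcases hA' with h1 | h1 <;> rcases hB' with h2 | h2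
  · exact absurd (by rw [hunion]; exact union_subset h1 h2) hnu
  · exact fin u v hu hd h1 h2
  · exact fin v u hv (by rwa [inter_comm v u]) h1 h2
  · exact absurd (by rw [hunion]; exact union_subset h1 h2) hnv

theorem inv_domain_real {f : ℝ → ℝ} {U : Set ℝ} (hU : IsOpen U) (hf : ContinuousOn f U)
    (hinj : InjOn f U) : IsOpen (f '' U) := by
  rw [isOpen_iff_mem_nhds]
  rintro _ ⟨x, hx, rfl⟩
  obtain ⟨ε, hε, hεU⟩ := Metric.nhds_basis_closedBall.mem_iff.1 (hU.mem_nhds hx)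
  rw [Real.closedBall_eq_Icc] at hεU
  have hab : x - ε ≤ x + ε := by linarith
  have hc := hf.mono hεU
  have hi := hinj.mono hεU
  have hsub : Ioo (x - ε) (x + ε) ⊆ U := Ioo_subset_Icc_self.trans hεU
  have m1 : x - ε ∈ Icc (x - ε) (x + ε) := left_mem_Icc.2 hab
  have m2 : x + ε ∈ Icc (x - ε) (x + ε) := right_mem_Icc.2 hab
  have m3 : x ∈ Icc (x - ε) (x + ε) := ⟨by linarith, by linarith⟩
  rcases hc.strictMonoOn_of_injOn_Icc' hab hi with h | h
  · refine mem_of_superset (Ioo_mem_nhds (h m1 m3 (by linarith)) (h m3 m2 (by linarith))) ?_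
    exact (intermediate_value_Ioo hab hc).trans (image_mono hsub)
  · refine mem_of_superset (Ioo_mem_nhds (h m3 m2 (by linarith)) (h m1 m3 (by linarith))) ?_
    exact (intermediate_value_Ioo' hab hc).trans (image_mono hsub)

/-- Invariance of domain. -/
theorem inv_domain {n : ℕ} (hn : 0 < n) {f : Eu n → Eu n} {U : Set (Eu n)} (hU : IsOpen U)
    (hf : ContinuousOn f U) (hinj : InjOn f U) : IsOpen (f '' U) := by
  rcases Nat.lt_or_ge 1 n with h2 | h1
  · rw [isOpen_iff_mem_nhds]
    rintro _ ⟨x, hx, rfl⟩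
    obtain ⟨ε, hε, hεU⟩ := Metric.nhds_basis_closedBall.mem_iff.1 (hU.mem_nhds hx)
    have hmap : ∀ y ∈ closedBall (0 : Eu n) 1, x + ε • y ∈ closedBall x ε := by
      intro y hy
      rw [mem_closedBall_zero_iff] at hy
      rw [mem_closedBall, dist_eq_norm, add_sub_cancel_left, norm_smul, Real.norm_of_nonneg hε.le]
      nlinarith
    have hop := open_image_unit_ball (n := n) h2 (f := fun y => f (x + ε • y)) (by
      refine hf.comp (by fun_prop) fun y hy => hεU (hmap y hy)) (by
      intro y hy y' hy' h
      have := hinj (hεU (hmap y hy)) (hεU (hmap y' hy')) h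
      have h3 := add_left_cancel this
      exact smul_right_injective _ hε.ne' h3)
    refine mem_of_superset (hop.mem_nhds ⟨0, by simp, by simp⟩) ?_
    rintro _ ⟨y, hy, rfl⟩
    exact ⟨_, hεU (hmap y (ball_subset_closedBall hy)), rfl⟩
  · have : n = 1 := by omega
    subst this
    let e : Eu 1 ≃ₜ ℝ := (EuclideanSpace.equiv (Fin 1) ℝ).toHomeomorph.trans (Homeomorph.funUnique (Fin 1) ℝ)
    have := inv_domain_real (f := fun t => e (f (e.symm t))) (U := e.symm ⁻¹' U)
      (hU.preimage e.symm.continuous)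
      (e.continuous.comp_continuousOn (hf.comp e.symm.continuous.continuousOn fun x hx => hx))
      (fun x hx y hy h => e.symm.injective (hinj hx hy (e.injective h)))
    have h3 : f '' U = e ⁻¹' ((fun t => e (f (e.symm t))) '' (e.symm ⁻¹' U)) := by
      ext y
      constructor
      · rintro ⟨x, hx, rfl⟩
        exact ⟨e x, by simpa using hx, by simp⟩
      · rintro ⟨t, ht, h⟩
        exact ⟨e.symm t, ht, e.injective h⟩
    rw [h3]
    exact this.preimage e.continuous

end Cantrell
end

section
open Set Metric Filter Topology MeasureTheory

/-- The unit sphere in `ℝⁿ⁺¹`. -/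
abbrev Sp (n : ℕ) : Type := Metric.sphere (0 : Eu (n + 1)) 1

namespace Cantrell

theorem homeo_to_fun {X Y : Type*} [TopologicalSpace X] [TopologicalSpace Y] [Nonempty X] [Nonempty Y]
    {S : Set X} {T : Set Y} (e : S ≃ₜ T) : ∃ (f : X → Y) (g : Y → X), ContinuousOn f S ∧
      ContinuousOn g T ∧ MapsTo f S T ∧ MapsTo g T S ∧ (∀ x ∈ S, g (f x) = x) ∧
      (∀ y ∈ T, f (g y) = y) ∧ (∀ x : S, f x = e x) ∧ ∀ y : T, g y = e.symm y := by
  classical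
  let f : X → Y := fun x => if h : x ∈ S then e ⟨x, h⟩ else Classical.arbitrary Y
  let g : Y → X := fun y => if h : y ∈ T then e.symm ⟨y, h⟩ else Classical.arbitrary X
  have hf : ∀ x : S, f x = e x := fun x => by simp [f]
  have hg : ∀ y : T, g y = e.symm y := fun x => by simp [g]
  refine ⟨f, g, ?_, ?_, ?_, ?_, ?_, ?_, hf, hg⟩
  · rw [continuousOn_iff_continuous_domRestrict]
    have : S.domRestrict f = fun x => (e x : Y) := funext fun x => hf x
    rw [this]; fun_prop
  · rw [continuousOn_iff_continuous_domRestrict]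
    have : T.domRestrict g = fun x => (e.symm x : X) := funext fun x => hg x
    rw [this]; fun_prop
  · intro x hx; rw [hf ⟨x, hx⟩]; exact (e _).2
  · intro x hx; rw [hg ⟨x, hx⟩]; exact (e.symm _).2
  · intro x hx; rw [hf ⟨x, hx⟩, hg, e.symm_apply_apply]
  · intro x hx; rw [hg ⟨x, hx⟩, hf, e.apply_symm_apply]

instance factFinrank (n : ℕ) : Fact (Module.finrank ℝ (Eu (n + 1)) = n + 1) :=
  ⟨finrank_euclideanSpace_fin⟩

/-- Stereographic chart. -/
noncomputable def st {n : ℕ} (v : Sp n) : OpenPartialHomeomorph (Sp n) (Eu n) := stereographic' n v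

theorem st_source {n : ℕ} (v : Sp n) : (st v).source = {v}ᶜ := stereographic'_source v
theorem st_target {n : ℕ} (v : Sp n) : (st v).target = univ := stereographic'_target v

theorem st_left {n : ℕ} {v x : Sp n} (h : x ≠ v) : (st v).symm (st v x) = x :=
  (st v).left_inv (by rw [st_source]; exact h)
theorem st_right {n : ℕ} (v : Sp n) (y : Eu n) : st v ((st v).symm y) = y :=
  (st v).right_inv (by rw [st_target]; trivial)
theorem st_symm_ne {n : ℕ} (v : Sp n) (y : Eu n) : (st v).symm y ≠ v := by
  have := (st v).map_target (x := y) (by rw [st_target]; trivial)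
  rw [st_source] at this
  exact this
theorem st_cont {n : ℕ} (v : Sp n) : ContinuousOn (st v) {v}ᶜ := by
  rw [← st_source]; exact (st v).continuousOn
theorem st_symm_cont {n : ℕ} (v : Sp n) : Continuous (st v).symm := by
  have := (st v).symm.continuousOn
  rwa [OpenPartialHomeomorph.symm_source, st_target, ← continuousOn_univ.symm.eq] at this
theorem st_open {n : ℕ} (v : Sp n) {U : Set (Sp n)} (hU : IsOpen U) (h : U ⊆ {v}ᶜ) :
    IsOpen (st v '' U) := (st v).isOpen_image_of_subset_source hU (by rwa [st_source])
theorem st_symm_open {n : ℕ} (v : Sp n) {U : Set (Eu n)} (hU : IsOpen U) :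
    IsOpen ((st v).symm '' U) := (st v).symm.isOpen_image_of_subset_source hU (by
      rw [OpenPartialHomeomorph.symm_source, st_target]; exact subset_univ _)

theorem jordan_brouwer {n : ℕ} (hn : 2 ≤ n) {S : Set (Sp n)} (e : S ≃ₜ sphere (0 : Eu n) 1)
    {x : Sp n} (hx : x ∉ S) : ¬ IsPreconnected Sᶜ := by
  intro hcon
  have hScomp : IsCompact S := by
    rw [isCompact_iff_compactSpace]
    exact e.symm.compactSpace
  have : Nonempty (Sp n) := ⟨x⟩
  obtain ⟨f, g, hf, hg, hfS, hgS, hgf, hfg, -, -⟩ := homeo_to_fun e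
  have hop : IsOpen Sᶜ := hScomp.isClosed.isOpen_compl
  -- nonempty
  obtain ⟨s0, hs0⟩ : S.Nonempty := by
    obtain ⟨q0, hq0⟩ := exists_large (n := n) (by omega) 0
    exact ⟨_, hgS (show ‖q0‖⁻¹ • q0 ∈ sphere (0 : Eu n) 1 by simp [norm_smul, hq0.ne'])⟩
  have hSs : Sᶜ ⊆ {s0}ᶜ := fun y hy h => hy (h ▸ hs0)
  have h1 : IsPreconnected (st s0 '' Sᶜ \ {st s0 x}) :=
    preconnected_diff_singleton hn (st_open s0 hop hSs) (hcon.image _ ((st_cont s0).mono hSs)) _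
  have h2 : IsPreconnected (Sᶜ \ {x}) := by
    have h3 := h1.image (st s0).symm (st_symm_cont s0).continuousOn
    convert h3 using 1
    ext y
    constructor
    · rintro ⟨hy, hyx⟩
      refine ⟨st s0 y, ⟨⟨y, hy, rfl⟩, fun h => hyx ?_⟩, st_left (hSs hy)⟩
      have h : st s0 y = st s0 x := h
      have := congrArg (st s0).symm h
      rwa [st_left (hSs hy), st_left (hSs hx)] at this
    · rintro ⟨_, ⟨⟨y, hy, rfl⟩, hyx⟩, rfl⟩
      rw [st_left (hSs hy)]
      exact ⟨hy, fun h => hyx (by rw [mem_singleton_iff.1 h]; rfl)⟩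
  have hSx : S ⊆ {x}ᶜ := fun y hy h => hx (h ▸ hy)
  have hK : IsCompact (st x '' S) := hScomp.image_of_continuousOn ((st_cont x).mono hSx)
  refine separation hn hK (σ := fun y => f ((st x).symm y)) (τ := fun z => st x (g z)) ?_ ?_ ?_ ?_ ?_ ?_
  · refine hf.comp (st_symm_cont x).continuousOn ?_
    rintro _ ⟨y, hy, rfl⟩
    rwa [st_left (hSx hy)]
  · rintro _ ⟨y, hy, rfl⟩
    rw [st_left (hSx hy)]
    simpa using hfS hy
  · exact (st_cont x).comp hg fun z hz => hSx (hgS hz)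
  · exact fun y hy => ⟨_, hgS hy, rfl⟩
  · intro y hy
    rw [st_left (hSx (hgS hy)), hfg y hy]
  · convert h2.image (st x) ((st_cont x).mono fun y hy => hy.2) using 1
    ext y
    constructor
    · intro hy
      refine ⟨(st x).symm y, ⟨fun h => hy ⟨_, h, st_right _ _⟩, st_symm_ne x y⟩, st_right _ _⟩
    · rintro ⟨z, ⟨hz, hzx⟩, rfl⟩ ⟨w, hw, hwz⟩
      have := congrArg (st x).symm hwz
      rw [st_left (hSx hw), st_left hzx] at this
      exact hz (this ▸ hw)

end Cantrell
end

section
open Set Metric Filter Topology MeasureTheory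

namespace Cantrell

/-- Closed half space. -/
def half (m : ℕ) : Set (Eu (m + 1)) := {v | 0 ≤ v 0}

theorem isClosed_half (m : ℕ) : IsClosed (half m) :=
  isClosed_le continuous_const (by fun_prop)

/-- A half-space chart of `X`, given by total functions. -/
structure Chart {m : ℕ} (X : Set (Sp (m + 1))) where
  O : Set (Sp (m + 1))
  Q : Set (Eu (m + 1))
  f : Sp (m + 1) → Eu (m + 1)
  g : Eu (m + 1) → Sp (m + 1)
  hO : IsOpen O
  hQ : IsOpen Q
  fc : ContinuousOn f (X ∩ O)
  gc : ContinuousOn g (half m ∩ Q)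
  fm : MapsTo f (X ∩ O) (half m ∩ Q)
  gm : MapsTo g (half m ∩ Q) (X ∩ O)
  gf : ∀ x ∈ X ∩ O, g (f x) = x
  fg : ∀ v ∈ half m ∩ Q, f (g v) = v

theorem chart_exists {m : ℕ} {X : Set (Sp (m + 1))} (x : X) {U : Set X} (hU : IsOpen U)
    (hx : x ∈ U) {V : Set (EuclideanHalfSpace (m + 1))} (hV : IsOpen V) (e : U ≃ₜ V) :
    ∃ c : Chart X, (x : Sp (m + 1)) ∈ c.O := by
  have he1 : IsEmbedding (Subtype.val : X → Sp (m + 1)) := IsEmbedding.subtypeVal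
  have he2 : IsEmbedding (Subtype.val : EuclideanHalfSpace (m + 1) → Eu (m + 1)) :=
    IsEmbedding.subtypeVal
  let e' := (he1.homeomorphImage U).symm.trans (e.trans (he2.homeomorphImage V))
  obtain ⟨O, hO, rfl⟩ := isOpen_induced_iff.1 hU
  obtain ⟨Q, hQ, rfl⟩ := isOpen_induced_iff.1 hV
  have h1 : (Subtype.val '' (Subtype.val ⁻¹' O : Set X)) = X ∩ O := by
    rw [image_preimage_eq_inter_range, Subtype.range_val, inter_comm]
  have h2 : (Subtype.val '' (Subtype.val ⁻¹' Q : Set (EuclideanHalfSpace (m + 1)))) = half m ∩ Q := by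
    rw [image_preimage_eq_inter_range]
    have : range (Subtype.val : EuclideanHalfSpace (m + 1) → Eu (m + 1)) = half m := by
      exact Subtype.range_val
    rw [this, inter_comm]
  have : Nonempty (Sp (m + 1)) := ⟨x⟩
  obtain ⟨f, g, hf, hg, hfS, hgS, hgf, hfg, -, -⟩ := homeo_to_fun e'
  rw [h1] at hf hfS hgS hgf
  rw [h2] at hg hfS hgS hfg
  exact ⟨⟨O, Q, f, g, hO, hQ, hf, hg, hfS, hgS, hgf, hfg⟩, hx⟩

theorem self_eq_neg_E {n : ℕ} {x : Eu n} (h : x = -x) : x = 0 := by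
  ext i
  have := congrArg (fun z : Eu n => z i) h
  simp at this
  simp
  linarith

theorem inv_domain_sphere {n : ℕ} (hn : 0 < n) {f : Eu n → Sp n} {U : Set (Eu n)} (hU : IsOpen U)
    (hf : ContinuousOn f U) (hinj : InjOn f U) : IsOpen (f '' U) := by
  rw [isOpen_iff_mem_nhds]
  rintro _ ⟨x, hx, rfl⟩
  set v : Sp n := - f x with hv
  have hne : f x ≠ v := by
    intro h
    have h2 : (f x : Eu (n + 1)) = - (f x : Eu (n + 1)) := by
      have := congrArg Subtype.val h
      simpa [hv] using this
    have h3 : (f x : Eu (n + 1)) = 0 := by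
      have h5 := self_eq_neg_E h2
      exact h5
    have h4 : ‖(f x : Eu (n + 1))‖ = 1 := by simp
    rw [h3, norm_zero] at h4
    norm_num at h4
  have hU' : IsOpen (U ∩ f ⁻¹' {v}ᶜ) := hf.isOpen_inter_preimage hU isOpen_compl_singleton
  have h1 := inv_domain hn (f := fun y => st v (f y)) hU'
    ((st_cont v).comp (hf.mono inter_subset_left) fun y hy => hy.2) (by
      intro y hy z hz h
      have := congrArg (st v).symm h
      simp only at this
      rw [st_left hy.2, st_left hz.2] at this
      exact hinj hy.1 hz.1 this)
  have h2 := st_symm_open v h1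
  refine mem_of_superset (h2.mem_nhds ⟨st v (f x), ⟨x, ⟨hx, hne⟩, rfl⟩, st_left hne⟩) ?_
  rintro _ ⟨_, ⟨y, hy, rfl⟩, rfl⟩
  exact ⟨y, hy.1, (st_left hy.2).symm⟩

theorem inv_domain_sphere' {n : ℕ} (hn : 0 < n) {f : Sp n → Eu n} {U : Set (Sp n)} (hU : IsOpen U)
    (hf : ContinuousOn f U) (hinj : InjOn f U) {x : Sp n} (hx : x ∈ U) :
    ∃ W ⊆ f '' U, IsOpen W ∧ f x ∈ W := by
  set v : Sp n := - x with hv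
  have hne : x ≠ v := by
    intro h
    have h2 : (x : Eu (n + 1)) = - (x : Eu (n + 1)) := by
      have := congrArg Subtype.val h
      simpa [hv] using this
    have h3 : (x : Eu (n + 1)) = 0 := self_eq_neg_E h2
    have h4 : ‖(x : Eu (n + 1))‖ = 1 := by simp
    rw [h3, norm_zero] at h4
    norm_num at h4
  have hU' : IsOpen ((st v).symm ⁻¹' U) := hU.preimage (st_symm_cont v)
  have h1 := inv_domain hn (f := fun y => f ((st v).symm y)) hU'
    (hf.comp (st_symm_cont v).continuousOn fun y hy => hy) (by
      intro y hy z hz h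
      have := congrArg (st v) (hinj hy hz h)
      rwa [st_right, st_right] at this)
  refine ⟨_, ?_, h1, ⟨st v x, ?_, ?_⟩⟩
  · rintro _ ⟨y, hy, rfl⟩
    exact ⟨_, hy, rfl⟩
  · simpa [mem_preimage, st_left hne] using hx
  · simp only [st_left hne]

/-- Basis vector. -/
noncomputable def e0 (m : ℕ) : Eu (m + 1) := EuclideanSpace.single 0 1

@[simp] theorem e0_zero (m : ℕ) : e0 m 0 = 1 := by simp [e0]

theorem pos_of_open_subset_half {m : ℕ} {W : Set (Eu (m + 1))} (hW : IsOpen W) (h : W ⊆ half m)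
    {v : Eu (m + 1)} (hv : v ∈ W) : 0 < v 0 := by
  by_contra hneg
  push Not at hneg
  have hc : Continuous fun t : ℝ => v - t • e0 m := by fun_prop
  have h1 : ∀ᶠ t in 𝓝 (0 : ℝ), v - t • e0 m ∈ W :=
    hc.continuousAt.eventually (by simpa using hW.mem_nhds hv)
  have h2 : ∀ᶠ t in 𝓝[>] (0 : ℝ), v - t • e0 m ∈ W ∧ 0 < t :=
    (h1.filter_mono nhdsWithin_le_nhds).and self_mem_nhdsWithin
  obtain ⟨t, ht, ht0⟩ := h2.exists
  have h3 : 0 ≤ (v - t • e0 m) 0 := h ht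
  simp at h3
  linarith

theorem chart_interior {m : ℕ} {X : Set (Sp (m + 1))} (c : Chart X) {y : Sp (m + 1)}
    (hy : y ∈ X ∩ c.O) : y ∈ interior X ↔ 0 < c.f y 0 := by
  constructor
  · intro hyi
    have hsub : interior X ∩ c.O ⊆ X ∩ c.O := inter_subset_inter_left _ interior_subset
    obtain ⟨W, hW1, hW2, hW3⟩ := inv_domain_sphere' (Nat.succ_pos m) (isOpen_interior.inter c.hO)
      (c.fc.mono hsub) (fun a ha b hb h => by
        rw [← c.gf a (hsub ha), ← c.gf b (hsub hb), h]) (x := y) ⟨hyi, hy.2⟩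
    refine pos_of_open_subset_half hW2 ?_ hW3
    rintro _ hv
    obtain ⟨z, hz, rfl⟩ := hW1 hv
    exact (c.fm (hsub hz)).1
  · intro hpos
    have hop : IsOpen (c.Q ∩ {v : Eu (m + 1) | 0 < v 0}) :=
      c.hQ.inter (isOpen_lt continuous_const (by fun_prop))
    have hsub : c.Q ∩ {v : Eu (m + 1) | 0 < v 0} ⊆ half m ∩ c.Q :=
      fun v hv => ⟨show (0 : ℝ) ≤ v 0 from le_of_lt hv.2, hv.1⟩
    have h1 := inv_domain_sphere (Nat.succ_pos m) hop (c.gc.mono hsub) (fun a ha b hb h => by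
        rw [← c.fg a (hsub ha), ← c.fg b (hsub hb), h])
    refine mem_interior.2 ⟨_, ?_, h1, ⟨c.f y, ⟨(c.fm hy).2, hpos⟩, c.gf y hy⟩⟩
    rintro _ ⟨v, hv, rfl⟩
    exact (c.gm (hsub hv)).1

/-- Inclusion of the hyperplane. -/
noncomputable def jj (m : ℕ) (v : Eu m) : Eu (m + 1) :=
  WithLp.toLp 2 (Fin.cons (0 : ℝ) (fun i => v i))

theorem jj_zero (m : ℕ) (v : Eu m) : jj m v 0 = 0 := rfl
theorem jj_succ (m : ℕ) (v : Eu m) (i : Fin m) : jj m v i.succ = v i := rfl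
theorem jj_cont (m : ℕ) : Continuous (jj m) := by
  unfold jj
  refine (PiLp.continuous_toLp 2 _).comp (continuous_pi fun i => ?_)
  refine Fin.cases ?_ (fun i => ?_) i
  · exact continuous_const
  · simp only [Fin.cons_succ]; fun_prop
theorem jj_inj (m : ℕ) : Function.Injective (jj m) := by
  intro a b h
  ext i
  rw [← jj_succ, h, jj_succ]
theorem jj_surj (m : ℕ) {v : Eu (m + 1)} (hv : v 0 = 0) : ∃ w, jj m w = v := by
  refine ⟨WithLp.toLp 2 (fun i => v i.succ), ?_⟩
  ext i
  refine Fin.cases ?_ (fun i => ?_) i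
  · rw [jj_zero, hv]
  · rw [jj_succ]

theorem bdry_eq {m : ℕ} (hm : 0 < m) {X S : Set (Sp (m + 1))} (hX : IsClosed X)
    (hXne : X ≠ univ) (hXn : X.Nonempty)
    (e : S ≃ₜ sphere (0 : Eu (m + 1)) 1) (hsub : X \ interior X ⊆ S)
    (hch : ∀ x ∈ X, ∃ c : Chart X, x ∈ c.O) : X \ interior X = S := by
  have hm2 : 2 ≤ m + 1 := by omega
  have hpre : IsPreconnected (univ : Set (Sp m)) :=
    (isPreconnected_iff_preconnectedSpace.1 (isPreconnected_sphere (one_lt_rank_Eu hm2) (0 : Eu (m + 1)) 1)).isPreconnected_univ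
  have hpre1 : PreconnectedSpace (Sp (m + 1)) := 
    isPreconnected_iff_preconnectedSpace.1 (isPreconnected_sphere (one_lt_rank_Eu (show 2 ≤ m + 1 + 1 by omega)) (0 : Eu (m + 1 + 1)) 1)
  have hcl : IsClosed (X \ interior X) := hX.sdiff isOpen_interior
  have hne : (X \ interior X).Nonempty := by
    by_contra h
    rw [not_nonempty_iff_eq_empty, sdiff_eq_empty] at h
    have hcl : IsClopen X := ⟨hX, by rw [subset_antisymm h interior_subset]; exact isOpen_interior⟩
    rcases isClopen_iff.1 hcl with h | h
    · exact hXn.ne_empty h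
    · exact hXne h
  have : Nonempty (Sp (m + 1)) := ⟨hne.some⟩
  obtain ⟨f, g, hf, hg, hfS, hgS, hgf, hfg, -, hge⟩ := homeo_to_fun e
  let T : Set (Sp m) := {y | g y ∈ X \ interior X}
  have hTc : IsClosed T := by
    have : T = (fun y => (e.symm y : Sp (m + 1))) ⁻¹' (X \ interior X) := by
      ext y
      change g y ∈ X \ interior X ↔ (e.symm y : Sp (m + 1)) ∈ X \ interior X
      rw [hge]
    rw [this]
    exact hcl.preimage (by fun_prop)
  have hTo : IsOpen T := by
    rw [isOpen_iff_mem_nhds]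
    intro y hy
    obtain ⟨c, hc⟩ := hch _ hy.1
    have hsub2 : ∀ v : Eu m, v ∈ jj m ⁻¹' c.Q → jj m v ∈ half m ∩ c.Q := fun v hv =>
      ⟨(jj_zero m v).ge, hv⟩
    have hb : ∀ v : Eu m, v ∈ jj m ⁻¹' c.Q → c.g (jj m v) ∈ X \ interior X := by
      intro v hv
      have h1 := c.gm (hsub2 v hv)
      refine ⟨h1.1, fun h2 => ?_⟩
      rw [chart_interior c h1, c.fg _ (hsub2 v hv), jj_zero] at h2
      exact lt_irrefl _ h2
    classical
    let F : Eu m → Sp m := fun v => if h : c.g (jj m v) ∈ S then e ⟨_, h⟩ else y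
    have hFv : ∀ v : Eu m, v ∈ jj m ⁻¹' c.Q → (F v : Eu (m + 1)) = f (c.g (jj m v)) := by
      intro v hv
      have h : c.g (jj m v) ∈ S := hsub (hb v hv)
      simp only [F, h, dif_pos]
      symm
      rw [← hfg _ (e ⟨_, h⟩).2, hge, e.symm_apply_apply]
    have hgF : ∀ v : Eu m, v ∈ jj m ⁻¹' c.Q → g (F v) = c.g (jj m v) := by
      intro v hv
      rw [hFv v hv, hgf _ (hsub (hb v hv))]
    have hop := inv_domain_sphere hm (f := F) (c.hQ.preimage (jj_cont m)) (by
      rw [continuousOn_iff_continuous_domRestrict, continuous_induced_rng]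
      have : ContinuousOn (fun v => f (c.g (jj m v))) (jj m ⁻¹' c.Q) := 
        hf.comp (c.gc.comp (jj_cont m).continuousOn hsub2) (fun v hv => hsub (hb v hv))
      rw [continuousOn_iff_continuous_domRestrict] at this
      convert this using 1
      ext1 v
      exact hFv v v.2) (by
      intro a ha b hb' h
      have h2 : c.g (jj m a) = c.g (jj m b) := by rw [← hgF a ha, ← hgF b hb', h]
      have h3 := congrArg c.f h2
      rw [c.fg _ (hsub2 a ha), c.fg _ (hsub2 b hb')] at h3
      exact jj_inj m h3)
    refine mem_of_superset (hop.mem_nhds ?_) ?_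
    · have hy0 : c.f (g y) 0 = 0 := by
        have h1 := (c.fm ⟨hy.1, hc⟩).1
        have h2 := hy.2
        rw [chart_interior c ⟨hy.1, hc⟩] at h2
        exact le_antisymm (not_lt.1 h2) h1
      obtain ⟨w, hw⟩ := jj_surj m hy0
      have hwQ : w ∈ jj m ⁻¹' c.Q := by
        rw [mem_preimage, hw]; exact (c.fm ⟨hy.1, hc⟩).2
      refine ⟨w, hwQ, ?_⟩
      apply Subtype.ext
      rw [hFv w hwQ, hw, c.gf _ ⟨hy.1, hc⟩, hfg _ y.2]
    · rintro _ ⟨v, hv, rfl⟩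
      change g (F v) ∈ X \ interior X
      rw [hgF v hv]
      exact hb v hv
  have hTu : T = univ := by
    have : PreconnectedSpace (Sp m) := ⟨hpre⟩
    rcases isClopen_iff.1 (⟨hTc, hTo⟩ : IsClopen T) with h | h
    · exfalso
      obtain ⟨x, hx⟩ := hne
      have : (⟨f x, hfS (hsub hx)⟩ : Sp m) ∈ T := by
        change g (f x) ∈ X \ interior X
        rwa [hgf x (hsub hx)]
      rw [h] at this
      exact this
    · exact h
  refine subset_antisymm hsub fun x hx => ?_
  have : (⟨f x, hfS hx⟩ : Sp m) ∈ T := by rw [hTu]; trivial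
  change g (f x) ∈ X \ interior X at this
  rwa [hgf x hx] at this

instance locConn (n : ℕ) : LocallyConnectedSpace (Sp n) :=
  ChartedSpace.locallyConnectedSpace (Eu n) (Sp n)

/-- Everything needed later about `X = closure H`. -/
theorem main_setup {m : ℕ} (hm : 0 < m) {S H : Set (Sp (m + 1))}
    (e : S ≃ₜ sphere (0 : Eu (m + 1)) 1)
    (hH : ∃ x ∈ Sᶜ, H = connectedComponentIn Sᶜ x)
    (hch : ∀ x ∈ closure H, ∃ c : Chart (closure H), x ∈ c.O) :
    IsOpen H ∧ H.Nonempty ∧ closure H = H ∪ S ∧ Disjoint H S ∧ IsCompact S ∧ (closure H)ᶜ.Nonempty ∧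
    ∀ c : Chart (closure H), ∀ y ∈ closure H ∩ c.O, (y ∈ S ↔ c.f y 0 = 0) := by
  obtain ⟨x, hx, rfl⟩ := hH
  have hScomp : IsCompact S := by
    rw [isCompact_iff_compactSpace]
    exact e.symm.compactSpace
  have hop : IsOpen Sᶜ := hScomp.isClosed.isOpen_compl
  set H := connectedComponentIn Sᶜ x with hHdef
  have hHo : IsOpen H := hop.connectedComponentIn
  have hHS : H ⊆ Sᶜ := connectedComponentIn_subset _ _
  have hxH : x ∈ H := mem_connectedComponentIn hx
  have hout : ∀ y ∈ Sᶜ, y ∉ H → y ∉ closure H := by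
    intro y hy hyH hyc
    obtain ⟨z, hz1, hz2⟩ := mem_closure_iff.1 hyc _ (hop.connectedComponentIn (x := y))
      (mem_connectedComponentIn hy)
    have h1 := connectedComponentIn_eq hz1
    have h2 := connectedComponentIn_eq hz2
    apply hyH
    rw [hHdef, h2, ← h1]
    exact mem_connectedComponentIn hy
  have hXne : (closure H)ᶜ.Nonempty := by
    have h := jordan_brouwer (by omega) e hx
    by_contra hemp
    rw [not_nonempty_iff_eq_empty, compl_empty_iff] at hemp
    apply h
    have : Sᶜ = H := by
      refine subset_antisymm (fun y hy => ?_) hHS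
      by_contra hyH
      exact hout y hy hyH (hemp ▸ mem_univ y)
    rw [this]
    exact isPreconnected_connectedComponentIn
  have hHint : H ⊆ interior (closure H) := interior_maximal subset_closure hHo
  have hsub : closure H \ interior (closure H) ⊆ S := by
    rintro y ⟨hy1, hy2⟩
    by_contra hyS
    by_cases hyH : y ∈ H
    · exact hy2 (hHint hyH)
    · exact hout y hyS hyH hy1
  have hb := bdry_eq hm isClosed_closure (fun h => by rw [h] at hXne; simp at hXne)
    ⟨x, subset_closure hxH⟩ e hsub hch
  refine ⟨hHo, ⟨x, hxH⟩, ?_, ?_, hScomp, hXne, ?_⟩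
  · refine subset_antisymm (fun y hy => ?_) (union_subset subset_closure ?_)
    · by_cases hyS : y ∈ S
      · exact Or.inr hyS
      · left
        by_contra hyH
        exact hout y hyS hyH hy
    · rw [← hb]; exact sdiff_subset
  · rw [disjoint_left]; exact fun y hy => hHS hy
  · intro c y hy
    have h1 := chart_interior c hy
    have h2 : 0 ≤ c.f y 0 := (c.fm hy).1
    rw [← hb]
    constructor
    · rintro ⟨-, h3⟩
      rw [h1] at h3
      exact le_antisymm (not_lt.1 h3) h2
    · intro h3
      refine ⟨hy.1, fun h4 => ?_⟩
      rw [h1, h3] at h4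
      exact lt_irrefl _ h4

end Cantrell
end

section
open Set Metric Filter Topology MeasureTheory

namespace Cantrell

section collar
variable {Y : Type} [TopologicalSpace Y]

/-- `X` with an external collar of variable height `l` attached along `S`. -/
def XL (X S : Set Y) (l : Y → ℝ) : Set (Y × ℝ) :=
  {p | p.1 ∈ X ∧ -l p.1 ≤ p.2 ∧ p.2 ≤ 0 ∧ (p.2 = 0 ∨ p.1 ∈ S)}

/-- The external collar of height `l` can be absorbed. -/
def Good (X S : Set Y) (l : Y → ℝ) : Prop :=
  ∃ ψ : Y × ℝ → Y, ContinuousOn ψ (XL X S l) ∧ BijOn ψ (XL X S l) X ∧ ∀ x ∈ S, ψ (x, -l x) = x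

theorem isClosed_XL {X S : Set Y} (hX : IsClosed X) (hS : IsClosed S) {l : Y → ℝ}
    (hl : Continuous l) : IsClosed (XL X S l) := by
  have h1 : IsClosed {p : Y × ℝ | p.1 ∈ X} := hX.preimage continuous_fst
  have h2 : IsClosed {p : Y × ℝ | -l p.1 ≤ p.2} := isClosed_le (by fun_prop) (by fun_prop)
  have h3 : IsClosed {p : Y × ℝ | p.2 ≤ 0} := isClosed_le (by fun_prop) (by fun_prop)
  have h4 : IsClosed {p : Y × ℝ | p.2 = 0} := isClosed_eq (by fun_prop) (by fun_prop)
  have h5 : IsClosed {p : Y × ℝ | p.1 ∈ S} := hS.preimage continuous_fst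
  exact h1.inter (h2.inter (h3.inter (h4.union h5)))

theorem good_zero (X S : Set Y) : Good X S (fun _ => 0) := by
  refine ⟨Prod.fst, continuous_fst.continuousOn, ⟨fun p hp => hp.1, ?_, ?_⟩, fun x _ => rfl⟩
  · rintro ⟨x, t⟩ ⟨-, h1, h2, -⟩ ⟨x', t'⟩ ⟨-, h3, h4, -⟩ h
    simp at h h1 h2 h3 h4
    ext
    · exact h
    · change t = t'; linarith
  · intro x hx
    exact ⟨(x, 0), ⟨hx, by simp, le_rfl, Or.inl rfl⟩, rfl⟩

theorem good_add {X S : Set Y} (hX : IsClosed X) (hS : IsClosed S) (hSX : S ⊆ X) {l μ : Y → ℝ}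
    (hl : Continuous l) (hl0 : ∀ x, 0 ≤ l x) (hμ : Continuous μ) (hμ0 : ∀ x, 0 ≤ μ x)
    (hgl : Good X S l) (hgμ : Good X S μ) : Good X S (fun x => l x + μ x) := by
  obtain ⟨a, hac, hab, haS⟩ := hgl
  obtain ⟨b, hbc, hbb, hbS⟩ := hgμ
  classical
  let ξ : Y × ℝ → Y × ℝ := fun p => if p.2 < -l p.1 then (p.1, p.2 + l p.1) else (a p, 0)
  have hc1 : IsClosed (XL X S (fun x => l x + μ x)) := isClosed_XL hX hS (hl.add hμ)
  have hsub2 : ∀ p ∈ XL X S (fun x => l x + μ x), -l p.1 ≤ p.2 → p ∈ XL X S l :=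
    fun p hp h => ⟨hp.1, h, hp.2.2⟩
  have hval1 : ∀ p ∈ XL X S (fun x => l x + μ x), p.2 ≤ -l p.1 → p.1 ∈ S →
      ξ p = (p.1, p.2 + l p.1) := by
    intro p hp hle hpS
    by_cases h : p.2 < -l p.1
    · simp [ξ, h]
    · have he : p.2 = -l p.1 := le_antisymm hle (not_lt.1 h)
      simp only [ξ, h, if_false]
      have : p = (p.1, -l p.1) := by rw [← he]
      rw [this, haS _ hpS]
      simp
  have hSof : ∀ p ∈ XL X S (fun x => l x + μ x), p.2 < -l p.1 → p.1 ∈ S := by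
    intro p hp h
    rcases hp.2.2.2 with h0 | h0
    · have := hl0 p.1
      linarith
    · exact h0
  have hξc : ContinuousOn ξ (XL X S (fun x => l x + μ x)) := by
    have hun : XL X S (fun x => l x + μ x) =
        (XL X S (fun x => l x + μ x) ∩ {p | p.2 ≤ -l p.1 ∧ p.1 ∈ S}) ∪
        (XL X S (fun x => l x + μ x) ∩ {p | -l p.1 ≤ p.2}) := by
      ext p
      constructor
      · intro hp
        by_cases h : p.2 < -l p.1
        · exact Or.inl ⟨hp, h.le, hSof p hp h⟩
        · exact Or.inr ⟨hp, not_lt.1 h⟩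
      · rintro (h | h) <;> exact h.1
    rw [hun]
    refine ContinuousOn.union_of_isClosed ?_ ?_ ?_ ?_
    · refine ContinuousOn.congr (f := fun p => (p.1, p.2 + l p.1)) (by fun_prop) ?_
      rintro p ⟨hp, h1, h2⟩
      exact hval1 p hp h1 h2
    · refine ContinuousOn.congr (f := fun p => (a p, (0 : ℝ)))
        ((hac.mono fun p hp => hsub2 p hp.1 hp.2).prodMk continuousOn_const) ?_
      rintro p ⟨hp, h1⟩
      have h1 : -l p.1 ≤ p.2 := h1
      simp [ξ, not_lt.2 h1]
    · have h6 : IsClosed {p : Y × ℝ | p.2 ≤ -l p.1} := isClosed_le (by fun_prop) (by fun_prop)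
      exact hc1.inter (h6.inter (hS.preimage continuous_fst))
    · exact hc1.inter (isClosed_le (by fun_prop) (by fun_prop))
  have hξb : BijOn ξ (XL X S (fun x => l x + μ x)) (XL X S μ) := by
    refine ⟨?_, ?_, ?_⟩
    · intro p hp
      by_cases h : p.2 < -l p.1
      · have h1 : -(l p.1 + μ p.1) ≤ p.2 := hp.2.1
        simp only [ξ, h, if_true]
        refine ⟨hp.1, ?_, ?_, Or.inr (hSof p hp h)⟩ <;> simp only <;> linarith
      · simp only [ξ, h, if_false]
        refine ⟨hab.mapsTo (hsub2 p hp (not_lt.1 h)), ?_, le_rfl, Or.inl rfl⟩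
        simpa using hμ0 _
    · intro p hp q hq h
      by_cases h1 : p.2 < -l p.1 <;> by_cases h2 : q.2 < -l q.1
      · simp only [ξ, h1, h2, if_true, Prod.mk.injEq] at h
        ext
        · exact h.1
        · have := h.2
          rw [h.1] at this
          linarith
      · simp only [ξ, h1, h2, if_true, if_false, Prod.mk.injEq] at h
        linarith [h.2]
      · simp only [ξ, h1, h2, if_true, if_false, Prod.mk.injEq] at h
        linarith [h.2]
      · simp only [ξ, h1, h2, if_false, Prod.mk.injEq] at h
        exact hab.injOn (hsub2 p hp (not_lt.1 h1)) (hsub2 q hq (not_lt.1 h2)) h.1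
    · rintro ⟨x, t⟩ ⟨hx, h1, h2, h3⟩
      simp only at hx h1 h2 h3
      rcases h2.lt_or_eq with h | h
      · have hxS : x ∈ S := h3.resolve_left h.ne
        refine ⟨(x, t - l x), ⟨hx, ?_, ?_, Or.inr hxS⟩, ?_⟩
        · simp only; linarith
        · simp only; linarith [hl0 x]
        · have : t - l x < - l x := by linarith
          simp [ξ, this]
      · obtain ⟨p, hp, rfl⟩ := hab.surjOn hx
        refine ⟨p, ⟨hp.1, ?_, hp.2.2⟩, ?_⟩
        · simp only; linarith [hp.2.1, hμ0 p.1]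
        · simp [ξ, not_lt.2 hp.2.1, h]
  refine ⟨b ∘ ξ, hbc.comp hξc hξb.mapsTo, hbb.comp hξb, ?_⟩
  intro x hx
  have hp : (x, -(l x + μ x)) ∈ XL X S (fun x => l x + μ x) :=
    ⟨hSX hx, le_rfl, by simp only; linarith [hl0 x, hμ0 x], Or.inr hx⟩
  have := hval1 _ hp (by simp only; linarith [hμ0 x]) hx
  rw [Function.comp_apply, this]
  simp only
  rw [show -(l x + μ x) + l x = -μ x by ring]
  exact hbS x hx

theorem good_sum {X S : Set Y} (hX : IsClosed X) (hS : IsClosed S) (hSX : S ⊆ X) {ι : Type*}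
    (t : Finset ι) (l : ι → Y → ℝ)
    (hl : ∀ i, Continuous (l i)) (hl0 : ∀ i x, 0 ≤ l i x) (hg : ∀ i, Good X S (l i)) :
    Good X S (fun x => ∑ i ∈ t, l i x) := by
  classical
  induction t using Finset.induction_on with
  | empty => simpa using good_zero X S
  | insert a s ha ih =>
    simp only [Finset.sum_insert ha]
    exact good_add hX hS hSX (hl a) (hl0 a) (continuous_finsetSum _ fun i _ => hl i)
      (fun x => Finset.sum_nonneg fun i _ => hl0 i x) (hg a) ih

theorem good_global [CompactSpace Y] [T2Space Y] {X S : Set Y} (hX : IsClosed X) (hS : IsClosed S)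
    (hSX : S ⊆ X)
    (hloc : ∀ y ∈ S, ∃ N : Set Y, IsOpen N ∧ y ∈ N ∧ ∀ l : Y → ℝ, Continuous l → (∀ x, 0 ≤ l x) →
      (∀ x, x ∉ N → l x = 0) → Good X S l) : Good X S (fun _ => 1) := by
  choose! N hNo hyN hN using hloc
  let U : S → Set Y := fun y => N y
  obtain ⟨ρ, hρ⟩ := PartitionOfUnity.exists_isSubordinate hS U (fun y => hNo y y.2)
    (fun y hy => mem_iUnion.2 ⟨⟨y, hy⟩, hyN y hy⟩)
  have hfin : {i | (Function.support (ρ i)).Nonempty}.Finite := 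
    ρ.locallyFinite.finite_nonempty_of_compact
  have h1 := good_sum hX hS hSX hfin.toFinset (fun i x => ρ i x) (fun i => (ρ i).continuous)
    (fun i x => ρ.nonneg i x) (fun i => hN i i.2 _ (ρ i).continuous (fun x => ρ.nonneg i x) (by
      intro x hx
      by_contra h
      exact hx (hρ i (subset_tsupport _ h))))
  have h2 : ∀ x ∈ S, ∑ i ∈ hfin.toFinset, ρ i x = 1 := by
    intro x hx
    rw [← ρ.sum_eq_one hx]
    symm
    apply finsum_eq_sum_of_support_subset
    intro i hi
    simp only [Finite.coe_toFinset]
    exact ⟨x, hi⟩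
  obtain ⟨ψ, hc, hb, hs⟩ := h1
  have h3 : XL X S (fun x => ∑ i ∈ hfin.toFinset, ρ i x) = XL X S (fun _ => 1) := by
    ext p
    constructor
    · rintro ⟨q1, q2, q3, q4⟩
      refine ⟨q1, ?_, q3, q4⟩
      rcases q4 with q | q
      · rw [q]; norm_num
      · simp only at q2
        rwa [h2 _ q] at q2
    · rintro ⟨q1, q2, q3, q4⟩
      refine ⟨q1, ?_, q3, q4⟩
      rcases q4 with q | q
      · rw [q]
        have : 0 ≤ ∑ i ∈ hfin.toFinset, ρ i p.1 := Finset.sum_nonneg fun i _ => ρ.nonneg i p.1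
        linarith
      · simp only
        rwa [h2 _ q]
  rw [h3] at hc hb
  refine ⟨ψ, hc, hb, fun x hx => ?_⟩
  have := hs x hx
  simp only at this
  rwa [h2 x hx] at this

end collar

end Cantrell
end

section
open Set Metric Filter Topology MeasureTheory

namespace Cantrell

/-- Projection to the hyperplane. -/
noncomputable def pr (m : ℕ) (v : Eu (m + 1)) : Eu (m + 1) := v - v 0 • e0 m

theorem pr_zero (m : ℕ) (v : Eu (m + 1)) : pr m v 0 = 0 := by simp [pr]
theorem pr_cont (m : ℕ) : Continuous (pr m) := by unfold pr; fun_prop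
theorem pr_add (m : ℕ) (v : Eu (m + 1)) (s : ℝ) : pr m (pr m v + s • e0 m) = pr m v := by
  simp [pr]
theorem pr_add_zero (m : ℕ) (v : Eu (m + 1)) (s : ℝ) : (pr m v + s • e0 m) 0 = s := by
  simp [pr]
theorem pr_self (m : ℕ) (v : Eu (m + 1)) : pr m v + v 0 • e0 m = v := by simp [pr]
theorem pr_of_zero (m : ℕ) {v : Eu (m + 1)} (h : v 0 = 0) : pr m v = v := by simp [pr, h]
theorem norm_e0 (m : ℕ) : ‖e0 m‖ = 1 := by simp [e0]

theorem good_local {m : ℕ} {X S : Set (Sp (m + 1))} (hX : IsClosed X) (hS : IsClosed S) (hSX : S ⊆ X)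
    (c : Chart X) (hcS : ∀ y ∈ X ∩ c.O, (y ∈ S ↔ c.f y 0 = 0)) {y : Sp (m + 1)} (hyS : y ∈ S)
    (hyO : y ∈ c.O) :
    ∃ N : Set (Sp (m + 1)), IsOpen N ∧ y ∈ N ∧ ∀ l : Sp (m + 1) → ℝ, Continuous l →
      (∀ x, 0 ≤ l x) → (∀ x, x ∉ N → l x = 0) → Good X S l := by
  classical
  have hyX : y ∈ X ∩ c.O := ⟨hSX hyS, hyO⟩
  set b := c.f y with hbdef
  have hb0 : b 0 = 0 := (hcS y hyX).1 hyS
  obtain ⟨r, hr, hrQ⟩ : ∃ r > 0, closedBall b (2 * r) ⊆ c.Q := by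
    obtain ⟨ε, hε, h⟩ := Metric.nhds_basis_closedBall.mem_iff.1 (c.hQ.mem_nhds (c.fm hyX).2)
    exact ⟨ε / 2, by linarith, by rwa [show 2 * (ε / 2) = ε by ring]⟩
  let B : Set (Eu (m + 1)) := {v | 0 ≤ v 0 ∧ v 0 ≤ r ∧ ‖pr m v - b‖ ≤ r}
  let W : Set (Eu (m + 1)) := {v | v 0 < r ∧ ‖pr m v - b‖ < r}
  have hprc := pr_cont m
  have hBball : B ⊆ closedBall b (2 * r) := by
    rintro v ⟨h1, h2, h3⟩
    rw [mem_closedBall, dist_eq_norm]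
    have : v - b = (pr m v - b) + v 0 • e0 m := by
      nth_rewrite 1 [← pr_self m v]; abel
    rw [this]
    refine (norm_add_le _ _).trans ?_
    rw [norm_smul, norm_e0, Real.norm_of_nonneg h1]
    linarith
  have hBQ : B ⊆ half m ∩ c.Q := fun v hv => ⟨hv.1, hrQ (hBball hv)⟩
  have hBc : IsCompact B := by
    refine (isCompact_closedBall b (2 * r)).of_isClosed_subset ?_ hBball
    have h1 : IsClosed {v : Eu (m + 1) | 0 ≤ v 0} := isClosed_le (by fun_prop) (by fun_prop)
    have h2 : IsClosed {v : Eu (m + 1) | v 0 ≤ r} := isClosed_le (by fun_prop) (by fun_prop)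
    have h3 : IsClosed {v : Eu (m + 1) | ‖pr m v - b‖ ≤ r} := isClosed_le (by fun_prop) (by fun_prop)
    exact h1.inter (h2.inter h3)
  have hWo : IsOpen W := by
    have h2 : IsOpen {v : Eu (m + 1) | v 0 < r} := isOpen_lt (by fun_prop) (by fun_prop)
    have h3 : IsOpen {v : Eu (m + 1) | ‖pr m v - b‖ < r} := isOpen_lt (by fun_prop) (by fun_prop)
    exact h2.inter h3
  let C := c.g '' B
  have hCc : IsCompact C := hBc.image_of_continuousOn (c.gc.mono hBQ)
  have hCX : C ⊆ X ∩ c.O := by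
    rintro _ ⟨v, hv, rfl⟩
    exact c.gm (hBQ hv)
  have hfC : ∀ x ∈ C, c.f x ∈ B := by
    rintro _ ⟨v, hv, rfl⟩
    rwa [c.fg v (hBQ hv)]
  obtain ⟨N', hN'o, hN'⟩ := (_root_.continuousOn_iff'.1 c.fc) W hWo
  let N := N' ∩ c.O
  have hNX : ∀ x ∈ X, x ∈ N ↔ x ∈ c.O ∧ c.f x ∈ W := by
    intro x hx
    constructor
    · rintro ⟨h1, h2⟩
      have : x ∈ c.f ⁻¹' W ∩ (X ∩ c.O) := by rw [hN']; exact ⟨h1, hx, h2⟩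
      exact ⟨h2, this.1⟩
    · rintro ⟨h1, h2⟩
      have : x ∈ N' ∩ (X ∩ c.O) := by rw [← hN']; exact ⟨h2, hx, h1⟩
      exact ⟨this.1, h1⟩
  have hNC : ∀ x ∈ X, x ∈ N → x ∈ C := by
    intro x hx hxN
    obtain ⟨h1, h2⟩ := (hNX x hx).1 hxN
    refine ⟨c.f x, ⟨(c.fm ⟨hx, h1⟩).1, h2.1.le, h2.2.le⟩, c.gf x ⟨hx, h1⟩⟩
  refine ⟨N, hN'o.inter c.hO, ?_, ?_⟩
  · rw [hNX y hyX.1]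
    refine ⟨hyO, ?_⟩
    change b 0 < r ∧ ‖pr m b - b‖ < r
    rw [pr_of_zero m hb0, hb0]
    simpa using hr
  intro l hl hl0 hlN
  have hprB : ∀ v ∈ B, pr m v ∈ B := by
    rintro v ⟨h1, h2, h3⟩
    refine ⟨(pr_zero m v).ge, by rw [pr_zero]; exact hr.le, ?_⟩
    rwa [pr_of_zero m (pr_zero m v)]
  have hsB : ∀ v ∈ B, ∀ s, 0 ≤ s → s ≤ r → pr m v + s • e0 m ∈ B := by
    rintro v ⟨h1, h2, h3⟩ s hs0 hsr
    refine ⟨by rwa [pr_add_zero], by rwa [pr_add_zero], by rwa [pr_add]⟩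
  let L : Sp (m + 1) → ℝ := fun x => l (c.g (pr m (c.f x)))
  have hL0 : ∀ x, 0 ≤ L x := fun x => hl0 _
  let Φ : Sp (m + 1) × ℝ → Sp (m + 1) := fun p =>
    c.g (pr m (c.f p.1) + ((c.f p.1 0 + p.2 + L p.1) * r / (r + L p.1)) • e0 m)
  let ψ : Sp (m + 1) × ℝ → Sp (m + 1) := fun p => if p.1 ∈ N then Φ p else p.1
  -- basic facts
  have hCO : ∀ x ∈ C, c.g (c.f x) = x := fun x hx => c.gf x (hCX hx)
  have hLS : ∀ x ∈ C, x ∈ S → L x = l x := by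
    intro x hx hxS
    have := (hcS x (hCX hx)).1 hxS
    simp only [L]
    rw [pr_of_zero m this, hCO x hx]
  have hτ : ∀ p ∈ XL X S l, p.1 ∈ C → 0 ≤ c.f p.1 0 + p.2 + L p.1 ∧ c.f p.1 0 + p.2 ≤ r := by
    intro p hp hpC
    have hB := hfC _ hpC
    refine ⟨?_, by linarith [hB.2.1, hp.2.2.1]⟩
    rcases hp.2.2.2 with h | h
    · rw [h]; linarith [hB.1, hL0 p.1]
    · rw [hLS _ hpC h]; linarith [hB.1, hp.2.1]
  have hs' : ∀ p ∈ XL X S l, p.1 ∈ C → 0 ≤ (c.f p.1 0 + p.2 + L p.1) * r / (r + L p.1) ∧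
      (c.f p.1 0 + p.2 + L p.1) * r / (r + L p.1) ≤ r := by
    intro p hp hpC
    obtain ⟨h1, h2⟩ := hτ p hp hpC
    have h3 := hL0 p.1
    constructor
    · positivity
    · rw [div_le_iff₀ (by linarith)]; nlinarith
  have hΦB : ∀ p ∈ XL X S l, p.1 ∈ C →
      pr m (c.f p.1) + ((c.f p.1 0 + p.2 + L p.1) * r / (r + L p.1)) • e0 m ∈ B := by
    intro p hp hpC
    exact hsB _ (hfC _ hpC) _ (hs' p hp hpC).1 (hs' p hp hpC).2
  have hΦC : ∀ p ∈ XL X S l, p.1 ∈ C → Φ p ∈ C := fun p hp hpC => ⟨_, hΦB p hp hpC, rfl⟩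
  have ht0 : ∀ p ∈ XL X S l, p.1 ∉ N → p.2 = 0 := by
    intro p hp hpN
    rcases hp.2.2.2 with h | h
    · exact h
    · have h1 := hp.2.1
      rw [hlN _ hpN] at h1
      linarith [hp.2.2.1]
  have hval : ∀ p ∈ XL X S l, p.1 ∈ C → ψ p = Φ p := by
    intro p hp hpC
    by_cases hpN : p.1 ∈ N
    · simp [ψ, hpN]
    · simp only [ψ, hpN, if_false]
      have hB := hfC _ hpC
      have hW : c.f p.1 ∉ W := fun h => hpN ((hNX _ hp.1).2 ⟨(hCX hpC).2, h⟩)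
      have h3 := hL0 p.1
      have hs : (c.f p.1 0 + p.2 + L p.1) * r / (r + L p.1) = c.f p.1 0 := by
        rw [ht0 p hp hpN, add_zero]
        by_cases hsr : c.f p.1 0 < r
        · have hnW : ¬ ‖pr m (c.f p.1) - b‖ < r := fun h => hW ⟨hsr, h⟩
          have hL : L p.1 = 0 := by
            apply hlN
            have hpB := hprB _ hB
            intro h
            have h5 := ((hNX _ (c.gm (hBQ hpB)).1).1 h).2
            rw [c.fg _ (hBQ hpB)] at h5
            apply hnW
            have h6 := h5.2
            rwa [pr_of_zero m (pr_zero m _)] at h6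
          rw [hL]; field_simp; ring
        · have : c.f p.1 0 = r := le_antisymm hB.2.1 (not_lt.1 hsr)
          rw [this]
          have : r + L p.1 ≠ 0 := by linarith
          field_simp
      simp only [Φ]
      rw [hs, pr_self, hCO _ hpC]
  have hval2 : ∀ p ∈ XL X S l, p.1 ∉ C → ψ p = p.1 := by
    intro p hp hpC
    have : p.1 ∉ N := fun h => hpC (hNC _ hp.1 h)
    simp [ψ, this]
  refine ⟨ψ, ?_, ⟨?_, ?_, ?_⟩, ?_⟩
  · have hun : XL X S l = (XL X S l ∩ {p | p.1 ∈ C}) ∪ (XL X S l ∩ {p | p.1 ∉ N}) := by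
      ext p
      constructor
      · intro hp
        by_cases h : p.1 ∈ N
        · exact Or.inl ⟨hp, hNC _ hp.1 h⟩
        · exact Or.inr ⟨hp, h⟩
      · rintro (h | h) <;> exact h.1
    have hcl := isClosed_XL hX hS hl
    rw [hun]
    refine ContinuousOn.union_of_isClosed ?_ ?_ ?_ ?_
    · refine ContinuousOn.congr (f := Φ) ?_ fun p hp => hval p hp.1 hp.2
      have hf1 : ContinuousOn (fun p : Sp (m + 1) × ℝ => c.f p.1) (XL X S l ∩ {p | p.1 ∈ C}) :=
        c.fc.comp continuous_fst.continuousOn fun p hp => hCX hp.2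
      have hL1 : ContinuousOn (fun p : Sp (m + 1) × ℝ => L p.1) (XL X S l ∩ {p | p.1 ∈ C}) := by
        refine hl.comp_continuousOn (c.gc.comp (hprc.comp_continuousOn hf1) ?_)
        intro p hp
        exact hBQ (hprB _ (hfC _ hp.2))
      have hf0 : ContinuousOn (fun p : Sp (m + 1) × ℝ => c.f p.1 0) (XL X S l ∩ {p | p.1 ∈ C}) :=
        (show Continuous fun v : Eu (m + 1) => v 0 by fun_prop).comp_continuousOn hf1
      refine c.gc.comp ?_ fun p hp => hBQ (hΦB p hp.1 hp.2)
      have hsc : ContinuousOn (fun p : Sp (m + 1) × ℝ =>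
          (c.f p.1 0 + p.2 + L p.1) * r / (r + L p.1)) (XL X S l ∩ {p | p.1 ∈ C}) := by
        refine ContinuousOn.div ?_ (continuousOn_const.add hL1) fun p hp => ?_
        · exact ((hf0.add continuous_snd.continuousOn).add hL1).mul continuousOn_const
        · have := hL0 p.1
          positivity
      have hsm : ContinuousOn (fun p : Sp (m + 1) × ℝ =>
          ((c.f p.1 0 + p.2 + L p.1) * r / (r + L p.1)) • e0 m) (XL X S l ∩ {p | p.1 ∈ C}) :=
        hsc.smul continuousOn_const
      exact (hprc.comp_continuousOn hf1).add hsm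
    · refine continuous_fst.continuousOn.congr fun p hp => ?_
      have : p.1 ∉ N := hp.2
      simp [ψ, this]
    · exact hcl.inter (hCc.isClosed.preimage continuous_fst)
    · exact hcl.inter (((hN'o.inter c.hO).isClosed_compl).preimage continuous_fst)
  · intro p hp
    by_cases h : p.1 ∈ C
    · rw [hval p hp h]; exact (hCX (hΦC p hp h)).1
    · rw [hval2 p hp h]; exact hp.1
  · intro p hp q hq h
    by_cases h1 : p.1 ∈ C <;> by_cases h2 : q.1 ∈ C
    · rw [hval p hp h1, hval q hq h2] at h
      have h3 := congrArg c.f h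
      simp only [Φ] at h3
      rw [c.fg _ (hBQ (hΦB p hp h1)), c.fg _ (hBQ (hΦB q hq h2))] at h3
      have h4 := congrArg (pr m) h3
      rw [pr_add, pr_add] at h4
      have h5 := congrArg (fun v : Eu (m + 1) => v 0) h3
      simp only [pr_add_zero] at h5
      have hLeq : L p.1 = L q.1 := by simp only [L]; rw [h4]
      have hLp := hL0 q.1
      rw [hLeq] at h5
      have hne : r + L q.1 ≠ 0 := by positivity
      have h6 : c.f p.1 0 + p.2 = c.f q.1 0 + q.2 := by
        rw [div_left_inj' hne] at h5
        have := mul_right_cancel₀ hr.ne' h5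
        linarith
      have hp2 := hp.2.2.1
      have hq2 := hq.2.2.1
      have hp0 := (hfC _ h1).1
      have hq0 := (hfC _ h2).1
      have hp3 : p.2 = 0 ∨ c.f p.1 0 = 0 := hp.2.2.2.imp_right (hcS _ (hCX h1)).1
      have hq3 : q.2 = 0 ∨ c.f q.1 0 = 0 := hq.2.2.2.imp_right (hcS _ (hCX h2)).1
      have h7 : c.f p.1 0 = c.f q.1 0 ∧ p.2 = q.2 := by
        rcases hp3 with a | a <;> rcases hq3 with b | b <;> constructor <;> linarith
      have h8 : c.f p.1 = c.f q.1 := by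
        rw [← pr_self m (c.f p.1), ← pr_self m (c.f q.1), h4, h7.1]
      have h9 := congrArg c.g h8
      rw [hCO _ h1, hCO _ h2] at h9
      exact Prod.ext h9 h7.2
    · rw [hval p hp h1, hval2 q hq h2] at h
      exact absurd (h ▸ hΦC p hp h1) h2
    · rw [hval2 p hp h1, hval q hq h2] at h
      exact absurd (h.symm ▸ hΦC q hq h2) h1
    · rw [hval2 p hp h1, hval2 q hq h2] at h
      refine Prod.ext h ?_
      rw [ht0 p hp fun h => h1 (hNC _ hp.1 h), ht0 q hq fun h => h2 (hNC _ hq.1 h)]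
  · intro x hx
    by_cases hxC : x ∈ C
    · obtain ⟨v, hv, rfl⟩ := hxC
      set ℓ := l (c.g (pr m v)) with hℓ
      have hℓ0 : 0 ≤ ℓ := hl0 _
      have hv0 := hv.1
      have hvr := hv.2.1
      set τ := v 0 * (r + ℓ) / r - ℓ with hτd
      have hτr : τ ≤ r := by
        rw [hτd, sub_le_iff_le_add, div_le_iff₀ hr]; nlinarith
      have hτℓ : -ℓ ≤ τ := by
        have : 0 ≤ v 0 * (r + ℓ) / r := by positivity
        linarith
      have hback : (τ + ℓ) * r / (r + ℓ) = v 0 := by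
        rw [hτd]
        have : r + ℓ ≠ 0 := by positivity
        field_simp
        ring
      have hwB : pr m v + (max τ 0) • e0 m ∈ B := hsB v hv _ (le_max_right _ _) (max_le hτr hr.le)
      have hwC : c.g (pr m v + (max τ 0) • e0 m) ∈ C := ⟨_, hwB, rfl⟩
      have hfw := c.fg _ (hBQ hwB)
      have hp : (c.g (pr m v + (max τ 0) • e0 m), min τ 0) ∈ XL X S l := by
        refine ⟨(hCX hwC).1, ?_, min_le_right _ _, ?_⟩
        · simp only
          rcases le_total 0 τ with h | h
          · rw [min_eq_right h]; linarith [hl0 (c.g (pr m v + (max τ 0) • e0 m))]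
          · rw [min_eq_left h, max_eq_right h, zero_smul, add_zero]; exact hτℓ
        · simp only
          rcases le_total 0 τ with h | h
          · left; exact min_eq_right h
          · right
            rw [hcS _ (hCX hwC), hfw, pr_add_zero]; exact max_eq_right h
      refine ⟨_, hp, ?_⟩
      rw [hval _ hp hwC]
      simp only [Φ, L]
      rw [hfw, pr_add, pr_add_zero, ← hℓ, max_add_min, add_zero, hback, pr_self]
    · exact ⟨(x, 0), ⟨hx, by simpa using hl0 x, le_rfl, Or.inl rfl⟩, hval2 (x, 0)
        ⟨hx, by simpa using hl0 x, le_rfl, Or.inl rfl⟩ hxC⟩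
  · intro x hx
    have hp : (x, -l x) ∈ XL X S l := ⟨hSX hx, le_rfl, by simpa using hl0 x, Or.inr hx⟩
    by_cases hxC : x ∈ C
    · rw [hval _ hp hxC]
      have h0 := (hcS x (hCX hxC)).1 hx
      simp only [Φ]
      rw [hLS x hxC hx, h0]
      simp only [zero_add, neg_add_cancel, zero_mul, zero_div, zero_smul, add_zero]
      rw [pr_of_zero m h0, hCO x hxC]
    · exact hval2 _ hp hxC

end Cantrell
end

section
open Set Metric Filter Topology MeasureTheory

namespace Cantrell

/-- A map of `X` onto the closed unit disc, whose only nontrivial fibre is that of `q`,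
and which sends exactly `S` to the unit sphere. -/
structure DiscMap {n : ℕ} (X S : Set (Sp n)) (q : Eu n) (F : Sp n → Eu n) : Prop where
  cont : ContinuousOn F X
  norm_le : ∀ x ∈ X, ‖F x‖ ≤ 1
  surj : ∀ z : Eu n, ‖z‖ ≤ 1 → ∃ x ∈ X, F x = z
  inj : ∀ x ∈ X, ∀ y ∈ X, F x = F y → F x ≠ q → x = y
  bdry : ∀ x ∈ X, (x ∈ S ↔ ‖F x‖ = 1)

theorem discMap_of_good {n : ℕ} {X S : Set (Sp n)} (hX : IsClosed X) (hXn : X.Nonempty)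
    (hS : IsClosed S)
    (hSX : S ⊆ X) (e : S ≃ₜ sphere (0 : Eu n) 1) (hg : Good X S (fun _ => 1)) :
    ∃ F : Sp n → Eu n, DiscMap X S 0 F := by
  obtain ⟨ψ, hψc, hψb, hψS⟩ := hg
  have : Nonempty (Sp n) := ⟨hXn.some⟩
  obtain ⟨σ, τ, hσ, hτ, hσS, hτS, hτσ, hστ, -, -⟩ := homeo_to_fun e
  obtain ⟨σ', hσ'c, hσ'⟩ := tietze hS hσ
  have hcpt : IsCompact (XL X S (fun _ => 1)) := by
    refine (isCompact_univ.prod (isCompact_Icc (a := (-1 : ℝ)) (b := 0))).of_isClosed_subset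
      (isClosed_XL hX hS continuous_const) ?_
    rintro p ⟨-, h1, h2, -⟩
    exact ⟨trivial, h1, h2⟩
  have hφc := continuousOn_invFunOn hcpt hψc hψb.injOn
  have hφl := hψb.injOn.leftInvOn_invFunOn
  rw [hψb.image_eq] at hφc
  set φ := Function.invFunOn ψ (XL X S (fun _ => 1)) with hφ
  have hφm : ∀ x ∈ X, φ x ∈ XL X S (fun _ => 1) ∧ ψ (φ x) = x := by
    intro x hx
    obtain ⟨p, hp, rfl⟩ := hψb.surjOn hx
    rw [hφl hp]
    exact ⟨hp, rfl⟩
  let Q : Sp n × ℝ → Eu n := fun p => (-p.2) • σ' p.1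
  have hQn : ∀ p ∈ XL X S (fun _ => 1), ‖Q p‖ = -p.2 := by
    intro p hp
    simp only [Q]
    rcases hp.2.2.2 with h | h
    · simp [h]
    · have h1 : ‖σ' p.1‖ = 1 := by rw [hσ' h]; simpa using hσS h
      rw [norm_smul, h1, mul_one, Real.norm_of_nonneg (by linarith [hp.2.2.1])]
  refine ⟨fun x => Q (φ x), ?_, ?_, ?_, ?_, ?_⟩
  · have : Continuous Q := by simp only [Q]; fun_prop
    exact this.comp_continuousOn hφc
  · intro x hx
    rw [hQn _ (hφm x hx).1]
    have := (hφm x hx).1.2.1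
    linarith
  · intro z hz
    by_cases hz0 : z = 0
    · obtain ⟨x, hx⟩ := hXn
      have hp : (x, (0 : ℝ)) ∈ XL X S (fun _ => 1) := ⟨hx, by simp, le_rfl, Or.inl rfl⟩
      refine ⟨ψ (x, 0), hψb.mapsTo hp, ?_⟩
      rw [hφl hp, hz0]
      simp [Q]
    · have hzn : ‖z‖ ≠ 0 := norm_ne_zero_iff.2 hz0
      have hzs : ‖z‖⁻¹ • z ∈ sphere (0 : Eu n) 1 := by simp [norm_smul, hzn]
      have hp : (τ (‖z‖⁻¹ • z), -‖z‖) ∈ XL X S (fun _ => 1) :=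
        ⟨hSX (hτS hzs), by simpa using hz, by simp, Or.inr (hτS hzs)⟩
      refine ⟨_, hψb.mapsTo hp, ?_⟩
      rw [hφl hp]
      simp only [Q, neg_neg]
      rw [hσ' (hτS hzs), hστ _ hzs, smul_smul, mul_inv_cancel₀ hzn, one_smul]
  · intro x hx y hy h hne
    obtain ⟨hpx, hpx2⟩ := hφm x hx
    obtain ⟨hpy, hpy2⟩ := hφm y hy
    have hn : ‖Q (φ x)‖ = ‖Q (φ y)‖ := by rw [h]
    rw [hQn _ hpx, hQn _ hpy] at hn
    have ht : (φ x).2 = (φ y).2 := by linarith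
    have htne : (φ x).2 ≠ 0 := by
      intro h0
      apply hne
      simp [Q, h0]
    have hxS := hpx.2.2.2.resolve_left htne
    have hyS := hpy.2.2.2.resolve_left (ht ▸ htne)
    simp only [Q] at h
    rw [hσ' hxS, hσ' hyS, ht] at h
    have h2 := smul_right_injective (Eu n) (neg_ne_zero.2 (ht ▸ htne)) h
    have h3 : (φ x).1 = (φ y).1 := by rw [← hτσ _ hxS, ← hτσ _ hyS, h2]
    rw [← hpx2, ← hpy2, Prod.ext h3 ht]
  · intro x hx
    obtain ⟨hpx, hpx2⟩ := hφm x hx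
    rw [hQn _ hpx]
    constructor
    · intro hxS
      have hp : (x, -(1 : ℝ)) ∈ XL X S (fun _ => 1) := ⟨hx, le_rfl, by simp, Or.inr hxS⟩
      have h1 := hφl hp
      have h2 : ψ (x, -1) = x := hψS x hxS
      rw [h2] at h1
      rw [h1]; simp
    · intro h
      have htne : (φ x).2 ≠ 0 := by intro h0; rw [h0] at h; norm_num at h
      have hxS := hpx.2.2.2.resolve_left htne
      have h2 := hψS _ hxS
      have h3 : ((φ x).1, -(1 : ℝ)) = φ x := Prod.ext rfl (by simp only; linarith)
      simp only at h2
      rw [h3, hpx2] at h2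
      rwa [← h2] at hxS

theorem discMap_move {n : ℕ} (hn : 0 < n) {X S : Set (Sp n)} {F : Sp n → Eu n}
    (hF : DiscMap X S 0 F) :
    ∃ (q : Eu n) (F' : Sp n → Eu n), ‖q‖ = 1 / 4 ∧ DiscMap X S q F' ∧
      ∀ x ∈ X, (F' x = q ↔ F x = 0) := by
  let q : Eu n := EuclideanSpace.single ⟨0, hn⟩ (1 / 4)
  have hq : ‖q‖ = 1 / 4 := by simp [q]
  obtain ⟨θ, hθ, hθ0⟩ := move_local (0 : Eu n) q 1 (by rw [dist_zero_right, hq]; norm_num)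
  have hθ1 : ∀ x : Eu n, 1 ≤ ‖x‖ → θ x = x := fun x hx => hθ x (by simpa using hx)
  have hθ2 : ∀ x : Eu n, ‖x‖ < 1 → ‖θ x‖ < 1 := by
    intro x hx
    by_contra h
    have h2 := hθ1 (θ x) (not_lt.1 h)
    have := θ.injective h2
    rw [this] at h
    exact h hx
  refine ⟨q, fun x => θ (F x), hq, ⟨?_, ?_, ?_, ?_, ?_⟩, ?_⟩
  · exact θ.continuous.comp_continuousOn hF.cont
  · intro x hx
    rcases (hF.norm_le x hx).lt_or_eq with h | h
    · exact (hθ2 _ h).le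
    · rw [hθ1 _ h.ge, h]
  · intro z hz
    have : ‖θ.symm z‖ ≤ 1 := by
      by_contra h
      push Not at h
      have := hθ1 _ h.le
      rw [θ.apply_symm_apply] at this
      rw [← this] at h
      linarith
    obtain ⟨x, hx, hxz⟩ := hF.surj _ this
    exact ⟨x, hx, by simp [hxz]⟩
  · intro x hx y hy h hne
    refine hF.inj x hx y hy (θ.injective h) fun h0 => hne ?_
    rw [h0, hθ0]
  · intro x hx
    rw [hF.bdry x hx]
    constructor
    · intro h; rw [hθ1 _ h.ge, h]
    · intro h
      rcases (hF.norm_le x hx).lt_or_eq with h1 | h1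
      · have := hθ2 _ h1
        linarith
      · exact h1
  · intro x hx
    rw [← hθ0]
    exact θ.injective.eq_iff

/-- Radial shrinking into a small ball, fixing a smaller ball. -/
theorem shrink_exists {n : ℕ} (β : Eu n) {δ : ℝ} (hδ : 0 < δ) :
    ∃ k : Eu n → Eu n, Continuous k ∧ Function.Injective k ∧ (∀ v ∈ ball β δ, k v = v) ∧
      ∀ v, k v ∈ ball β (2 * δ) := by
  let φ : ℝ → ℝ := fun s => (2 * δ - δ ^ 2 / max s δ) / max s δ
  have hd : ∀ s : ℝ, 0 < max s δ := fun s => lt_of_lt_of_le hδ (le_max_right _ _)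
  have hφc : Continuous φ := by
    have h1 : Continuous fun s : ℝ => max s δ := continuous_id.max continuous_const
    exact ((continuous_const.sub (continuous_const.div h1 fun s => (hd s).ne'))).div h1
      fun s => (hd s).ne'
  have hφ1 : ∀ s ≤ δ, φ s = 1 := by
    intro s hs
    simp only [φ, max_eq_right hs]
    field_simp
    ring
  have hφ2 : ∀ s, δ ≤ s → s * φ s = 2 * δ - δ ^ 2 / s := by
    intro s hs
    have : s ≠ 0 := by linarith
    simp only [φ, max_eq_left hs]
    field_simp
  have hφpos : ∀ s, 0 < φ s := by
    intro s
    refine div_pos ?_ (hd s)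
    have : δ ^ 2 / max s δ ≤ δ := by
      rw [div_le_iff₀ (hd s)]; nlinarith [le_max_right s δ]
    linarith
  have hmono : ∀ s t, 0 ≤ s → s < t → s * φ s < t * φ t := by
    intro s t hs hst
    rcases le_total t δ with h | h
    · rw [hφ1 t h, hφ1 s (by linarith)]; linarith
    · have ht : 0 < t := by linarith
      rcases le_total s δ with h' | h'
      · rw [hφ1 s h', hφ2 t h]
        have h3 : δ ^ 2 / t ≤ δ := by rw [div_le_iff₀ ht]; nlinarith
        rcases h'.lt_or_eq with h4 | h4
        · linarith
        · have : δ ^ 2 / t < δ := by rw [div_lt_iff₀ ht]; nlinarith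
          linarith
      · rw [hφ2 t h, hφ2 s h']
        have : δ ^ 2 / t < δ ^ 2 / s := by
          apply div_lt_div_of_pos_left (by positivity) (by linarith) hst
        linarith
  have hnorm : ∀ v : Eu n, ‖φ ‖v - β‖ • (v - β)‖ = ‖v - β‖ * φ ‖v - β‖ := by
    intro v
    rw [norm_smul, Real.norm_of_nonneg (hφpos _).le, mul_comm]
  refine ⟨fun v => β + φ ‖v - β‖ • (v - β), ?_, ?_, ?_, ?_⟩
  · fun_prop
  · intro v w h
    have h1 := add_left_cancel h
    have h2 : ‖v - β‖ * φ ‖v - β‖ = ‖w - β‖ * φ ‖w - β‖ := by rw [← hnorm, ← hnorm, h1]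
    have h3 : ‖v - β‖ = ‖w - β‖ := by
      rcases lt_trichotomy ‖v - β‖ ‖w - β‖ with h | h | h
      · exact absurd h2 (hmono _ _ (norm_nonneg _) h).ne
      · exact h
      · exact absurd h2 (hmono _ _ (norm_nonneg _) h).ne'
    rw [h3] at h1
    have h4 := smul_right_injective (Eu n) (hφpos ‖w - β‖).ne' h1
    exact sub_left_injective h4
  · intro v hv
    rw [mem_ball, dist_eq_norm] at hv
    simp only
    rw [hφ1 _ hv.le, one_smul]; abel
  · intro v
    rw [mem_ball, dist_eq_norm, add_sub_cancel_left, hnorm]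
    rcases le_total ‖v - β‖ δ with h | h
    · rw [hφ1 _ h]; linarith
    · rw [hφ2 _ h]
      have : 0 < δ ^ 2 / ‖v - β‖ := by
        have : 0 < ‖v - β‖ := by linarith
        positivity
      linarith

theorem cell_abstract {n : ℕ} {A Ω : Set (Sp n)} {w a : Sp n} {g γ : Sp n → Sp n}
    (hg : ContinuousOn g {w}ᶜ) (hgw : ∀ x, x ≠ w → g x ≠ w) (hgΩ : ∀ x, x ≠ w → g x ∈ Ω)
    (hga : ∀ x, x ≠ w → (g x = a ↔ x ∈ A)) (hγg : ∀ x, x ≠ w → x ∉ A → γ (g x) = x)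
    (hgγ : ∀ y ∈ Ω, y ≠ a → γ y ≠ w ∧ g (γ y) = y) (hγ : ContinuousOn γ (Ω \ {a}))
    (hΩ : IsOpen Ω) (haΩ : a ∈ Ω) (haw : a ≠ w) (hwA : w ∉ A)
    (hnb : ∀ V : Set (Sp n), IsOpen V → A ⊆ V → ∃ N ∈ 𝓝 a, ∀ x, x ≠ w → g x ∈ N → x ∈ V)
    {V : Set (Sp n)} (hV : IsOpen V) (hAV : A ⊆ V) :
    ∃ p : Eu n → Sp n, Continuous p ∧ Function.Injective p ∧ range p ⊆ V ∧ A ⊆ range p := by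
  classical
  obtain ⟨N, hN, hNV⟩ := hnb V hV hAV
  have hN2 : (st w).symm ⁻¹' (N ∩ Ω) ∈ 𝓝 (st w a) := by
    refine (st_symm_cont w).continuousAt ?_
    rw [st_left haw]
    exact inter_mem hN (hΩ.mem_nhds haΩ)
  obtain ⟨ε, hε, hεN⟩ := Metric.mem_nhds_iff.1 hN2
  obtain ⟨k, hkc, hki, hkid, hkb⟩ := shrink_exists (st w a) (δ := ε / 2) (by linarith)
  rw [show 2 * (ε / 2) = ε by ring] at hkb
  let K : Sp n → Sp n := fun y => (st w).symm (k (st w y))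
  have hKc : ContinuousOn K {w}ᶜ :=
    (st_symm_cont w).comp_continuousOn (hkc.comp_continuousOn (st_cont w))
  have hKN : ∀ y, K y ∈ N ∩ Ω := fun y => hεN (hkb _)
  have hKi : ∀ x y, x ≠ w → y ≠ w → K x = K y → x = y := by
    intro x y hx hy h
    have h1 := congrArg (st w) h
    simp only [K] at h1
    rw [st_right, st_right] at h1
    have h2 := congrArg (st w).symm (hki h1)
    rwa [st_left hx, st_left hy] at h2
  let N1 : Set (Sp n) := {w}ᶜ ∩ st w ⁻¹' ball (st w a) (ε / 2)
  have hN1 : IsOpen N1 := (st_cont w).isOpen_inter_preimage isOpen_compl_singleton isOpen_ball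
  have haN1 : a ∈ N1 := ⟨haw, by simp [hε]⟩
  have hK1 : ∀ y ∈ N1, K y = y := by
    intro y hy
    simp only [K]
    rw [hkid _ hy.2, st_left hy.1]
  have hKa : ∀ y, y ≠ w → (K y = a ↔ y = a) := by
    intro y hy
    constructor
    · intro h
      rw [← hK1 a haN1] at h
      exact hKi _ _ hy haw h
    · rintro rfl
      exact hK1 _ haN1
  let P : Sp n → Sp n := fun x => if x ∈ A then x else γ (K (g x))
  have hP1 : ∀ x, x ≠ w → g x ∈ N1 → P x = x := by
    intro x hx hgx
    by_cases h : x ∈ A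
    · simp [P, h]
    · simp only [P, h, if_false]
      rw [hK1 _ hgx, hγg x hx h]
  have hP2 : ∀ x, x ≠ w → x ∉ A → K (g x) ∈ Ω \ {a} := by
    intro x hx hxA
    refine ⟨(hKN _).2, fun h => hxA ?_⟩
    rw [← hga x hx, ← hKa _ (hgw x hx)]
    exact h
  have hPc : ContinuousOn P {w}ᶜ := by
    intro x hx
    refine ContinuousAt.continuousWithinAt ?_
    by_cases hxA : x ∈ A
    · have hop : IsOpen ({w}ᶜ ∩ g ⁻¹' N1) := hg.isOpen_inter_preimage isOpen_compl_singleton hN1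
      have hmem : x ∈ {w}ᶜ ∩ g ⁻¹' N1 := ⟨hx, by rw [mem_preimage, (hga x hx).2 hxA]; exact haN1⟩
      refine continuousAt_id.congr ?_
      filter_upwards [hop.mem_nhds hmem] with z hz
      exact (hP1 z hz.1 hz.2).symm
    · have hop : IsOpen ({w}ᶜ ∩ g ⁻¹' {a}ᶜ) :=
        hg.isOpen_inter_preimage isOpen_compl_singleton isOpen_compl_singleton
      have hmem : x ∈ {w}ᶜ ∩ g ⁻¹' {a}ᶜ := ⟨hx, fun h => hxA ((hga x hx).1 h)⟩
      have hAof : ∀ z ∈ {w}ᶜ ∩ g ⁻¹' {a}ᶜ, z ∉ A := fun z hz hzA => hz.2 ((hga z hz.1).2 hzA)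
      have hcc : ContinuousOn (fun z => γ (K (g z))) ({w}ᶜ ∩ g ⁻¹' {a}ᶜ) := by
        refine hγ.comp (hKc.comp (hg.mono inter_subset_left) fun z hz => hgw z hz.1) ?_
        exact fun z hz => hP2 z hz.1 (hAof z hz)
      refine (hcc.continuousAt (hop.mem_nhds hmem)).congr ?_
      filter_upwards [hop.mem_nhds hmem] with z hz
      simp [P, hAof z hz]
  have hPA : ∀ x, x ≠ w → x ∉ A → P x ∉ A ∧ g (P x) = K (g x) ∧ P x ≠ w := by
    intro x hx hxA
    have h2 := hP2 x hx hxA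
    have h3 := hgγ _ h2.1 h2.2
    have h4 : P x = γ (K (g x)) := by simp [P, hxA]
    rw [h4]
    refine ⟨fun h => h2.2 ?_, h3.2, h3.1⟩
    have := (hga _ h3.1).2 h
    rw [h3.2] at this
    exact this
  have hPi : ∀ x y, x ≠ w → y ≠ w → P x = P y → x = y := by
    intro x y hx hy h
    by_cases hxA : x ∈ A <;> by_cases hyA : y ∈ A
    · simpa [P, hxA, hyA] using h
    · have h1 := (hPA y hy hyA).1
      rw [← h] at h1
      simp [P, hxA] at h1
    · have h1 := (hPA x hx hxA).1
      rw [h] at h1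
      simp [P, hyA] at h1
    · have h1 : K (g x) = K (g y) := by rw [← (hPA x hx hxA).2.1, h, (hPA y hy hyA).2.1]
      have h2 := hKi _ _ (hgw x hx) (hgw y hy) h1
      rw [← hγg x hx hxA, h2, hγg y hy hyA]
  refine ⟨fun v => P ((st w).symm v), ?_, ?_, ?_, ?_⟩
  · exact hPc.comp_continuous (st_symm_cont w) fun v => st_symm_ne w v
  · intro u v h
    have := congrArg (st w) (hPi _ _ (st_symm_ne w u) (st_symm_ne w v) h)
    rwa [st_right, st_right] at this
  · rintro _ ⟨v, rfl⟩
    set x := (st w).symm v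
    have hx : x ≠ w := st_symm_ne w v
    by_cases hxA : x ∈ A
    · have hPx : P x = x := by simp [P, hxA]
      change P x ∈ V
      rw [hPx]; exact hAV hxA
    · obtain ⟨h1, h2, h3⟩ := hPA x hx hxA
      refine hNV _ h3 ?_
      rw [h2]; exact (hKN _).1
  · intro x hx
    have hxw : x ≠ w := fun h => hwA (h ▸ hx)
    refine ⟨st w x, ?_⟩
    simp only
    rw [st_left hxw]
    simp [P, hx]

end Cantrell
end

section
open Set Metric Filter Topology MeasureTheory

namespace Cantrell

theorem glue_on {X Y : Type*} [TopologicalSpace X] [TopologicalSpace Y] {f : X → Y}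
    {U C D : Set X} (hC : IsClosed C) (hD : IsClosed D) (hCD : ∀ x, x ∈ C ∨ x ∈ D)
    (h1 : ContinuousOn f (U ∩ C)) (h2 : ContinuousOn f (U ∩ D)) : ContinuousOn f U := by
  intro x hx
  have hU : U = (U ∩ C) ∪ (U ∩ D) := by
    ext y
    have := hCD y
    simp only [mem_union, mem_inter_iff]
    tauto
  rw [hU]
  refine ContinuousWithinAt.union ?_ ?_
  · by_cases h : x ∈ C
    · exact h1 x ⟨hx, h⟩
    · refine continuousWithinAt_of_notMem_closure fun h' => h ?_
      exact hC.closure_subset_iff.2 inter_subset_right h'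
  · by_cases h : x ∈ D
    · exact h2 x ⟨hx, h⟩
    · refine continuousWithinAt_of_notMem_closure fun h' => h ?_
      exact hD.closure_subset_iff.2 inter_subset_right h'

noncomputable def hh {n : ℕ} (y : Eu n) : Eu n := (max ‖y‖ (1 / 2 + ‖y‖ / 3) / ‖y‖) • y
noncomputable def hi {n : ℕ} (y : Eu n) : Eu n := (min ‖y‖ (3 * ‖y‖ - 3 / 2) / ‖y‖) • y

theorem hh_norm {n : ℕ} {y : Eu n} (hy : y ≠ 0) : ‖hh y‖ = max ‖y‖ (1 / 2 + ‖y‖ / 3) := by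
  have h := norm_pos_iff.2 hy
  have h2 : 0 ≤ max ‖y‖ (1 / 2 + ‖y‖ / 3) := h.le.trans (le_max_left _ _)
  rw [hh, norm_smul, Real.norm_of_nonneg (by positivity)]
  field_simp

theorem hi_pos {n : ℕ} {y : Eu n} (hy : 1 / 2 < ‖y‖) : 0 < min ‖y‖ (3 * ‖y‖ - 3 / 2) :=
  lt_min (by linarith) (by linarith)

theorem hi_norm {n : ℕ} {y : Eu n} (hy : 1 / 2 < ‖y‖) :
    ‖hi y‖ = min ‖y‖ (3 * ‖y‖ - 3 / 2) := by
  have h : 0 < ‖y‖ := by linarith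
  have h2 := hi_pos hy
  rw [hi, norm_smul, Real.norm_of_nonneg (by positivity)]
  field_simp

theorem hi_hh {n : ℕ} {y : Eu n} (hy : y ≠ 0) : hi (hh y) = y := by
  have h := norm_pos_iff.2 hy
  have h2 : 0 < max ‖y‖ (1 / 2 + ‖y‖ / 3) := h.trans_le (le_max_left _ _)
  have h3 : min (max ‖y‖ (1 / 2 + ‖y‖ / 3)) (3 * max ‖y‖ (1 / 2 + ‖y‖ / 3) - 3 / 2) = ‖y‖ := by
    rcases le_total ‖y‖ (1 / 2 + ‖y‖ / 3) with h | h
    · rw [max_eq_right h, min_eq_right] <;> linarith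
    · rw [max_eq_left h, min_eq_left]; linarith
  rw [hi, hh_norm hy, h3, hh, smul_smul]
  rw [show ‖y‖ / max ‖y‖ (1 / 2 + ‖y‖ / 3) * (max ‖y‖ (1 / 2 + ‖y‖ / 3) / ‖y‖) = 1 by field_simp,
    one_smul]

theorem hh_hi {n : ℕ} {y : Eu n} (hy : 1 / 2 < ‖y‖) : hh (hi y) = y := by
  have h : 0 < ‖y‖ := by linarith
  have h2 := hi_pos hy
  have h3 : max (min ‖y‖ (3 * ‖y‖ - 3 / 2)) (1 / 2 + min ‖y‖ (3 * ‖y‖ - 3 / 2) / 3) = ‖y‖ := by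
    rcases le_total ‖y‖ (3 * ‖y‖ - 3 / 2) with h | h
    · rw [min_eq_left h, max_eq_left]; linarith
    · rw [min_eq_right h, max_eq_right] <;> linarith
  rw [hh, hi_norm hy, h3, hi, smul_smul, div_mul_div_cancel₀ h2.ne', div_self h.ne', one_smul]

theorem hh_id {n : ℕ} {y : Eu n} (hy : ‖y‖ = 1) : hh y = y := by
  rw [hh, hy, max_eq_left (by norm_num)]; simp

theorem hi_id {n : ℕ} {y : Eu n} (hy : ‖y‖ = 1) : hi y = y := by
  rw [hi, hy, min_eq_left (by norm_num)]; simp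

theorem hh_cont {n : ℕ} : ContinuousOn (hh (n := n)) {0}ᶜ := by
  unfold hh
  have h : ∀ x ∈ ({0}ᶜ : Set (Eu n)), ‖x‖ ≠ 0 := fun x hx => by simpa using hx
  fun_prop (disch := exact h)

theorem hi_cont {n : ℕ} : ContinuousOn (hi (n := n)) {0}ᶜ := by
  unfold hi
  have h : ∀ x ∈ ({0}ᶜ : Set (Eu n)), ‖x‖ ≠ 0 := fun x hx => by simpa using hx
  fun_prop (disch := exact h)

theorem inverse_exists {n : ℕ} {X S : Set (Sp n)} {q : Eu n} {F : Sp n → Eu n}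
    (hX : IsClosed X) (hF : DiscMap X S q F) :
    ∃ I : Eu n → Sp n, ContinuousOn I (closedBall 0 1 \ {q}) ∧ (∀ z, ‖z‖ ≤ 1 → I z ∈ X) ∧
      (∀ z, ‖z‖ ≤ 1 → F (I z) = z) ∧ ∀ x ∈ X, F x ≠ q → I (F x) = x := by
  have : Nonempty (Sp n) := by
    obtain ⟨x, -⟩ := hF.surj 0 (by simp)
    exact ⟨x⟩
  have hex : ∀ z : Eu n, ∃ x, ‖z‖ ≤ 1 → x ∈ X ∧ F x = z := by
    intro z
    by_cases h : ‖z‖ ≤ 1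
    · obtain ⟨x, hx⟩ := hF.surj z h
      exact ⟨x, fun _ => hx⟩
    · exact ⟨Classical.arbitrary _, fun h' => absurd h' h⟩
  choose I hI using hex
  have hIF : ∀ x ∈ X, F x ≠ q → I (F x) = x := by
    intro x hx hne
    obtain ⟨h1, h2⟩ := hI (F x) (hF.norm_le x hx)
    exact (hF.inj x hx _ h1 h2.symm hne).symm
  refine ⟨I, ?_, fun z hz => (hI z hz).1, fun z hz => (hI z hz).2, hIF⟩
  rw [continuousOn_iff_isClosed]
  intro t ht
  refine ⟨F '' (X ∩ t), ?_, ?_⟩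
  · exact ((hX.inter ht).isCompact.image_of_continuousOn (hF.cont.mono inter_subset_left)).isClosed
  · ext z
    constructor
    · rintro ⟨h1, h2⟩
      have hz : ‖z‖ ≤ 1 := by simpa using h2.1
      exact ⟨⟨I z, ⟨(hI z hz).1, h1⟩, (hI z hz).2⟩, h2⟩
    · rintro ⟨⟨x, ⟨hx, hxt⟩, rfl⟩, h2⟩
      refine ⟨?_, h2⟩
      rw [mem_preimage, hIF x hx h2.2]
      exact hxt

theorem cellular {n : ℕ} {H X S : Set (Sp n)} {q : Eu n} {F : Sp n → Eu n}
    (hH : IsOpen H) (hX : IsClosed X) (hXU : X = H ∪ S) (hd : Disjoint H S)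
    (hF : DiscMap X S q F) (hq : ‖q‖ = 1 / 4) {V : Set (Sp n)} (hV : IsOpen V)
    (hAV : {x | x ∈ X ∧ F x = q} ⊆ V) :
    ∃ p : Eu n → Sp n, Continuous p ∧ Function.Injective p ∧ range p ⊆ V ∧
      {x | x ∈ X ∧ F x = q} ⊆ range p := by
  classical
  obtain ⟨I, hIc, hIX, hFI, hIF⟩ := inverse_exists hX hF
  have hHX : H ⊆ X := hXU ▸ subset_union_left
  have hHiff : ∀ x ∈ X, (x ∈ H ↔ ‖F x‖ < 1) := by
    intro x hx
    have h1 := hF.bdry x hx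
    have h2 := hF.norm_le x hx
    constructor
    · intro h
      refine lt_of_le_of_ne h2 fun h3 => ?_
      exact disjoint_left.1 hd h (h1.2 h3)
    · intro h
      rw [hXU] at hx
      rcases hx with hx | hx
      · exact hx
      · exact absurd (h1.1 hx) h.ne
  have hq0 : q ≠ 0 := by intro h; rw [h] at hq; norm_num at hq
  obtain ⟨w, hwX, hw⟩ := hF.surj 0 (by simp)
  have hw0 : ∀ x ∈ X, x ≠ w → F x ≠ 0 := by
    intro x hx hxw h
    exact hxw (hF.inj x hx w hwX (h.trans hw.symm) (by rw [h]; exact hq0.symm))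
  have hnotq : ∀ y : Eu n, 1 / 2 < ‖y‖ → y ≠ q := by
    rintro y hy rfl; linarith
  have hh1 : ∀ y : Eu n, y ≠ 0 → 1 / 2 < ‖hh y‖ := by
    intro y hy
    rw [hh_norm hy]
    have := norm_pos_iff.2 hy
    exact lt_max_of_lt_right (by linarith)
  have hh2 : ∀ y : Eu n, y ≠ 0 → ‖y‖ ≤ 1 → ‖hh y‖ ≤ 1 := by
    intro y hy h1
    rw [hh_norm hy]
    exact max_le h1 (by linarith)
  have hh3 : ∀ y : Eu n, y ≠ 0 → ‖y‖ < 1 → ‖hh y‖ < 1 := by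
    intro y hy h1
    rw [hh_norm hy]
    exact max_lt h1 (by linarith)
  have hi1 : ∀ y : Eu n, 1 / 2 < ‖y‖ → hi y ≠ 0 := by
    intro y hy
    rw [← norm_pos_iff, hi_norm hy]
    exact hi_pos hy
  have hi2 : ∀ y : Eu n, 1 / 2 < ‖y‖ → ‖hi y‖ ≤ ‖y‖ := by
    intro y hy
    rw [hi_norm hy]
    exact min_le_left _ _
  have hhq : ‖hh q‖ < 1 := hh3 q hq0 (by rw [hq]; norm_num)
  let g : Sp n → Sp n := fun x => if x ∈ H then I (hh (F x)) else x
  let γ : Sp n → Sp n := fun y => if y ∈ H then I (hi (F y)) else y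
  let a : Sp n := I (hh q)
  let Ω : Set (Sp n) := {x | x ∈ H → 1 / 2 < ‖F x‖}
  have haX : a ∈ X := hIX _ hhq.le
  have hFa : F a = hh q := hFI _ hhq.le
  have haH : a ∈ H := (hHiff a haX).2 (hFa ▸ hhq)
  have hwH : w ∈ H := (hHiff w hwX).2 (by rw [hw]; simp)
  -- values of g
  have gH : ∀ x ∈ H, x ≠ w → g x ∈ H ∧ F (g x) = hh (F x) ∧ g x = I (hh (F x)) := by
    intro x hx hxw
    have e : g x = I (hh (F x)) := by simp [g, hx]
    have h1 := (hHiff x (hHX hx)).1 hx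
    have h2 := hh3 _ (hw0 x (hHX hx) hxw) h1
    rw [e]
    refine ⟨?_, hFI _ h2.le, rfl⟩
    rw [hHiff _ (hIX _ h2.le), hFI _ h2.le]
    exact h2
  have gN : ∀ x, x ∉ H → g x = x := by intro x hx; simp [g, hx]
  have γH : ∀ y ∈ H, 1 / 2 < ‖F y‖ → γ y ∈ H ∧ F (γ y) = hi (F y) ∧ γ y = I (hi (F y)) := by
    intro y hy hy2
    have e : γ y = I (hi (F y)) := by simp [γ, hy]
    have h1 := (hHiff y (hHX hy)).1 hy
    have h2 := (hi2 _ hy2).trans_lt h1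
    rw [e]
    refine ⟨?_, hFI _ h2.le, rfl⟩
    rw [hHiff _ (hIX _ h2.le), hFI _ h2.le]
    exact h2
  have γN : ∀ x, x ∉ H → γ x = x := by intro x hx; simp [γ, hx]
  have hcov : ∀ x, x ∈ X ∨ x ∈ Hᶜ := by
    intro x
    by_cases h : x ∈ H
    · exact Or.inl (hHX h)
    · exact Or.inr h
  have gX : ∀ x ∈ X, x ≠ w → g x = I (hh (F x)) := by
    intro x hx hxw
    by_cases h : x ∈ H
    · exact (gH x h hxw).2.2
    · have h1 : ‖F x‖ = 1 := le_antisymm (hF.norm_le x hx) (not_lt.1 fun h2 => h ((hHiff x hx).2 h2))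
      rw [gN x h, hh_id h1, hIF x hx]
      exact hnotq _ (by rw [h1]; norm_num)
  have γX : ∀ x ∈ X, γ x = I (hi (F x)) := by
    intro x hx
    by_cases h : x ∈ H
    · simp [γ, h]
    · have h1 : ‖F x‖ = 1 := le_antisymm (hF.norm_le x hx) (not_lt.1 fun h2 => h ((hHiff x hx).2 h2))
      rw [γN x h, hi_id h1, hIF x hx]
      exact hnotq _ (by rw [h1]; norm_num)
  refine cell_abstract (A := {x | x ∈ X ∧ F x = q}) (Ω := Ω) (w := w) (a := a) (g := g) (γ := γ)
    ?_ ?_ ?_ ?_ ?_ ?_ ?_ ?_ ?_ ?_ ?_ ?_ hV hAV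
  · refine glue_on hX hH.isClosed_compl hcov ?_ ?_
    · have h1 : ContinuousOn (fun x => I (hh (F x))) ({w}ᶜ ∩ X) := by
        refine hIc.comp (hh_cont.comp (hF.cont.mono inter_subset_right) ?_) ?_
        · intro x hx; exact hw0 x hx.2 hx.1
        · intro x hx
          have h0 := hw0 x hx.2 hx.1
          refine ⟨by simpa using hh2 _ h0 (hF.norm_le x hx.2), hnotq _ (hh1 _ h0)⟩
      exact h1.congr fun x hx => gX x hx.2 hx.1
    · exact continuousOn_id.congr fun x hx => gN x hx.2
  · intro x hx h
    by_cases hxH : x ∈ H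
    · have h1 := (gH x hxH hx).2.1
      have h2 := hh1 _ (hw0 x (hHX hxH) hx)
      rw [← h1, h, hw] at h2
      norm_num at h2
    · exact hx ((gN x hxH).symm.trans h)
  · intro x hx hgH
    by_cases hxH : x ∈ H
    · rw [(gH x hxH hx).2.1]
      exact hh1 _ (hw0 x (hHX hxH) hx)
    · rw [gN x hxH] at hgH
      exact absurd hgH hxH
  · intro x hx
    by_cases hxH : x ∈ H
    · have h0 := hw0 x (hHX hxH) hx
      constructor
      · intro h
        refine ⟨hHX hxH, ?_⟩
        have h1 := (gH x hxH hx).2.1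
        rw [h, hFa] at h1
        rw [← hi_hh h0, ← h1, hi_hh hq0]
      · rintro ⟨-, h⟩
        rw [(gH x hxH hx).2.2, h]
    · rw [gN x hxH]
      constructor
      · rintro rfl; exact absurd haH hxH
      · rintro ⟨h1, h2⟩
        refine absurd ((hHiff x h1).2 ?_) hxH
        rw [h2, hq]; norm_num
  · intro x hx hxA
    by_cases hxH : x ∈ H
    · have h0 := hw0 x (hHX hxH) hx
      obtain ⟨h1, h2, h3⟩ := gH x hxH hx
      have h4 := (γH (g x) h1 (h2 ▸ hh1 _ h0)).2.2
      rw [h4, h2, hi_hh h0]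
      exact hIF x (hHX hxH) fun h => hxA ⟨hHX hxH, h⟩
    · rw [gN x hxH, γN x hxH]
  · intro y hy hya
    by_cases hyH : y ∈ H
    · have hy2 := hy hyH
      obtain ⟨h1, h2, h3⟩ := γH y hyH hy2
      have hne : γ y ≠ w := by
        intro h
        rw [h, hw] at h2
        exact hi1 _ hy2 h2.symm
      refine ⟨hne, ?_⟩
      rw [(gH _ h1 hne).2.2, h2, hh_hi hy2, hIF y (hHX hyH) (hnotq _ hy2)]
    · rw [γN y hyH]
      exact ⟨fun h => hyH (h ▸ hwH), gN y hyH⟩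
  · have hΩX : ∀ x ∈ X, x ∈ Ω → 1 / 2 < ‖F x‖ := by
      intro x hx hxΩ
      by_cases h : x ∈ H
      · exact hxΩ h
      · have h1 := not_lt.1 fun h2 => h ((hHiff x hx).2 h2)
        linarith
    refine glue_on hX hH.isClosed_compl hcov ?_ ?_
    · have h1 : ContinuousOn (fun x => I (hi (F x))) ((Ω \ {a}) ∩ X) := by
        refine hIc.comp (hi_cont.comp (hF.cont.mono inter_subset_right) ?_) ?_
        · intro x hx h0
          have h1 := hΩX x hx.2 hx.1.1
          rw [h0] at h1
          norm_num at h1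
        · intro x hx
          have h1 := hΩX x hx.2 hx.1.1
          refine ⟨by simpa using (hi2 _ h1).trans (hF.norm_le x hx.2), fun h => hx.1.2 ?_⟩
          have h : hi (F x) = q := h
          have h2 : F x = F a := by rw [hFa, ← h, hh_hi h1]
          exact hF.inj x hx.2 a haX h2 (hnotq _ h1)
      exact h1.congr fun x hx => γX x hx.2
    · exact continuousOn_id.congr fun x hx => γN x hx.2
  · have h1 : IsClosed (X ∩ F ⁻¹' closedBall 0 (1 / 2)) :=
      hF.cont.preimage_isClosed_of_isClosed hX isClosed_closedBall
    have h2 : Ω = (X ∩ F ⁻¹' closedBall 0 (1 / 2))ᶜ := by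
      ext x
      simp only [Ω, mem_ofPred_eq, mem_compl_iff, mem_inter_iff, mem_preimage,
        mem_closedBall, dist_zero_right, not_and, not_le]
      constructor
      · intro h hx
        by_cases hxH : x ∈ H
        · exact h hxH
        · have h1 := not_lt.1 fun h2 => hxH ((hHiff x hx).2 h2)
          linarith
      · intro h hx
        exact h (hHX hx)
    rw [h2]
    exact h1.isOpen_compl
  · intro _
    rw [hFa]; exact hh1 _ hq0
  · intro h
    have := hh1 _ hq0
    rw [← hFa, h, hw] at this
    norm_num at this
  · rintro ⟨-, h⟩
    exact hq0 (h.symm.trans hw)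
  · intro V hV hAV
    have hcl : IsClosed (F '' (X \ V)) :=
      ((hX.sdiff hV).isCompact.image_of_continuousOn (hF.cont.mono sdiff_subset)).isClosed
    have hop1 : IsOpen (H ∩ F ⁻¹' {y | 1 / 2 < ‖y‖}) :=
      (hF.cont.mono hHX).isOpen_inter_preimage hH (isOpen_lt continuous_const continuous_norm)
    have hc2 : ContinuousOn (fun x => hi (F x)) (H ∩ F ⁻¹' {y | 1 / 2 < ‖y‖}) := by
      refine hi_cont.comp (hF.cont.mono fun x hx => hHX hx.1) ?_
      intro x hx h0
      have h1 : 1 / 2 < ‖F x‖ := hx.2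
      rw [h0] at h1
      norm_num at h1
    have hop2 := hc2.isOpen_inter_preimage hop1 hcl.isOpen_compl
    refine ⟨_, hop2.mem_nhds ?_, ?_⟩
    · refine ⟨⟨haH, ?_⟩, ?_⟩
      · simp only [mem_preimage, mem_ofPred_eq, hFa]; exact hh1 _ hq0
      · simp only [mem_preimage, hFa, hi_hh hq0]
        rintro ⟨x, hx, hxq⟩
        exact hx.2 (hAV ⟨hx.1, hxq⟩)
    · rintro x hx ⟨⟨h1, h2⟩, h3⟩
      by_cases hxH : x ∈ H
      · have h0 := hw0 x (hHX hxH) hx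
        simp only [mem_preimage, (gH x hxH hx).2.1, hi_hh h0] at h3
        by_contra hxV
        exact h3 ⟨x, ⟨hHX hxH, hxV⟩, rfl⟩
      · rw [gN x hxH] at h1
        exact absurd h1 hxH

end Cantrell
end

section
open Set Metric Filter Topology MeasureTheory

namespace Cantrell

theorem radial_homeo {n : ℕ} (hn : 0 < n) {R c : ℝ} (hR : 0 < R) (hc : 0 < c) (hc1 : c ≤ 1) :
    ∃ θ : Eu n ≃ₜ Eu n, (∀ x, 2 * R ≤ ‖x‖ → θ x = x) ∧ ∀ x, ‖x‖ ≤ R → θ x = c • x := by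
  let φ : ℝ → ℝ := fun s => min 1 (2 - c - 2 * R * (1 - c) / max s R)
  have hd : ∀ s : ℝ, 0 < max s R := fun s => lt_of_lt_of_le hR (le_max_right _ _)
  have hφc : Continuous φ := by
    have h1 : Continuous fun s : ℝ => max s R := continuous_id.max continuous_const
    exact continuous_const.min (continuous_const.sub
      (continuous_const.div h1 fun s => (hd s).ne'))
  have hφ1 : ∀ s ≤ R, φ s = c := by
    intro s hs
    simp only [φ, max_eq_right hs]
    rw [show 2 * R * (1 - c) / R = 2 * (1 - c) by field_simp, min_eq_right] <;> linarith
  have hφ2 : ∀ s, 2 * R ≤ s → φ s = 1 := by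
    intro s hs
    simp only [φ, max_eq_left (by linarith : R ≤ s)]
    rw [min_eq_left]
    have : 2 * R * (1 - c) / s ≤ 1 - c := by
      rw [div_le_iff₀ (by linarith)]; nlinarith
    linarith
  have hmono : Monotone φ := by
    intro s t hst
    refine min_le_min le_rfl (sub_le_sub le_rfl ?_)
    refine div_le_div_of_nonneg_left ?_ (hd s) (max_le_max hst le_rfl)
    have : 0 ≤ 1 - c := by linarith
    positivity
  have hpos : ∀ s, 0 < φ s := by
    intro s
    rcases le_total s R with h | h
    · rw [hφ1 s h]; exact hc
    · have := hmono h
      rw [hφ1 R le_rfl] at this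
      linarith
  let f : Eu n → Eu n := fun x => φ ‖x‖ • x
  have hfc : Continuous f := by simp only [f]; fun_prop
  have hfn : ∀ x, ‖f x‖ = φ ‖x‖ * ‖x‖ := by
    intro x
    rw [norm_smul, Real.norm_of_nonneg (hpos _).le]
  have hst : ∀ s t, 0 ≤ s → s < t → φ s * s < φ t * t := by
    intro s t hs hst
    have := hmono hst.le
    have := hpos t
    nlinarith
  have hinj : Function.Injective f := by
    intro x y h
    have h1 : φ ‖x‖ * ‖x‖ = φ ‖y‖ * ‖y‖ := by rw [← hfn, ← hfn, h]
    have h2 : ‖x‖ = ‖y‖ := by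
      rcases lt_trichotomy ‖x‖ ‖y‖ with h' | h' | h'
      · exact absurd h1 (hst _ _ (norm_nonneg _) h').ne
      · exact h'
      · exact absurd h1 (hst _ _ (norm_nonneg _) h').ne'
    simp only [f, h2] at h
    exact smul_right_injective (Eu n) (hpos ‖y‖).ne' h
  have hsurj : Function.Surjective f := by
    intro y
    by_cases hy : y = 0
    · exact ⟨0, by simp [f, hy]⟩
    have hy0 : 0 < ‖y‖ := norm_pos_iff.2 hy
    have hM : (0 : ℝ) ≤ max (2 * R) ‖y‖ := hy0.le.trans (le_max_right _ _)
    have hcont : ContinuousOn (fun s => φ s * s) (Icc 0 (max (2 * R) ‖y‖)) := by fun_prop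
    have hmem : ‖y‖ ∈ Icc ((fun s => φ s * s) 0) ((fun s => φ s * s) (max (2 * R) ‖y‖)) := by
      refine ⟨by simp, ?_⟩
      have := hφ2 _ (le_max_left (2 * R) ‖y‖)
      simp only [this, one_mul]
      exact le_max_right _ _
    obtain ⟨s, hs, hsy⟩ := intermediate_value_Icc hM hcont hmem
    have hsy : φ s * s = ‖y‖ := hsy
    refine ⟨(s / ‖y‖) • y, ?_⟩
    have hn : ‖(s / ‖y‖) • y‖ = s := by
      rw [norm_smul, Real.norm_of_nonneg (div_nonneg hs.1 hy0.le)]; field_simp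
    simp only [f]
    rw [hn, smul_smul, ← mul_div_assoc, hsy, div_self hy0.ne', one_smul]
  have hopen : IsOpenMap f := fun U hU => inv_domain hn hU hfc.continuousOn hinj.injOn
  refine ⟨(Equiv.ofBijective f ⟨hinj, hsurj⟩).toHomeomorphOfContinuousOpen hfc hopen, ?_, ?_⟩
  · intro x hx
    change f x = x
    simp [f, hφ2 _ hx]
  · intro x hx
    change f x = _
    simp [f, hφ1 _ hx]

theorem extend_fun {n : ℕ} {p : Eu n → Sp n} (hp : IsOpenEmbedding p) {R : ℝ}
    (θ : Eu n → Eu n) (hθc : Continuous θ) (hθ : ∀ x, R ≤ ‖x‖ → θ x = x) :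
    ∃ e : Sp n → Sp n, Continuous e ∧ (∀ v, e (p v) = p (θ v)) ∧ ∀ y, y ∉ range p → e y = y := by
  classical
  let k := Function.invFun p
  have hk : ∀ v, k (p v) = v := Function.leftInverse_invFun hp.injective
  have hkc : ContinuousOn k (range p) := by
    rw [continuousOn_open_iff hp.isOpen_range]
    intro t ht
    have : range p ∩ k ⁻¹' t = p '' t := by
      ext y
      constructor
      · rintro ⟨⟨v, rfl⟩, h⟩
        rw [mem_preimage, hk] at h
        exact ⟨v, h, rfl⟩
      · rintro ⟨v, h, rfl⟩
        exact ⟨⟨v, rfl⟩, by rw [mem_preimage, hk]; exact h⟩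
    rw [this]
    exact hp.isOpenMap t ht
  let e : Sp n → Sp n := fun y => if y ∈ range p then p (θ (k y)) else y
  have he1 : ∀ y ∈ range p, e y = p (θ (k y)) := fun y hy => by simp only [e, hy, if_true]
  have he2 : ∀ y, y ∉ range p → e y = y := fun y hy => by simp only [e, hy, if_false]
  have he3 : ∀ y, y ∉ p '' closedBall 0 R → e y = y := by
    intro y hy
    by_cases h : y ∈ range p
    · obtain ⟨v, rfl⟩ := h
      rw [he1 _ ⟨v, rfl⟩, hk, hθ]
      by_contra hv
      exact hy ⟨v, by simpa using (not_le.1 hv).le, rfl⟩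
    · exact he2 y h
  have hcl : IsClosed (p '' closedBall 0 R) :=
    ((isCompact_closedBall 0 R).image hp.continuous).isClosed
  refine ⟨e, ?_, ?_, he2⟩
  · rw [continuous_iff_continuousAt]
    intro y
    by_cases hy : y ∈ range p
    · have h1 : ContinuousOn (fun y => p (θ (k y))) (range p) :=
        hp.continuous.comp_continuousOn (hθc.comp_continuousOn hkc)
      refine (h1.continuousAt (hp.isOpen_range.mem_nhds hy)).congr ?_
      filter_upwards [hp.isOpen_range.mem_nhds hy] with z hz
      exact (he1 z hz).symm
    · refine continuousAt_id.congr ?_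
      have : y ∈ (p '' closedBall 0 R)ᶜ := fun ⟨v, _, h⟩ => hy ⟨v, h⟩
      filter_upwards [hcl.isOpen_compl.mem_nhds this] with z hz
      exact (he3 z hz).symm
  · intro v
    rw [he1 _ ⟨v, rfl⟩, hk]

theorem extend_homeo {n : ℕ} {p : Eu n → Sp n} (hp : IsOpenEmbedding p) {R : ℝ}
    (θ : Eu n ≃ₜ Eu n) (hθ : ∀ x, R ≤ ‖x‖ → θ x = x) :
    ∃ e : Sp n ≃ₜ Sp n, (∀ v, e (p v) = p (θ v)) ∧ ∀ y, y ∉ range p → e y = y := by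
  obtain ⟨e, hec, he1, he2⟩ := extend_fun hp θ θ.continuous hθ
  have hθ' : ∀ x, R ≤ ‖x‖ → θ.symm x = x := by
    intro x hx
    rw [Homeomorph.symm_apply_eq, hθ x hx]
  obtain ⟨e', hec', he1', he2'⟩ := extend_fun hp θ.symm θ.symm.continuous hθ'
  refine ⟨⟨⟨e, e', ?_, ?_⟩, hec, hec'⟩, he1, he2⟩
  · intro y
    by_cases h : y ∈ range p
    · obtain ⟨v, rfl⟩ := h
      rw [he1, he1', θ.symm_apply_apply]
    · rw [he2 y h, he2' y h]
  · intro y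
    by_cases h : y ∈ range p
    · obtain ⟨v, rfl⟩ := h
      rw [he1', he1, θ.apply_symm_apply]
    · rw [he2' y h, he2 y h]

theorem shrink_step {n : ℕ} (hn : 0 < n) {A : Set (Sp n)} (hA : IsCompact A)
    (hcell : ∀ V : Set (Sp n), IsOpen V → A ⊆ V → ∃ p : Eu n → Sp n, Continuous p ∧
      Function.Injective p ∧ range p ⊆ V ∧ A ⊆ range p)
    (φ : Sp n ≃ₜ Sp n) {V : Set (Sp n)} (hV : IsOpen V) (hAV : A ⊆ V) {ε : ℝ} (hε : 0 < ε) :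
    ∃ (φ' : Sp n ≃ₜ Sp n) (W : Set (Sp n)), IsOpen W ∧ A ⊆ W ∧ closure W ⊆ V ∧
      (∀ x, x ∉ V → φ' x = φ x) ∧ (∀ x ∈ V, φ' x ∈ φ '' V) ∧
      ∀ x ∈ W, ∀ y ∈ W, dist (φ' x) (φ' y) ≤ ε := by
  obtain ⟨p, hpc, hpi, hpV, hAp⟩ := hcell V hV hAV
  have hp : IsOpenEmbedding p := IsOpenEmbedding.of_continuous_injective_isOpenMap hpc hpi
    fun U hU => inv_domain_sphere hn hU hpc.continuousOn hpi.injOn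
  have hcpt : IsCompact (p ⁻¹' A) := hp.isInducing.isCompact_preimage_iff hAp |>.2 hA
  obtain ⟨R, hR⟩ := hcpt.isBounded.subset_ball_lt 0 (0 : Eu n)
  obtain ⟨hR0, hR⟩ := hR
  have hc1 : ContinuousAt (fun v => φ (p v)) 0 := (φ.continuous.comp hpc).continuousAt
  obtain ⟨δ, hδ, hδ2⟩ := Metric.continuousAt_iff.1 hc1 (ε / 2) (by linarith)
  have hc : 0 < min 1 (δ / R) := lt_min one_pos (by positivity)
  obtain ⟨θ, hθ1, hθ2⟩ := radial_homeo hn hR0 hc (min_le_left _ _)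
  obtain ⟨e, he1, he2⟩ := extend_homeo hp θ hθ1
  have hθb : ∀ v, ‖v‖ < R → ‖θ v‖ < δ := by
    intro v hv
    rw [hθ2 v hv.le, norm_smul, Real.norm_of_nonneg hc.le]
    calc min 1 (δ / R) * ‖v‖ ≤ δ / R * ‖v‖ :=
          mul_le_mul_of_nonneg_right (min_le_right _ _) (norm_nonneg _)
      _ < δ / R * R := mul_lt_mul_of_pos_left hv (by positivity)
      _ = δ := by field_simp
  refine ⟨e.trans φ, p '' ball 0 R, hp.isOpenMap _ isOpen_ball, ?_, ?_, ?_, ?_, ?_⟩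
  · intro x hx
    obtain ⟨v, rfl⟩ := hAp hx
    exact ⟨v, hR hx, rfl⟩
  · have hcl : IsClosed (p '' closedBall 0 R) :=
      ((isCompact_closedBall 0 R).image hp.continuous).isClosed
    refine (closure_minimal (image_mono ball_subset_closedBall) hcl).trans ?_
    exact (image_subset_range _ _).trans hpV
  · intro x hx
    simp only [Homeomorph.trans_apply]
    rw [he2 x fun h => hx (hpV h)]
  · intro x hx
    refine ⟨e x, ?_, rfl⟩
    by_cases h : x ∈ range p
    · obtain ⟨v, rfl⟩ := h
      rw [he1]; exact hpV ⟨_, rfl⟩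
    · rw [he2 x h]; exact hx
  · rintro _ ⟨u, hu, rfl⟩ _ ⟨v, hv, rfl⟩
    simp only [Homeomorph.trans_apply, he1]
    rw [mem_ball_zero_iff] at hu hv
    have h1 := hδ2 (x := θ u) (by simpa using hθb u hu)
    have h2 := hδ2 (x := θ v) (by simpa using hθb v hv)
    have := dist_triangle_right (φ (p (θ u))) (φ (p (θ v))) (φ (p 0))
    linarith

theorem shrink {n : ℕ} (hn : 0 < n) {A U : Set (Sp n)} (hA : IsCompact A)
    (hU : IsOpen U) (hAU : A ⊆ U)
    (hcell : ∀ V : Set (Sp n), IsOpen V → A ⊆ V → ∃ p : Eu n → Sp n, Continuous p ∧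
      Function.Injective p ∧ range p ⊆ V ∧ A ⊆ range p) :
    ∃ Φ : Sp n → Sp n, Continuous Φ ∧ Function.Surjective Φ ∧ (∀ x, x ∉ U → Φ x = x) ∧
      ∀ x y, Φ x = Φ y ↔ (x = y ∨ (x ∈ A ∧ y ∈ A)) := by
  let St := {s : (Sp n ≃ₜ Sp n) × Set (Sp n) // IsOpen s.2 ∧ A ⊆ s.2}
  have hstep : ∀ (i : ℕ) (s : St), ∃ t : St, closure t.1.2 ⊆ s.1.2 ∧
      (∀ x, x ∉ s.1.2 → t.1.1 x = s.1.1 x) ∧ (∀ x ∈ s.1.2, t.1.1 x ∈ s.1.1 '' s.1.2) ∧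
      (∀ x ∈ t.1.2, ∀ y ∈ t.1.2, dist (t.1.1 x) (t.1.1 y) ≤ 1 / (i + 1 : ℝ)) ∧
      t.1.2 ⊆ thickening (1 / (i + 1 : ℝ)) A := by
    rintro i ⟨⟨φ, V⟩, hV, hAV⟩
    have hi : (0 : ℝ) < 1 / (i + 1 : ℝ) := by positivity
    obtain ⟨φ', W, h1, h2, h3, h4, h5, h6⟩ := shrink_step hn hA hcell φ hV hAV hi
    refine ⟨⟨(φ', W ∩ thickening (1 / (i + 1 : ℝ)) A), h1.inter isOpen_thickening,
      subset_inter h2 (self_subset_thickening hi A)⟩, ?_, h4, h5, ?_, inter_subset_right⟩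
    · exact (closure_mono inter_subset_left).trans h3
    · exact fun x hx y hy => h6 x hx.1 y hy.1
  choose f hf1 hf2 hf3 hf4 hf5 using hstep
  let s : ℕ → St := fun i => Nat.rec ⟨(Homeomorph.refl _, U), hU, hAU⟩ (fun i t => f i t) i
  have hs : ∀ i, s (i + 1) = f i (s i) := fun i => rfl
  let φ : ℕ → Sp n ≃ₜ Sp n := fun i => (s i).1.1
  let V : ℕ → Set (Sp n) := fun i => (s i).1.2
  have hAV : ∀ i, A ⊆ V i := fun i => (s i).2.2
  have h1 : ∀ i, closure (V (i + 1)) ⊆ V i := fun i => hf1 i (s i)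
  have h2 : ∀ i x, x ∉ V i → φ (i + 1) x = φ i x := fun i => hf2 i (s i)
  have h3 : ∀ i, ∀ x ∈ V i, φ (i + 1) x ∈ φ i '' V i := fun i => hf3 i (s i)
  have h4 : ∀ i : ℕ, ∀ x ∈ V (i + 1), ∀ y ∈ V (i + 1),
      dist (φ (i + 1) x) (φ (i + 1) y) ≤ 1 / (i + 1 : ℝ) := fun i => hf4 i (s i)
  have h5 : ∀ i : ℕ, V (i + 1) ⊆ thickening (1 / (i + 1 : ℝ)) A := fun i => hf5 i (s i)
  have hV0 : V 0 = U := rfl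
  have hφ0 : ∀ x, φ 0 x = x := fun x => rfl
  have hanti : Antitone V := antitone_nat_of_succ_le fun i => subset_closure.trans (h1 i)
  -- stability off V i
  have hoff : ∀ i j, i ≤ j → ∀ x, x ∉ V i → φ j x = φ i x := by
    intro i j hij
    induction j, hij using Nat.le_induction with
    | base => intro x _; rfl
    | succ j hij ih =>
      intro x hx
      rw [h2 j x fun h => hx (hanti hij h), ih x hx]
  have hin : ∀ i j, i ≤ j → ∀ x, x ∈ V i → φ j x ∈ φ i '' V i := by
    intro i j hij x hx
    by_contra h
    -- φ j x = φ i y with y ∉ V i, so φ j x = φ j y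
    have h6 : φ i ((φ i).symm (φ j x)) = φ j x := (φ i).apply_symm_apply _
    have h7 : (φ i).symm (φ j x) ∉ V i := fun h8 => h ⟨_, h8, h6⟩
    have h8 := hoff i j hij _ h7
    rw [h6] at h8
    have h9 := (φ j).injective h8
    rw [h9] at h7
    exact h7 hx
  have hdist : ∀ i j : ℕ, i + 1 ≤ j → ∀ x, dist (φ j x) (φ (i + 1) x) ≤ 1 / (i + 1 : ℝ) := by
    intro i j hij x
    by_cases hx : x ∈ V (i + 1)
    · obtain ⟨y, hy, hyx⟩ := hin _ _ hij x hx
      rw [← hyx]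
      exact h4 i y hy x hx
    · rw [hoff _ _ hij x hx, dist_self]; positivity
  have hlim0 : Tendsto (fun i : ℕ => 1 / (i + 1 : ℝ)) atTop (𝓝 0) :=
    tendsto_one_div_add_atTop_nhds_zero_nat
  have hcau : ∀ x, ∃ l, Tendsto (fun i => φ i x) atTop (𝓝 l) := by
    intro x
    refine cauchySeq_tendsto_of_complete ?_
    rw [Metric.cauchySeq_iff']
    intro ε hε
    obtain ⟨i, hi⟩ := (hlim0.eventually_lt_const hε).exists
    exact ⟨i + 1, fun j hj => (hdist i j hj x).trans_lt hi⟩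
  choose Φ hΦ using hcau
  have hΦd : ∀ (i : ℕ) x, dist (Φ x) (φ (i + 1) x) ≤ 1 / (i + 1 : ℝ) := by
    intro i x
    refine le_of_tendsto ((hΦ x).dist tendsto_const_nhds) ?_
    filter_upwards [eventually_ge_atTop (i + 1)] with j hj
    exact hdist i j hj x
  have hΦoff : ∀ i x, x ∉ V i → Φ x = φ i x := by
    intro i x hx
    refine tendsto_nhds_unique (hΦ x) (tendsto_const_nhds.congr' ?_)
    filter_upwards [eventually_ge_atTop i] with j hj
    exact (hoff i j hj x hx).symm
  have hΦc : Continuous Φ := by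
    refine continuous_of_uniform_approx_of_continuous fun u hu => ?_
    obtain ⟨ε, hε, hεu⟩ := Metric.mem_uniformity_dist.1 hu
    obtain ⟨i, hi⟩ := (hlim0.eventually_lt_const hε).exists
    exact ⟨φ (i + 1), (φ (i + 1)).continuous, fun x => hεu ((hΦd i x).trans_lt hi)⟩
  have hexV : ∀ x, x ∉ A → ∃ i, x ∉ V i := by
    intro x hx
    by_contra! h
    apply hx
    rw [← hA.isClosed.closure_eq, Metric.mem_closure_iff]
    intro ε hε
    obtain ⟨i, hi⟩ := (hlim0.eventually_lt_const hε).exists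
    obtain ⟨a, ha, hxa⟩ := mem_thickening_iff.1 (h5 i (h (i + 1)))
    exact ⟨a, ha, hxa.trans hi⟩
  have hmix : ∀ x y, x ∉ A → y ∈ A → Φ x ≠ Φ y := by
    intro x y hx hy h
    obtain ⟨i, hi⟩ := hexV x hx
    have hxi : x ∉ V (i + 1) := fun h => hi (hanti (Nat.le_succ i) h)
    have h6 : Φ y ∈ closure (φ (i + 1) '' V (i + 1)) := by
      refine mem_closure_of_tendsto (hΦ y) ?_
      filter_upwards [eventually_ge_atTop (i + 1)] with j hj
      exact hin _ _ hj y (hAV (i + 1) hy)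
    rw [← (φ (i + 1)).image_closure, ← h, hΦoff (i + 1) _ hxi] at h6
    obtain ⟨z, hz, hzx⟩ := h6
    rw [(φ (i + 1)).injective hzx] at hz
    exact hi (h1 i hz)
  refine ⟨Φ, hΦc, ?_, ?_, ?_⟩
  · intro y
    have hcl : IsClosed (range Φ) := (isCompact_range hΦc).isClosed
    change y ∈ range Φ
    rw [← hcl.closure_eq, Metric.mem_closure_iff]
    intro ε hε
    obtain ⟨i, hi⟩ := (hlim0.eventually_lt_const hε).exists
    refine ⟨_, ⟨(φ (i + 1)).symm y, rfl⟩, ?_⟩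
    have := hΦd i ((φ (i + 1)).symm y)
    rw [Homeomorph.apply_symm_apply, dist_comm] at this
    exact this.trans_lt hi
  · intro x hx
    rw [hΦoff 0 x hx, hφ0]
  · intro x y
    constructor
    · intro h
      by_cases hx : x ∈ A <;> by_cases hy : y ∈ A
      · exact Or.inr ⟨hx, hy⟩
      · exact absurd h.symm (hmix y x hy hx)
      · exact absurd h (hmix x y hx hy)
      · obtain ⟨i, hi⟩ := hexV x hx
        obtain ⟨j, hj⟩ := hexV y hy
        have hxi : x ∉ V (max i j) := fun h => hi (hanti (le_max_left i j) h)
        have hyi : y ∉ V (max i j) := fun h => hj (hanti (le_max_right i j) h)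
        rw [hΦoff _ _ hxi, hΦoff _ _ hyi] at h
        exact Or.inl ((φ (max i j)).injective h)
    · rintro (rfl | ⟨hx, hy⟩)
      · rfl
      · refine dist_le_zero.1 ?_
        have hl := ((hΦ x).comp (tendsto_add_atTop_nat 1)).dist
          ((hΦ y).comp (tendsto_add_atTop_nat 1))
        refine le_of_tendsto_of_tendsto hl hlim0 (Eventually.of_forall fun i => ?_)
        exact h4 i x (hAV (i + 1) hx) y (hAV (i + 1) hy)

end Cantrell
end

section
open Set Metric Filter Topology MeasureTheory

namespace Cantrell

theorem homeo_of_fibres {X Y Z : Type*} [TopologicalSpace X] [TopologicalSpace Y]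
    [TopologicalSpace Z] [CompactSpace X] [T2Space Y] [T2Space Z] {f : X → Y} {g : X → Z}
    (hf : Continuous f) (hg : Continuous g) (hfs : Function.Surjective f)
    (hgs : Function.Surjective g) (h : ∀ x y, f x = f y ↔ g x = g y) : Nonempty (Y ≃ₜ Z) := by
  have hq : IsQuotientMap f := hf.isClosedMap.isQuotientMap hf hfs
  let k : Y → Z := fun y => g (Function.surjInv hfs y)
  have hk : ∀ x, k (f x) = g x := fun x => (h _ _).1 (Function.surjInv_eq hfs (f x))
  have hkc : Continuous k := by
    rw [hq.continuous_iff]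
    exact hg.congr fun x => (hk x).symm
  have hkb : Function.Bijective k := by
    constructor
    · intro a b hab
      obtain ⟨x, rfl⟩ := hfs a
      obtain ⟨y, rfl⟩ := hfs b
      rw [hk, hk] at hab
      exact (h x y).2 hab
    · intro z
      obtain ⟨x, rfl⟩ := hgs z
      exact ⟨f x, hk x⟩
  have : CompactSpace Y := ⟨by rw [← hfs.range_eq]; exact isCompact_range hf⟩
  exact ⟨Continuous.homeoOfEquivCompactToT2 (f := Equiv.ofBijective k hkb) hkc⟩

theorem final_homeo {n : ℕ} (hn : 0 < n) {H X S : Set (Sp n)} {q : Eu n} {F : Sp n → Eu n}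
    (hH : IsOpen H) (hX : IsClosed X) (hXU : X = H ∪ S) (hd : Disjoint H S)
    (hF : DiscMap X S q F) (hq : ‖q‖ = 1 / 4) :
    Nonempty (X ≃ₜ (closedBall (0 : Eu n) 1 : Set (Eu n))) := by
  have hA : IsClosed (X ∩ F ⁻¹' {q}) :=
    hF.cont.preimage_isClosed_of_isClosed hX isClosed_singleton
  have hAeq : {x | x ∈ X ∧ F x = q} = X ∩ F ⁻¹' {q} := rfl
  have hAH : {x | x ∈ X ∧ F x = q} ⊆ H := by
    rintro x ⟨hx, hxq⟩
    have hx' := hx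
    rw [hXU] at hx'
    rcases hx' with h | h
    · exact h
    · have := (hF.bdry x hx).1 h
      rw [hxq, hq] at this
      norm_num at this
  obtain ⟨Φ, hΦc, hΦs, hΦid, hΦf⟩ := shrink hn (A := {x | x ∈ X ∧ F x = q}) (U := H)
    (hAeq ▸ hA.isCompact) hH hAH (fun V hV hAV => cellular hH hX hXU hd hF hq hV hAV)
  have hΦH : ∀ x, x ∈ H → Φ x ∈ H := by
    intro x hx
    by_contra h
    have h1 := hΦid _ h
    rcases (hΦf _ _).1 h1 with h2 | ⟨h2, -⟩
    · rw [h2] at h; exact h hx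
    · exact h (hAH h2)
  have hΦX : ∀ x ∈ X, Φ x ∈ X := by
    intro x hx
    by_cases h : x ∈ H
    · rw [hXU]; exact Or.inl (hΦH x h)
    · rwa [hΦid x h]
  have : CompactSpace X := isCompact_iff_compactSpace.1 hX.isCompact
  refine homeo_of_fibres (f := fun x : X => (⟨Φ x, hΦX x x.2⟩ : X))
    (g := fun x : X => (⟨F x, by simpa using hF.norm_le x x.2⟩ : (closedBall (0 : Eu n) 1 : Set _)))
    ?_ ?_ ?_ ?_ ?_
  · exact (hΦc.comp continuous_subtype_val).subtype_mk _
  · exact (continuousOn_iff_continuous_domRestrict.1 hF.cont).subtype_mk _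
  · rintro ⟨y, hy⟩
    obtain ⟨x, hx⟩ := hΦs y
    by_cases h : x ∈ H
    · exact ⟨⟨x, by rw [hXU]; exact Or.inl h⟩, Subtype.ext hx⟩
    · rw [hΦid x h] at hx
      exact ⟨⟨x, hx ▸ hy⟩, Subtype.ext (by simpa [hΦid x h] using hx)⟩
  · rintro ⟨z, hz⟩
    obtain ⟨x, hx, hxz⟩ := hF.surj z (by simpa using hz)
    exact ⟨⟨x, hx⟩, Subtype.ext hxz⟩
  · rintro ⟨x, hx⟩ ⟨y, hy⟩
    simp only [Subtype.mk.injEq]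
    rw [hΦf]
    constructor
    · rintro (rfl | ⟨h1, h2⟩)
      · rfl
      · rw [h1.2, h2.2]
    · intro h
      by_cases h1 : F x = q
      · exact Or.inr ⟨⟨hx, h1⟩, hy, h ▸ h1⟩
      · exact Or.inl (hF.inj x hx y hy h h1)

theorem case_high {m : ℕ} (hm : 0 < m) {S H : Set (Sp (m + 1))}
    (e : S ≃ₜ sphere (0 : Eu (m + 1)) 1) (hH : ∃ x ∈ Sᶜ, H = connectedComponentIn Sᶜ x)
    (hch : ∀ x ∈ closure H, ∃ c : Chart (closure H), x ∈ c.O) :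
    Nonempty (closure H ≃ₜ (closedBall (0 : Eu (m + 1)) 1 : Set (Eu (m + 1)))) := by
  obtain ⟨hHo, hHn, hcl, hd, hSc, -, hc⟩ := main_setup hm e hH hch
  have hSX : S ⊆ closure H := by rw [hcl]; exact subset_union_right
  have hg := good_global isClosed_closure hSc.isClosed hSX (fun y hy => by
    obtain ⟨c, hyc⟩ := hch y (hSX hy)
    exact good_local isClosed_closure hSc.isClosed hSX c (hc c) hy hyc)
  obtain ⟨F, hF⟩ := discMap_of_good isClosed_closure (hHn.mono subset_closure) hSc.isClosed hSX e hg
  obtain ⟨q, F', hq, hF', -⟩ := discMap_move (Nat.succ_pos m) hF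
  exact final_homeo (Nat.succ_pos m) hHo isClosed_closure hcl hd hF' hq

end Cantrell
end

section
open Set Metric Filter Topology MeasureTheory

namespace Cantrell

noncomputable def lineHomeo : ℝ ≃ₜ Eu 1 where
  toFun t := WithLp.toLp 2 fun _ => t
  invFun v := v 0
  left_inv t := rfl
  right_inv v := by
    ext i
    rw [Subsingleton.elim i 0]
  continuous_toFun := by fun_prop
  continuous_invFun := by fun_prop

theorem norm_eu1 (v : Eu 1) : ‖v‖ = |v 0| := by
  rw [EuclideanSpace.norm_eq]; simp [Real.sqrt_sq_eq_abs]

theorem eu1_ext {u v : Eu 1} (h : u 0 = v 0) : u = v := by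
  ext i
  rw [Subsingleton.elim i 0]
  exact h

theorem two_points {S : Set (Sp 1)} (e : S ≃ₜ sphere (0 : Eu 1) 1) :
    ∃ s0 s1 : Sp 1, s0 ≠ s1 ∧ S = {s0, s1} := by
  have h1 : lineHomeo 1 ∈ sphere (0 : Eu 1) 1 := by
    rw [mem_sphere_zero_iff_norm, norm_eu1]; change |(1 : ℝ)| = 1; simp
  have h2 : lineHomeo (-1) ∈ sphere (0 : Eu 1) 1 := by
    rw [mem_sphere_zero_iff_norm, norm_eu1]; change |(-1 : ℝ)| = 1; simp
  refine ⟨e.symm ⟨_, h1⟩, e.symm ⟨_, h2⟩, ?_, ?_⟩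
  · intro h
    have h3 := e.symm.injective (Subtype.ext h)
    have h4 := lineHomeo.injective (congrArg Subtype.val h3)
    norm_num at h4
  · ext x
    simp only [mem_insert_iff, mem_singleton_iff]
    constructor
    · intro hx
      have h3 : ‖((e ⟨x, hx⟩ : sphere (0 : Eu 1) 1) : Eu 1)‖ = 1 :=
        mem_sphere_zero_iff_norm.1 (e ⟨x, hx⟩).2
      rw [norm_eu1] at h3
      rcases (abs_eq zero_le_one).1 h3 with h | h
      · left
        have : e ⟨x, hx⟩ = ⟨_, h1⟩ := Subtype.ext (eu1_ext h)
        rw [← this, e.symm_apply_apply]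
      · right
        have : e ⟨x, hx⟩ = ⟨_, h2⟩ := Subtype.ext (eu1_ext h)
        rw [← this, e.symm_apply_apply]
    · rintro (rfl | rfl) <;> exact Subtype.coe_prop _

theorem arc_exists {s0 s1 x : Sp 1} (h01 : s0 ≠ s1) (hx0 : x ≠ s0) (hx1 : x ≠ s1) :
    ∃ c : ℝ → Sp 1, IsOpenEmbedding c ∧ range c = {s0}ᶜ ∧ c 0 = s1 ∧ ∃ t, 0 < t ∧ c t = x := by
  let L := lineHomeo
  let c0 : ℝ → Sp 1 := fun t => (st s0).symm (L t)
  have hc0 : IsOpenEmbedding c0 := by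
    refine IsOpenEmbedding.of_continuous_injective_isOpenMap
      ((st_symm_cont s0).comp L.continuous) ?_ ?_
    · intro s t h
      have := congrArg (st s0) h
      simp only [c0] at this
      rw [st_right, st_right] at this
      exact L.injective this
    · intro U hU
      have := st_symm_open s0 (L.isOpenMap U hU)
      rwa [image_image] at this
  have hr : range c0 = {s0}ᶜ := by
    ext y
    constructor
    · rintro ⟨t, rfl⟩
      exact st_symm_ne s0 _
    · intro hy
      exact ⟨L.symm (st s0 y), by simp only [c0, L.apply_symm_apply]; exact st_left hy⟩
  obtain ⟨t1, ht1⟩ : s1 ∈ range c0 := by rw [hr]; exact h01.symm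
  obtain ⟨t, ht⟩ : x ∈ range c0 := by rw [hr]; exact hx0
  have hne : t ≠ t1 := by rintro rfl; exact hx1 (ht.symm.trans ht1)
  rcases hne.lt_or_gt with h | h
  · let A : ℝ ≃ₜ ℝ := (Homeomorph.neg ℝ).trans (Homeomorph.addLeft t1)
    have hA : ∀ s, A s = t1 + -s := fun s => rfl
    refine ⟨c0 ∘ A, hc0.comp A.isOpenEmbedding, ?_, ?_, t1 - t, by linarith, ?_⟩
    · rw [A.surjective.range_comp, hr]
    · simp [hA, ht1]
    · simp [hA, ht]
  · let A : ℝ ≃ₜ ℝ := Homeomorph.addLeft t1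
    have hA : ∀ s, A s = t1 + s := fun s => rfl
    refine ⟨c0 ∘ A, hc0.comp A.isOpenEmbedding, ?_, ?_, t - t1, by linarith, ?_⟩
    · rw [A.surjective.range_comp, hr]
    · simp [hA, ht1]
    · simp [hA, ht]

theorem case_one {S H : Set (Sp 1)} (e : S ≃ₜ sphere (0 : Eu 1) 1)
    (hH : ∃ x ∈ Sᶜ, H = connectedComponentIn Sᶜ x) :
    Nonempty (closure H ≃ₜ (closedBall (0 : Eu 1) 1 : Set (Eu 1))) := by
  classical
  obtain ⟨s0, s1, h01, rfl⟩ := two_points e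
  obtain ⟨x, hx, rfl⟩ := hH
  simp only [mem_compl_iff, mem_insert_iff, mem_singleton_iff, not_or] at hx
  obtain ⟨c, hc, hr, hc0, t, ht, rfl⟩ := arc_exists h01 hx.1 hx.2
  have hcs0 : ∀ t, c t ≠ s0 := fun t => by
    have : c t ∈ range c := ⟨t, rfl⟩
    rw [hr] at this
    exact this
  have hcS : ∀ t, t ≠ 0 → c t ∈ ({s0, s1}ᶜ : Set (Sp 1)) := by
    intro t ht
    simp only [mem_compl_iff, mem_insert_iff, mem_singleton_iff, not_or]
    refine ⟨hcs0 t, fun h => ht ?_⟩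
    rw [← hc0] at h
    exact hc.injective h
  have hHeq : connectedComponentIn ({s0, s1}ᶜ : Set (Sp 1)) (c t) = c '' Ioi 0 := by
    apply Subset.antisymm
    · refine isPreconnected_connectedComponentIn.subset_left_of_subset_union
        (v := c '' Iio 0) (hc.isOpenMap _ isOpen_Ioi) (hc.isOpenMap _ isOpen_Iio) ?_ ?_ ?_
      · rw [disjoint_image_iff hc.injective]
        exact Set.disjoint_left.2 fun a (h1 : 0 < a) (h2 : a < 0) => by linarith
      · intro y hy
        have hy := connectedComponentIn_subset _ _ hy
        simp only [mem_compl_iff, mem_insert_iff, mem_singleton_iff, not_or] at hy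
        obtain ⟨u, rfl⟩ : y ∈ range c := by rw [hr]; exact hy.1
        rcases lt_trichotomy u 0 with h | h | h
        · exact Or.inr ⟨u, h, rfl⟩
        · exact absurd (h ▸ hc0) hy.2
        · exact Or.inl ⟨u, h, rfl⟩
      · exact ⟨c t, mem_connectedComponentIn (hcS t ht.ne'), t, ht, rfl⟩
    · refine IsPreconnected.subset_connectedComponentIn
        (isPreconnected_Ioi.image _ hc.continuous.continuousOn) ⟨t, ht, rfl⟩ ?_
      rintro _ ⟨u, hu, rfl⟩
      exact hcS u (ne_of_gt hu)
  rw [hHeq]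
  have hlim : Tendsto c atTop (𝓝 s0) := by
    intro N hN
    obtain ⟨N', hN'N, hN'o, hsN'⟩ := _root_.mem_nhds_iff.1 hN
    have hcpt : IsCompact N'ᶜ := hN'o.isClosed_compl.isCompact
    have hsub : N'ᶜ ⊆ range c := by
      intro y hy
      rw [hr]
      rintro rfl
      exact hy hsN'
    have h2 : IsCompact (c ⁻¹' N'ᶜ) := (hc.isInducing.isCompact_preimage_iff hsub).2 hcpt
    obtain ⟨b, hb⟩ := h2.bddAbove
    rw [Filter.mem_map]
    filter_upwards [eventually_gt_atTop b] with u hu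
    by_contra h
    have := hb (show u ∈ c ⁻¹' N'ᶜ from fun h' => h (hN'N h'))
    linarith
  have hcl : closure (c '' Ioi 0) = c '' Ici 0 ∪ {s0} := by
    apply Subset.antisymm
    · have hclosed : IsClosed (c '' Ici 0 ∪ {s0}) := by
        have : c '' Ici 0 ∪ {s0} = (c '' Iio 0)ᶜ := by
          ext y
          constructor
          · rintro (⟨u, hu, rfl⟩ | h)
            · rintro ⟨v, hv, hvu⟩
              rw [hc.injective hvu] at hv
              exact (not_le.2 (show u < 0 from hv)) hu
            · rintro ⟨v, hv, hvu⟩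
              exact hcs0 v (hvu.trans h)
          · intro hy
            by_cases h : y = s0
            · exact Or.inr h
            · obtain ⟨u, rfl⟩ : y ∈ range c := by rw [hr]; exact h
              exact Or.inl ⟨u, mem_Ici.2 (not_lt.1 fun h' => hy ⟨u, h', rfl⟩), rfl⟩
        rw [this]
        exact (hc.isOpenMap _ isOpen_Iio).isClosed_compl
      refine closure_minimal ?_ hclosed
      exact (image_mono Ioi_subset_Ici_self).trans subset_union_left
    · rintro y (⟨u, hu, rfl⟩ | rfl)
      · have h1 : u ∈ closure (Ioi (0 : ℝ)) := by rw [closure_Ioi]; exact hu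
        exact image_closure_subset_closure_image hc.continuous ⟨u, h1, rfl⟩
      · refine mem_closure_of_tendsto hlim ?_
        filter_upwards [eventually_gt_atTop 0] with u hu
        exact ⟨u, hu, rfl⟩
  let k : ℝ → Sp 1 := fun t => if t < 1 then c (t / (1 - t)) else s0
  have hk1 : ∀ t, t < 1 → k t = c (t / (1 - t)) := fun t ht => by simp only [k, ht, if_true]
  have hk2 : k 1 = s0 := by simp [k]
  have hkc : ContinuousOn k (Iic 1) := by
    intro t ht
    rcases (show t ≤ 1 from ht).lt_or_eq with h | rfl
    · refine ContinuousAt.continuousWithinAt ?_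
      have h1 : ContinuousAt (fun t : ℝ => c (t / (1 - t))) t := by
        refine hc.continuous.continuousAt.comp ?_
        exact continuousAt_id.div (by fun_prop) (by linarith)
      refine h1.congr ?_
      filter_upwards [Iio_mem_nhds h] with u hu
      exact (hk1 u hu).symm
    · rw [← continuousWithinAt_Iio_iff_Iic]
      have h1 : Tendsto (fun t : ℝ => 1 - t) (𝓝[<] 1) (𝓝[>] 0) := by
        refine tendsto_nhdsWithin_iff.2 ⟨?_, ?_⟩
        · have : Tendsto (fun t : ℝ => 1 - t) (𝓝 1) (𝓝 (1 - 1)) := by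
            exact (continuous_const.sub continuous_id).tendsto 1
          rw [sub_self] at this
          exact this.mono_left nhdsWithin_le_nhds
        · filter_upwards [self_mem_nhdsWithin] with u hu
          have : u < 1 := hu
          exact sub_pos.2 this
      have h2 := tendsto_inv_nhdsGT_zero.comp h1
      have h3 : Tendsto (fun t : ℝ => t * (1 - t)⁻¹) (𝓝[<] 1) atTop :=
        Tendsto.pos_mul_atTop one_pos (tendsto_id.mono_left nhdsWithin_le_nhds) h2
      have h4 := hlim.comp h3
      rw [ContinuousWithinAt, hk2]
      refine h4.congr' ?_
      filter_upwards [self_mem_nhdsWithin] with u hu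
      rw [hk1 u hu, div_eq_mul_inv]; rfl
  have hD : ∀ z ∈ (closedBall (0 : Eu 1) 1 : Set (Eu 1)), -1 ≤ z 0 ∧ z 0 ≤ 1 := by
    intro z hz
    rw [mem_closedBall_zero_iff, norm_eu1] at hz
    exact abs_le.1 hz
  have hmaps : ∀ z ∈ (closedBall (0 : Eu 1) 1 : Set (Eu 1)),
      k ((1 + z 0) / 2) ∈ closure (c '' Ioi 0) := by
    intro z hz
    obtain ⟨h1, h2⟩ := hD z hz
    rw [hcl]
    rcases h2.lt_or_eq with h | h
    · rw [hk1 _ (by linarith)]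
      refine Or.inl ⟨_, mem_Ici.2 (div_nonneg ?_ ?_), rfl⟩ <;> linarith
    · rw [h]
      norm_num
      exact Or.inl hk2
  have hcd : CompactSpace (closedBall (0 : Eu 1) 1 : Set (Eu 1)) :=
    isCompact_iff_compactSpace.1 (isCompact_closedBall _ _)
  let f : (closedBall (0 : Eu 1) 1 : Set (Eu 1)) → closure (c '' Ioi 0) :=
    fun z => ⟨k ((1 + (z : Eu 1) 0) / 2), hmaps z z.2⟩
  have hfc : Continuous f := by
    refine Continuous.subtype_mk ?_ _
    refine hkc.comp_continuous (by fun_prop) ?_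
    intro z
    have := (hD z z.2).2
    change (1 + (z : Eu 1) 0) / 2 ≤ 1
    linarith
  have hfb : Function.Bijective f := by
    constructor
    · rintro ⟨u, hu⟩ ⟨v, hv⟩ h
      have h := congrArg Subtype.val h
      simp only [f] at h
      refine Subtype.ext (eu1_ext ?_)
      change u 0 = v 0
      rcases (hD u hu).2.lt_or_eq with h1 | h1 <;> rcases (hD v hv).2.lt_or_eq with h2 | h2
      · rw [hk1 _ (by linarith), hk1 _ (by linarith)] at h
        have h3 := hc.injective h
        rw [div_eq_div_iff (by linarith) (by linarith)] at h3
        linarith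
      · rw [hk1 _ (by linarith), h2, show (1 + 1 : ℝ) / 2 = 1 by norm_num, hk2] at h
        exact absurd h (hcs0 _)
      · rw [hk1 ((1 + v 0) / 2) (by linarith), h1, show (1 + 1 : ℝ) / 2 = 1 by norm_num, hk2] at h
        exact absurd h.symm (hcs0 _)
      · rw [h1, h2]
    · rintro ⟨y, hy⟩
      have hy' := hy
      rw [hcl] at hy'
      rcases hy' with ⟨u, hu, rfl⟩ | h
      · have hu : 0 ≤ u := hu
        have hz : lineHomeo (2 * (u / (1 + u)) - 1) ∈ (closedBall (0 : Eu 1) 1 : Set (Eu 1)) := by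
          rw [mem_closedBall_zero_iff, norm_eu1]
          change |2 * (u / (1 + u)) - 1| ≤ 1
          have h1 : 0 ≤ u / (1 + u) := by positivity
          have h2 : u / (1 + u) ≤ 1 := by rw [div_le_one (by linarith)]; linarith
          rw [abs_le]; constructor <;> linarith
        refine ⟨⟨_, hz⟩, Subtype.ext ?_⟩
        change k ((1 + (2 * (u / (1 + u)) - 1)) / 2) = c u
        have h2 : u / (1 + u) < 1 := by rw [div_lt_one (by linarith)]; linarith
        rw [show (1 + (2 * (u / (1 + u)) - 1)) / 2 = u / (1 + u) by ring, hk1 _ h2]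
        congr 1
        have : 1 + u ≠ 0 := by linarith
        rw [show 1 - u / (1 + u) = 1 / (1 + u) by field_simp; ring]
        field_simp
      · have h : y = s0 := h
        have hz : lineHomeo 1 ∈ (closedBall (0 : Eu 1) 1 : Set (Eu 1)) := by
          rw [mem_closedBall_zero_iff, norm_eu1]
          change |(1 : ℝ)| ≤ 1
          simp
        refine ⟨⟨_, hz⟩, Subtype.ext ?_⟩
        change k ((1 + 1) / 2) = y
        rw [show (1 + 1 : ℝ) / 2 = 1 by norm_num, hk2, h]
  exact ⟨(Continuous.homeoOfEquivCompactToT2 (f := Equiv.ofBijective f hfb) hfc).symm⟩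

end Cantrell
end

/-- Cantrell's theorem: if `S` is an `(n-1)`-sphere in `Sⁿ` and `H` is a connected component
of `Sⁿ \ S` whose closure is a topological manifold with boundary, then the closure of `H`
is homeomorphic to the closed `n`-ball. -/
theorem cantrell (n : ℕ) [NeZero n]
    (S H : Set (Metric.sphere (0 : EuclideanSpace ℝ (Fin (n + 1))) 1))
    (hS : Nonempty (S ≃ₜ (Metric.sphere (0 : EuclideanSpace ℝ (Fin n)) 1 : Set _)))
    (hH : ∃ x ∈ Sᶜ, H = connectedComponentIn Sᶜ x)
    (hman : IsTopManifoldWithBoundary n (closure H)) :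
    Nonempty (closure H ≃ₜ (Metric.closedBall (0 : EuclideanSpace ℝ (Fin n)) 1 : Set _)) := by
  obtain ⟨e⟩ := hS
  obtain ⟨m, rfl⟩ : ∃ m, n = m + 1 := ⟨n - 1, (Nat.succ_pred (NeZero.ne n)).symm⟩
  rcases Nat.eq_zero_or_pos m with rfl | hm
  · exact Cantrell.case_one e hH
  · refine Cantrell.case_high hm e hH fun x hx => ?_
    obtain ⟨U, hxU, hU, V, hV, ⟨f⟩⟩ := hman.2.2 ⟨x, hx⟩
    exact Cantrell.chart_exists ⟨x, hx⟩ hU hxU hV f
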